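/- Let γ be the standard Gaussian measure on ℝⁿ, let r > 0, and let K and L be origin-symmetric convex bodies in ℝⁿ both containing r·B₂ⁿ. If p ∈ [0,1] satisfies p ≥ 1 − 2r²/(n+1), then for every λ ∈ [0,1], γ(λ·K +_p (1−λ)·L) ≥ γ(K)^λ · γ(L)^{1−λ}. -/

import Mathlib

open MeasureTheory
open scoped RealInnerProductSpace ENNReal

noncomputable section

abbrev Euc (n : ℕ) : Type := EuclideanSpace ℝ (Fin n)

/-- A convex body: a compact convex set with nonempty interior. -/
def IsConvexBody {n : ℕ} (K : Set (Euc n)) : Prop :=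
  IsCompact K ∧ Convex ℝ K ∧ (interior K).Nonempty

/-- The support function `h_K(u) = sup_{y ∈ K} ⟨u, y⟩`. -/
def suppFn {n : ℕ} (K : Set (Euc n)) (u : Euc n) : ℝ :=
  sSup ((fun y => ⟪u, y⟫) '' K)

/-- `lpComb p lam K L` is the `L_p` combination `lam·K +_p (1−lam)·L`;
for `p = 0` it is the logarithmic combination. -/
def lpComb {n : ℕ} (p lam : ℝ) (K L : Set (Euc n)) : Set (Euc n) :=
  if p = 0 then
    {x | ∀ u : Euc n, ‖u‖ = 1 → ⟪x, u⟫ ≤ suppFn K u ^ lam * suppFn L u ^ (1 - lam)}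
  else
    {x | ∀ u : Euc n, ‖u‖ = 1 →
      ⟪x, u⟫ ≤ (lam * suppFn K u ^ p + (1 - lam) * suppFn L u ^ p) ^ (1 / p)}


/-- The standard Gaussian measure on `ℝⁿ`, with density `(2π)^{-n/2} e^{-|x|²/2}`. -/
def gaussianMeasure (n : ℕ) : Measure (Euc n) :=
  volume.withDensity fun x =>
    ENNReal.ofReal ((2 * Real.pi) ^ (-(n : ℝ) / 2) * Real.exp (-‖x‖ ^ 2 / 2))

/-! ### Partial derivatives and integration by parts on Euclidean space -/

/-- The `i`-th partial derivative of a function on `ℝⁿ`. -/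
def pd {n : ℕ} (i : Fin n) (f : Euc n → ℝ) (x : Euc n) : ℝ :=
  fderiv ℝ f x (EuclideanSpace.single i 1)

/-- The density `e^{-W}`. -/
def wt {n : ℕ} (W : Euc n → ℝ) (x : Euc n) : ℝ := Real.exp (-W x)

/-- The generator `Δu - ⟨∇W, ∇u⟩` associated with the density `e^{-W}`. -/
def gen {n : ℕ} (W u : Euc n → ℝ) (x : Euc n) : ℝ :=
  ∑ i, (pd i (pd i u) x - pd i W x * pd i u x)

section Calculus

variable {n : ℕ}

lemma fderiv_apply_eq_sum (f : Euc n → ℝ) (x w : Euc n) :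
    fderiv ℝ f x w = ∑ i, w i * pd i f x := by
  have h : w = ∑ i, w i • EuclideanSpace.single i (1 : ℝ) := by
    ext j
    simp [Finset.sum_apply, Pi.single_apply]
  conv_lhs => rw [h]
  simp [pd]

lemma ContDiff.pd {f : Euc n → ℝ} {m k : WithTop ℕ∞} (hf : ContDiff ℝ k f) (h : m + 1 ≤ k)
    (i : Fin n) : ContDiff ℝ m (pd i f) :=
  (hf.fderiv_right h).clm_apply contDiff_const

lemma HasCompactSupport.pd {f : Euc n → ℝ} (hf : HasCompactSupport f) (i : Fin n) :
    HasCompactSupport (pd i f) :=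
  (hf.fderiv (𝕜 := ℝ)).comp_left (g := fun L : Euc n →L[ℝ] ℝ => L (EuclideanSpace.single i 1)) rfl

lemma pd_eq_zero_of_notMem_tsupport {f : Euc n → ℝ} {x : Euc n} (hx : x ∉ tsupport f)
    (i : Fin n) : pd i f x = 0 := by
  have : fderiv ℝ f x = 0 := by
    by_contra h
    exact hx (support_fderiv_subset ℝ (Function.mem_support.2 h))
  simp [pd, this]

lemma pd_mul {f g : Euc n → ℝ} {x : Euc n} (hf : DifferentiableAt ℝ f x)
    (hg : DifferentiableAt ℝ g x) (i : Fin n) :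
    pd i (fun y => f y * g y) x = pd i f x * g x + f x * pd i g x := by
  simp only [pd]
  rw [fderiv_fun_mul hf hg]
  simp
  ring

lemma pd_add {f g : Euc n → ℝ} {x : Euc n} (hf : DifferentiableAt ℝ f x)
    (hg : DifferentiableAt ℝ g x) (i : Fin n) :
    pd i (fun y => f y + g y) x = pd i f x + pd i g x := by
  simp only [pd]
  rw [fderiv_fun_add hf hg]
  simp

lemma pd_sub {f g : Euc n → ℝ} {x : Euc n} (hf : DifferentiableAt ℝ f x)
    (hg : DifferentiableAt ℝ g x) (i : Fin n) :
    pd i (fun y => f y - g y) x = pd i f x - pd i g x := by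
  simp only [pd]
  rw [fderiv_fun_sub hf hg]
  simp

lemma pd_sum {ι : Type*} (s : Finset ι) {f : ι → Euc n → ℝ} {x : Euc n}
    (hf : ∀ k ∈ s, DifferentiableAt ℝ (f k) x) (i : Fin n) :
    pd i (fun y => ∑ k ∈ s, f k y) x = ∑ k ∈ s, pd i (f k) x := by
  simp only [pd]
  rw [fderiv_fun_sum hf]
  simp

lemma pd_comm {f : Euc n → ℝ} (hf : ContDiff ℝ 2 f) (i j : Fin n) (x : Euc n) :
    pd i (pd j f) x = pd j (pd i f) x := by
  have hd : DifferentiableAt ℝ (fderiv ℝ f) x :=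
    ((hf.fderiv_right (m := 1) (by norm_num)).differentiable (by norm_num)) x
  have key : ∀ v w : Euc n, fderiv ℝ (fun y => fderiv ℝ f y v) x w = fderiv ℝ (fderiv ℝ f) x w v := by
    intro v w
    rw [fderiv_clm_apply hd (differentiableAt_const v)]
    simp
  have hs := hf.contDiffAt (x := x) |>.isSymmSndFDerivAt (by simp)
  change fderiv ℝ (fun y => fderiv ℝ f y _) x _ = fderiv ℝ (fun y => fderiv ℝ f y _) x _
  rw [key, key]
  exact hs.eq _ _

lemma contDiff_wt {W : Euc n → ℝ} {k : WithTop ℕ∞} (hW : ContDiff ℝ k W) :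
    ContDiff ℝ k (wt W) := Real.contDiff_exp.comp hW.neg

lemma wt_pos (W : Euc n → ℝ) (x : Euc n) : 0 < wt W x := Real.exp_pos _

lemma pd_wt {W : Euc n → ℝ} {x : Euc n} (hW : DifferentiableAt ℝ W x) (i : Fin n) :
    pd i (wt W) x = - pd i W x * wt W x := by
  simp only [pd]
  have : HasFDerivAt (wt W) (Real.exp (-W x) • (-(fderiv ℝ W x))) x := hW.hasFDerivAt.neg.exp
  rw [this.fderiv]
  simp [wt]
  ring

lemma integral_mul_pd {f g : Euc n → ℝ} (hf : ContDiff ℝ 1 f) (hg : ContDiff ℝ 1 g)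
    (hc : HasCompactSupport g) (i : Fin n) :
    ∫ x, f x * pd i g x = - ∫ x, pd i f x * g x := by
  have hf' := (hf.pd (m := 0) (by norm_num) i).continuous
  have hg' := (hg.pd (m := 0) (by norm_num) i).continuous
  refine integral_mul_fderiv_eq_neg_fderiv_mul_of_integrable ?_ ?_ ?_ ?_ ?_
  · exact (hf'.mul hg.continuous).integrable_of_hasCompactSupport (hc.mul_left)
  · exact (hf.continuous.mul hg').integrable_of_hasCompactSupport ((hc.pd i).mul_left)
  · exact (hf.continuous.mul hg.continuous).integrable_of_hasCompactSupport (hc.mul_left)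
  · exact fun x _ => hf.differentiable (by norm_num) x
  · exact fun x _ => hg.differentiable (by norm_num) x

lemma integral_mul_pd_wt {W f g : Euc n → ℝ} (hW : ContDiff ℝ 1 W) (hf : ContDiff ℝ 1 f)
    (hg : ContDiff ℝ 1 g) (hc : HasCompactSupport g) (i : Fin n) :
    ∫ x, f x * (pd i g x - pd i W x * g x) * wt W x = - ∫ x, pd i f x * g x * wt W x := by
  have h := integral_mul_pd hf (hg.mul (contDiff_wt hW)) (hc.mul_right (f' := wt W)) i
  have e : ∀ x, pd i (fun y => g y * wt W y) x = (pd i g x - pd i W x * g x) * wt W x := by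
    intro x
    rw [pd_mul (hg.differentiable (by norm_num) x)
      ((contDiff_wt hW).differentiable (by norm_num) x), pd_wt (hW.differentiable (by norm_num) x)]
    ring
  change ∫ x, f x * pd i (fun y => g y * wt W y) x = - ∫ x, pd i f x * (g x * wt W x) at h
  simp only [e, ← mul_assoc] at h
  exact h

lemma contDiff_gen {W u : Euc n → ℝ} (hW : ContDiff ℝ 2 W) (hu : ContDiff ℝ 3 u) :
    ContDiff ℝ 1 (gen W u) := by
  unfold gen
  refine ContDiff.sum fun i _ => ?_
  exact ((hu.pd (m := 2) (by norm_num) i).pd (by norm_num) i).sub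
    ((hW.pd (by norm_num) i).mul (hu.pd (by norm_num) i))

lemma continuous_gen {W u : Euc n → ℝ} (hW : ContDiff ℝ 1 W) (hu : ContDiff ℝ 2 u) :
    Continuous (gen W u) := by
  unfold gen
  refine continuous_finsetSum _ fun i _ => ?_
  exact ((hu.pd (m := 1) (by norm_num) i).pd (m := 0) (by norm_num) i).continuous.sub
    ((hW.pd (m := 0) (by norm_num) i).continuous.mul (hu.pd (m := 0) (by norm_num) i).continuous)

lemma gen_eq_zero_of_notMem_tsupport {W u : Euc n → ℝ} {x : Euc n} (hx : x ∉ tsupport u) :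
    gen W u x = 0 := by
  unfold gen
  refine Finset.sum_eq_zero fun i _ => ?_
  have h1 : x ∉ tsupport (pd i u) := by
    intro h
    refine hx (closure_minimal ?_ (isClosed_tsupport u) h)
    intro y hy
    by_contra hy'
    exact hy (pd_eq_zero_of_notMem_tsupport hy' i)
  rw [pd_eq_zero_of_notMem_tsupport hx, pd_eq_zero_of_notMem_tsupport h1]
  simp

lemma hasCompactSupport_gen {W u : Euc n → ℝ} (hc : HasCompactSupport u) :
    HasCompactSupport (gen W u) :=
  HasCompactSupport.intro hc fun _ hx => gen_eq_zero_of_notMem_tsupport hx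

lemma integral_mul_gen {W f u : Euc n → ℝ} (hW : ContDiff ℝ 1 W) (hf : ContDiff ℝ 1 f)
    (hu : ContDiff ℝ 2 u) (hc : HasCompactSupport u) :
    ∫ x, f x * gen W u x * wt W x = - ∫ x, (∑ i, pd i f x * pd i u x) * wt W x := by
  have hui : ∀ i, ContDiff ℝ 1 (pd i u) := fun i => hu.pd (by norm_num) i
  have hwc := (contDiff_wt hW).continuous
  simp only [gen, Finset.mul_sum, Finset.sum_mul]
  rw [integral_finsetSum, integral_finsetSum, ← Finset.sum_neg_distrib]
  · exact Finset.sum_congr rfl fun i _ => integral_mul_pd_wt hW hf (hui i) (hc.pd i) i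
  · intro i _
    refine Continuous.integrable_of_hasCompactSupport ?_ ((hc.pd i).mul_left.mul_right)
    exact ((hf.pd (m := 0) (by norm_num) i).continuous.mul (hui i).continuous).mul hwc
  · intro i _
    refine Continuous.integrable_of_hasCompactSupport ?_ (HasCompactSupport.mul_right
      (HasCompactSupport.mul_left (((hc.pd i).pd i).sub ((hc.pd i).mul_left))))
    exact (hf.continuous.mul (((hui i).pd (m := 0) (by norm_num) i).continuous.sub
      ((hW.pd (m := 0) (by norm_num) i).continuous.mul (hui i).continuous))).mul hwc

lemma pd_gen {W u : Euc n → ℝ} (hW : ContDiff ℝ 2 W) (hu : ContDiff ℝ 3 u) (j : Fin n)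
    (x : Euc n) :
    pd j (gen W u) x = gen W (pd j u) x - ∑ i, pd j (pd i W) x * pd i u x := by
  have h1 : ∀ i, ContDiff ℝ 1 (pd i (pd i u)) := fun i =>
    (hu.pd (m := 2) (by norm_num) i).pd (by norm_num) i
  have h2 : ∀ i, ContDiff ℝ 1 (pd i W) := fun i => hW.pd (by norm_num) i
  have h3 : ∀ i, ContDiff ℝ 2 (pd i u) := fun i => hu.pd (by norm_num) i
  have d1 : ∀ i, DifferentiableAt ℝ (pd i (pd i u)) x :=
    fun i => (h1 i).differentiable (by norm_num) x
  have d2 : ∀ i, DifferentiableAt ℝ (pd i W) x := fun i => (h2 i).differentiable (by norm_num) x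
  have d3 : ∀ i, DifferentiableAt ℝ (pd i u) x := fun i => (h3 i).differentiable (by norm_num) x
  have hu2 : ContDiff ℝ 2 u := hu.of_le (by norm_num)
  unfold gen
  have d4 : ∀ i, DifferentiableAt ℝ (fun y => pd i W y * pd i u y) x := fun i => (d2 i).mul (d3 i)
  have d5 : ∀ i, DifferentiableAt ℝ (fun y => pd i (pd i u) y - pd i W y * pd i u y) x :=
    fun i => (d1 i).sub (d4 i)
  rw [pd_sum _ (fun i _ => d5 i), ← Finset.sum_sub_distrib]
  refine Finset.sum_congr rfl fun i _ => ?_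
  rw [pd_sub (d1 i) (d4 i), pd_mul (d2 i) (d3 i), pd_comm (h3 i) j i,
    pd_comm hu2 j i]
  have : pd j (pd i u) = pd i (pd j u) := funext fun y => pd_comm hu2 j i y
  rw [this]
  ring

/-- The integrated Bochner formula. -/
lemma integral_gen_sq {W u : Euc n → ℝ} (hW : ContDiff ℝ 2 W) (hu : ContDiff ℝ 3 u)
    (hc : HasCompactSupport u) :
    ∫ x, gen W u x ^ 2 * wt W x =
      ∫ x, ((∑ j, ∑ i, pd i (pd j u) x ^ 2)
        + ∑ j, ∑ i, pd j (pd i W) x * pd i u x * pd j u x) * wt W x := by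
  have hW1 : ContDiff ℝ 1 W := hW.of_le (by norm_num)
  have hwc := (contDiff_wt hW).continuous
  have cu : ∀ i, ContDiff ℝ 2 (pd i u) := fun i => hu.pd (by norm_num) i
  have cW : ∀ i j, Continuous (pd j (pd i W)) := fun i j =>
    ((hW.pd (m := 1) (by norm_num) i).pd (m := 0) (by norm_num) j).continuous
  have cuu : ∀ i j, Continuous (pd i (pd j u)) := fun i j =>
    ((cu j).pd (m := 1) (by norm_num) i).continuous
  have h1 := integral_mul_gen hW1 (contDiff_gen hW hu) (hu.of_le (by norm_num)) hc
  have e1 : ∀ x, gen W u x ^ 2 * wt W x = gen W u x * gen W u x * wt W x := fun x => by ring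
  simp only [e1, h1, pd_gen hW hu]
  have i1 : ∀ j, Integrable fun x => pd j u x * gen W (pd j u) x * wt W x := fun j =>
    (((cu j).continuous.mul (continuous_gen hW1 (cu j))).mul hwc).integrable_of_hasCompactSupport
      ((hc.pd j).mul_right.mul_right)
  have i2 : ∀ j, Integrable fun x =>
      (∑ i, pd j (pd i W) x * pd i u x * pd j u x) * wt W x := fun j => by
    refine Continuous.integrable_of_hasCompactSupport ?_ ?_
    · exact (continuous_finsetSum _ fun i _ =>
        ((cW i j).mul (cu i).continuous).mul (cu j).continuous).mul hwc
    · have : HasCompactSupport fun x => (∑ i, pd j (pd i W) x * pd i u x) * pd j u x :=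
        (hc.pd j).mul_left
      simp only [Finset.sum_mul] at this
      exact this.mul_right
  have i3 : ∀ j, Integrable fun x => (∑ i, pd i (pd j u) x ^ 2) * wt W x := fun j => by
    simp only [Finset.sum_mul]
    refine integrable_finsetSum _ fun i _ => ?_
    refine Continuous.integrable_of_hasCompactSupport (((cuu i j).pow 2).mul hwc) ?_
    simp only [sq]
    exact ((hc.pd j).pd i).mul_right.mul_right
  have e2 : ∀ x, (∑ j, (gen W (pd j u) x - ∑ i, pd j (pd i W) x * pd i u x) * pd j u x) * wt W x
      = ∑ j, (pd j u x * gen W (pd j u) x * wt W x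
        - (∑ i, pd j (pd i W) x * pd i u x * pd j u x) * wt W x) := by
    intro x
    rw [Finset.sum_mul]
    refine Finset.sum_congr rfl fun j _ => ?_
    rw [← Finset.sum_mul]
    ring
  have e3 : ∀ x, ((∑ j, ∑ i, pd i (pd j u) x ^ 2)
        + ∑ j, ∑ i, pd j (pd i W) x * pd i u x * pd j u x) * wt W x
      = ∑ j, ((∑ i, pd i (pd j u) x ^ 2) * wt W x
        + (∑ i, pd j (pd i W) x * pd i u x * pd j u x) * wt W x) := by
    intro x
    rw [← Finset.sum_add_distrib, Finset.sum_mul]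
    exact Finset.sum_congr rfl fun j _ => by ring
  simp only [e2, e3]
  rw [integral_finsetSum _ fun j _ => by exact (i1 j).sub (i2 j),
    integral_finsetSum _ fun j _ => by exact (i3 j).add (i2 j), ← Finset.sum_neg_distrib]
  refine Finset.sum_congr rfl fun j _ => ?_
  rw [integral_sub (i1 j) (i2 j), integral_add (i3 j) (i2 j),
    integral_mul_gen hW1 ((cu j).of_le (by norm_num)) (cu j) (hc.pd j)]
  simp only [sq]
  ring

end Calculus

/-! ### Mollification -/

/-- A smooth probability density supported in the ball of radius `ε`. -/
structure IsMollifier {n : ℕ} (ρ : Euc n → ℝ) (ε : ℝ) : Prop where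
  smooth : ContDiff ℝ (⊤ : ℕ∞) ρ
  compact : HasCompactSupport ρ
  nonneg : ∀ x, 0 ≤ ρ x
  integral_eq_one : ∫ x, ρ x = 1
  eq_zero : ∀ x, ε ≤ ‖x‖ → ρ x = 0

/-- The convolution `ρ * m`. -/
def mollify {n : ℕ} (ρ m : Euc n → ℝ) (y : Euc n) : ℝ := ∫ x, ρ (y - x) * m x

section Mollify

variable {n : ℕ}

lemma ContDiffBump.isMollifier_normed (φ : ContDiffBump (0 : Euc n)) :
    IsMollifier (φ.normed volume) φ.rOut where
  smooth := φ.contDiff_normed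
  compact := φ.hasCompactSupport_normed
  nonneg := φ.nonneg_normed
  integral_eq_one := φ.integral_normed
  eq_zero x hx := by
    by_contra h
    have : x ∈ Function.support (φ.normed volume) := h
    rw [φ.support_normed_eq, mem_ball_zero_iff] at this
    linarith

lemma mollify_eq_convolution (ρ m : Euc n → ℝ) :
    mollify ρ m = convolution ρ m (ContinuousLinearMap.lsmul ℝ ℝ) volume := by
  funext y
  rw [convolution_lsmul_swap]
  simp [mollify]

lemma integrable_mollify_integrand {ρ m : Euc n → ℝ} (hρ : Continuous ρ)
    (hc : HasCompactSupport ρ) (hm : LocallyIntegrable m) (y : Euc n) :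
    Integrable fun x => ρ (y - x) * m x := by
  have h := hm.integrable_smul_left_of_hasCompactSupport
    (g := fun x => ρ (y - x)) (by fun_prop) (hc.comp_homeomorph (Homeomorph.subLeft y))
  simpa using h

lemma contDiff_mollify {ρ m : Euc n → ℝ} (hρ : ContDiff ℝ (⊤ : ℕ∞) ρ)
    (hc : HasCompactSupport ρ) (hm : LocallyIntegrable m) :
    ContDiff ℝ (⊤ : ℕ∞) (mollify ρ m) := by
  rw [mollify_eq_convolution]
  exact hc.contDiff_convolution_left _ hρ hm

lemma pd_mollify {ρ m : Euc n → ℝ} (hρ : ContDiff ℝ 1 ρ)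
    (hc : HasCompactSupport ρ) (hm : LocallyIntegrable m) (i : Fin n) :
    pd i (mollify ρ m) = mollify (pd i ρ) m := by
  funext y
  rw [mollify_eq_convolution, pd,
    (hc.hasFDerivAt_convolution_left (ContinuousLinearMap.lsmul ℝ ℝ) hρ hm y).fderiv,
    convolution_eq_swap, ContinuousLinearMap.integral_apply]
  · simp [mollify, pd, ContinuousLinearMap.precompL]
  · have h := ((hc.fderiv (𝕜 := ℝ)).convolutionExists_left
      ((ContinuousLinearMap.lsmul ℝ ℝ).precompL (Euc n) : _ →L[ℝ] ℝ →L[ℝ] _)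
      (hρ.continuous_fderiv (by norm_num)) hm y)
    exact (convolutionExistsAt_iff_integrable_swap).1 h

lemma integral_mollifier_sub {ρ : Euc n → ℝ} {ε : ℝ} (hρ : IsMollifier ρ ε) (y : Euc n) :
    ∫ x, ρ (y - x) = 1 := by
  rw [integral_sub_left_eq_self ρ volume y, hρ.integral_eq_one]

lemma mollify_sq_le {ρ k : Euc n → ℝ} {ε : ℝ} (hρ : IsMollifier ρ ε) (hk : LocallyIntegrable k)
    (hk2 : LocallyIntegrable fun x => k x ^ 2) (y : Euc n) :
    mollify ρ k y ^ 2 ≤ mollify ρ (fun x => k x ^ 2) y := by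
  set a := mollify ρ k y with ha
  have i1 := integrable_mollify_integrand hρ.smooth.continuous hρ.compact hk y
  have i2 := integrable_mollify_integrand hρ.smooth.continuous hρ.compact hk2 y
  have i0 : Integrable fun x => ρ (y - x) :=
    (hρ.smooth.continuous.integrable_of_hasCompactSupport hρ.compact).comp_sub_left y
  have h : 0 ≤ ∫ x, (ρ (y - x) * k x ^ 2 - (2 * a) * (ρ (y - x) * k x) + a ^ 2 * ρ (y - x)) := by
    refine integral_nonneg fun x => ?_
    have := mul_nonneg (hρ.nonneg (y - x)) (sq_nonneg (k x - a))
    simp only [Pi.zero_apply]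
    nlinarith
  rw [integral_add (by exact i2.sub (i1.const_mul _)) (by exact i0.const_mul _),
    integral_sub i2 (i1.const_mul _),
    integral_const_mul, integral_const_mul, integral_mollifier_sub hρ] at h
  change 0 ≤ mollify ρ (fun x => k x ^ 2) y - 2 * a * a + _ at h
  nlinarith

lemma integrable_mollify {ρ m : Euc n → ℝ} {ε : ℝ} (hρ : IsMollifier ρ ε) (hm : Integrable m) :
    Integrable (mollify ρ m) := by
  rw [mollify_eq_convolution]
  exact (hρ.smooth.continuous.integrable_of_hasCompactSupport hρ.compact).integrable_convolution
    _ hm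

lemma integral_mollify {ρ m : Euc n → ℝ} {ε : ℝ} (hρ : IsMollifier ρ ε) (hm : Integrable m) :
    ∫ y, mollify ρ m y = ∫ x, m x := by
  rw [mollify_eq_convolution, integral_convolution _
    (hρ.smooth.continuous.integrable_of_hasCompactSupport hρ.compact) hm, hρ.integral_eq_one]
  simp

lemma abs_mollify_le {ρ m k : Euc n → ℝ} {ε C : ℝ} (hρ : IsMollifier ρ ε)
    (hk : LocallyIntegrable k) {y : Euc n}
    (h : ∀ x, ‖y - x‖ < ε → |m x| ≤ C * k x) : |mollify ρ m y| ≤ C * mollify ρ k y := by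
  have i1 := integrable_mollify_integrand hρ.smooth.continuous hρ.compact hk y
  unfold mollify
  rw [← integral_const_mul, ← Real.norm_eq_abs]
  refine norm_integral_le_of_norm_le (i1.const_mul _) (Filter.Eventually.of_forall fun x => ?_)
  rcases lt_or_ge ‖y - x‖ ε with hx | hx
  · rw [norm_mul, Real.norm_eq_abs, Real.norm_eq_abs, abs_of_nonneg (hρ.nonneg _)]
    calc _ ≤ ρ (y - x) * (C * k x) := mul_le_mul_of_nonneg_left (h x hx) (hρ.nonneg _)
      _ = _ := by ring
  · simp [hρ.eq_zero _ hx]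

/-- Mollification against a continuous compactly supported test function. -/
lemma abs_integral_mollify_mul_sub_le {m κ : Euc n → ℝ} (hm : LocallyIntegrable m)
    (hκ : Continuous κ) (hκc : HasCompactSupport κ) {δ : ℝ} (hδ : 0 < δ) :
    ∃ ε₀ > 0, ∀ ρ ε, IsMollifier ρ ε → ε < ε₀ →
      |(∫ y, mollify ρ m y * κ y) - ∫ y, m y * κ y| ≤ δ := by
  set B : Set (Euc n) := Metric.cthickening 1 (tsupport κ) with hB
  have hBc : IsCompact B := hκc.isCompact.cthickening
  set m₁ : Euc n → ℝ := B.indicator m with hm₁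
  have hm₁i : Integrable m₁ := (integrable_indicator_iff hBc.measurableSet).2
    (hm.integrableOn_isCompact hBc)
  set A := ∫ x, |m₁ x| with hA
  have hA0 : 0 ≤ A := integral_nonneg fun _ => abs_nonneg _
  have huc : UniformContinuous κ := hκ.uniformContinuous_of_tendsto_cocompact
    (x := 0) hκc.is_zero_at_infty
  obtain ⟨ε₁, hε₁, hu⟩ := Metric.uniformContinuous_iff.1 huc (δ / (A + 1)) (by positivity)
  refine ⟨min ε₁ 1, by positivity, fun ρ ε hρ hε => ?_⟩
  have hρi := hρ.smooth.continuous.integrable_of_hasCompactSupport hρ.compact (μ := volume)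
  have e1 : ∀ y, mollify ρ m y * κ y = ∫ x, ρ (y - x) * m₁ x * κ y := by
    intro y
    rw [integral_mul_const]
    by_cases hy : y ∈ tsupport κ
    · congr 1
      refine integral_congr_ae (Filter.Eventually.of_forall fun x => ?_)
      simp only
      by_cases hx : x ∈ B
      · simp [hm₁, hx]
      · rw [hρ.eq_zero (y - x), zero_mul, zero_mul]
        by_contra hlt
        push Not at hlt
        refine hx (Metric.mem_cthickening_of_dist_le x y 1 _ hy ?_)
        rw [dist_comm, dist_eq_norm]
        have := min_le_right ε₁ 1
        linarith
    · rw [image_eq_zero_of_notMem_tsupport hy]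
      simp
  have e2 : ∀ y, m y * κ y = m₁ y * κ y := by
    intro y
    by_cases hy : y ∈ tsupport κ
    · have : y ∈ B := Metric.self_subset_cthickening _ hy
      simp [hm₁, this]
    · rw [image_eq_zero_of_notMem_tsupport hy]
      simp
  have hint : Integrable (Function.uncurry fun y x => ρ (y - x) * m₁ x * κ y)
      (volume.prod volume) := by
    obtain ⟨C, hC⟩ := hκ.bounded_above_of_compact_support hκc
    have := Integrable.convolution_integrand (ContinuousLinearMap.mul ℝ ℝ) hm₁i hρi
    refine Integrable.mul_bdd (c := C) (f := fun p : Euc n × Euc n => ρ (p.1 - p.2) * m₁ p.2)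
      (g := fun p => κ p.1) ?_ (by fun_prop) (Filter.Eventually.of_forall fun p => hC p.1)
    refine this.congr (Filter.Eventually.of_forall fun p => ?_)
    simp [mul_comm]
  simp only [e1, e2]
  have i4 : Integrable fun x => ∫ y, ρ (y - x) * m₁ x * κ y := hint.integral_prod_right
  rw [integral_integral_swap hint, ← integral_sub i4
    (hm₁i.mul_bdd (c := (hκ.bounded_above_of_compact_support hκc).choose)
    hκ.aestronglyMeasurable
    (Filter.Eventually.of_forall (hκ.bounded_above_of_compact_support hκc).choose_spec)),
    ← Real.norm_eq_abs]
  have hb : ∀ x, ‖(∫ y, ρ (y - x) * m₁ x * κ y) - m₁ x * κ x‖ ≤ |m₁ x| * (δ / (A + 1)) := by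
    intro x
    have h1 : ∫ y, ρ (y - x) = 1 := by
      rw [integral_sub_right_eq_self ρ x, hρ.integral_eq_one]
    have i1 : Integrable fun y => ρ (y - x) := hρi.comp_sub_right x
    have i2 : Integrable fun y => ρ (y - x) * κ y :=
      (by fun_prop : Continuous κ).integrable_of_hasCompactSupport hκc |>.bdd_mul
        (c := (hρ.smooth.continuous.bounded_above_of_compact_support hρ.compact).choose)
        (by have := hρ.smooth.continuous; fun_prop) (Filter.Eventually.of_forall fun y =>
          (hρ.smooth.continuous.bounded_above_of_compact_support hρ.compact).choose_spec _)
    have h2 : (∫ y, ρ (y - x) * m₁ x * κ y) - m₁ x * κ x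
        = m₁ x * ∫ y, ρ (y - x) * (κ y - κ x) := by
      have : ∫ y, ρ (y - x) * m₁ x * κ y = m₁ x * ∫ y, ρ (y - x) * κ y := by
        rw [← integral_const_mul]
        exact integral_congr_ae (Filter.Eventually.of_forall fun y => by ring)
      rw [this]
      simp only [mul_sub]
      rw [integral_sub i2 (i1.mul_const _), integral_mul_const, h1]
      ring
    rw [h2, norm_mul, Real.norm_eq_abs]
    refine mul_le_mul_of_nonneg_left ?_ (abs_nonneg _)
    have h3 : ∫ y, ρ (y - x) * (δ / (A + 1)) = δ / (A + 1) := by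
      rw [integral_mul_const, h1, one_mul]
    rw [← h3]
    refine norm_integral_le_of_norm_le (i1.mul_const _) (Filter.Eventually.of_forall fun y => ?_)
    rw [norm_mul, Real.norm_eq_abs, abs_of_nonneg (hρ.nonneg _)]
    rcases lt_or_ge ‖y - x‖ ε with hy | hy
    · refine mul_le_mul_of_nonneg_left ?_ (hρ.nonneg _)
      have := hu (a := y) (b := x)
        (by rw [dist_eq_norm]; exact hy.trans (hε.trans_le (min_le_left _ _)))
      exact this.le
    · simp [hρ.eq_zero _ hy]
  refine (norm_integral_le_of_norm_le (hm₁i.abs.mul_const _)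
    (Filter.Eventually.of_forall hb)).trans ?_
  rw [integral_mul_const, ← hA, ← mul_div_assoc, div_le_iff₀ (by positivity)]
  nlinarith

lemma exists_isMollifier (ε : ℝ) (hε : 0 < ε) : ∃ ρ : Euc n → ℝ, IsMollifier ρ ε :=
  ⟨_, ContDiffBump.isMollifier_normed (⟨ε / 2, ε, by positivity, by linarith⟩ :
    ContDiffBump (0 : Euc n))⟩

/-- A locally integrable function with vanishing weak gradient is almost everywhere constant. -/
lemma ae_eq_const_of_weak_gradient_eq_zero {f : Euc n → ℝ} (hf : LocallyIntegrable f)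
    (h : ∀ θ : Euc n → ℝ, ContDiff ℝ (⊤ : ℕ∞) θ → HasCompactSupport θ → ∀ i,
      ∫ x, f x * pd i θ x = 0) : ∃ c : ℝ, f =ᵐ[volume] fun _ => c := by
  let φ : ℕ → ContDiffBump (0 : Euc n) := fun j =>
    ⟨1 / ((j : ℝ) + 1) / 2, 1 / ((j : ℝ) + 1), by positivity, by
      have : 0 < 1 / ((j : ℝ) + 1) := by positivity
      linarith⟩
  have hφ : Filter.Tendsto (fun j => (φ j).rOut) Filter.atTop (nhds 0) :=
    tendsto_one_div_add_atTop_nhds_zero_nat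
  have hlim := ContDiffBump.ae_convolution_tendsto_right_of_locallyIntegrable (μ := volume) (K := 2) hφ
    (Filter.Eventually.of_forall fun j => by simp only [φ]; linarith) hf
  have hconst : ∀ j y, mollify ((φ j).normed volume) f y = mollify ((φ j).normed volume) f 0 := by
    intro j y
    have hM := (φ j).isMollifier_normed
    refine is_const_of_fderiv_eq_zero (𝕜 := ℝ)
      ((contDiff_mollify hM.smooth hM.compact hf).differentiable (by norm_num)) (fun z => ?_) y 0
    ext w
    rw [fderiv_apply_eq_sum]
    simp only [zero_apply]
    refine Finset.sum_eq_zero fun i _ => ?_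
    rw [pd_mollify (hM.smooth.of_le (by exact_mod_cast le_top)) hM.compact hf]
    have key := h (fun x => (φ j).normed volume (z - x)) (hM.smooth.comp (contDiff_const.sub contDiff_id))
      (hM.compact.comp_homeomorph (Homeomorph.subLeft z)) i
    have e : ∀ x, pd i (fun x => (φ j).normed volume (z - x)) x
        = - pd i ((φ j).normed volume) (z - x) := by
      intro x
      simp only [pd]
      have hd : DifferentiableAt ℝ ((φ j).normed volume) (z - x) :=
        hM.smooth.differentiable (by norm_num) _
      have hd2 : HasFDerivAt (fun x : Euc n => z - x) (-ContinuousLinearMap.id ℝ (Euc n)) x :=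
        (hasFDerivAt_id x).const_sub z
      have := (hd.hasFDerivAt.comp x hd2).fderiv
      simp only [Function.comp_def] at this
      rw [this]
      simp
    simp only [e, mul_neg, integral_neg, neg_eq_zero] at key
    unfold mollify
    simp only [mul_comm (pd i _ _), key, mul_zero]
  simp only [← mollify_eq_convolution] at hlim
  have hne : (MeasureTheory.ae (volume : Measure (Euc n))).NeBot := inferInstance
  obtain ⟨x₀, hx₀⟩ := hlim.exists
  refine ⟨f x₀, ?_⟩
  filter_upwards [hlim] with x hx
  refine tendsto_nhds_unique hx (hx₀.congr fun j => ?_)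
  rw [hconst j x, hconst j x₀]

end Mollify

/-! ### Density of the range of the generator -/

section Density

variable {n : ℕ}

/-- Smooth cutoff functions at scale `R` with gradient `O(1/R)`. -/
lemma exists_cutoff (n : ℕ) : ∃ C : ℝ, 0 ≤ C ∧ ∀ R : ℝ, 0 < R → ∃ η : Euc n → ℝ,
    ContDiff ℝ (⊤ : ℕ∞) η ∧ HasCompactSupport η ∧ (∀ x, 0 ≤ η x) ∧ (∀ x, η x ≤ 1) ∧
    (∀ x, ‖x‖ ≤ R → η x = 1) ∧ (∀ x, 2 * R ≤ ‖x‖ → η x = 0) ∧ ∀ i x, |pd i η x| ≤ C / R := by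
  let b : ContDiffBump (0 : Euc n) := ⟨1, 2, by norm_num, by norm_num⟩
  have hb : ContDiff ℝ (⊤ : ℕ∞) b := b.contDiff
  have hbc : HasCompactSupport b := b.hasCompactSupport
  have h1 : ∀ i, ∃ C, ∀ x, ‖pd i b x‖ ≤ C := fun i =>
    (((hb.of_le (by exact_mod_cast le_top) : ContDiff ℝ 1 b).pd (m := 0) (by norm_num)
      i).continuous).bounded_above_of_compact_support (hbc.pd i)
  choose C hC using h1
  have hC0 : ∀ i, 0 ≤ C i := fun i => (norm_nonneg _).trans (hC i 0)
  refine ⟨∑ i, C i, Finset.sum_nonneg fun i _ => hC0 i, fun R hR => ⟨fun x => b (R⁻¹ • x), ?_, ?_,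
    fun x => b.nonneg, fun x => b.le_one, ?_, ?_, ?_⟩⟩
  · exact hb.comp (contDiff_const_smul R⁻¹)
  · exact hbc.comp_homeomorph (Homeomorph.smulOfNeZero R⁻¹ (by positivity))
  · intro x hx
    refine b.one_of_mem_closedBall ?_
    rw [mem_closedBall_zero_iff, norm_smul, norm_inv, Real.norm_of_nonneg hR.le]
    change R⁻¹ * ‖x‖ ≤ 1
    rw [inv_mul_le_iff₀ hR]
    linarith
  · intro x hx
    refine b.zero_of_le_dist ?_
    rw [dist_zero_right, norm_smul, norm_inv, Real.norm_of_nonneg hR.le]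
    change 2 ≤ R⁻¹ * ‖x‖
    rw [le_inv_mul_iff₀ hR]
    linarith
  · intro i x
    have hd : HasFDerivAt (fun x : Euc n => R⁻¹ • x) (R⁻¹ • ContinuousLinearMap.id ℝ (Euc n)) x :=
      (hasFDerivAt_id x).const_smul R⁻¹
    have := (((hb.differentiable (by norm_num)) (R⁻¹ • x)).hasFDerivAt.comp x hd).fderiv
    simp only [Function.comp_def] at this
    rw [pd, this]
    have e : (fderiv ℝ b (R⁻¹ • x) ∘SL (R⁻¹ • ContinuousLinearMap.id ℝ (Euc n)))
        (EuclideanSpace.single i 1) = R⁻¹ * pd i b (R⁻¹ • x) := by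
      simp [pd]
    rw [e, abs_mul, abs_of_pos (by positivity : 0 < R⁻¹), div_eq_inv_mul]
    refine mul_le_mul_of_nonneg_left ?_ (by positivity)
    exact (hC i _).trans (Finset.single_le_sum (fun i _ => hC0 i) (Finset.mem_univ i))

/-- Energy estimate for a weak solution of `div (e^{-W} ∇G) = div R`. -/
lemma energy_estimate {W G η : Euc n → ℝ} {R : Fin n → Euc n → ℝ} (hW : ContDiff ℝ 1 W)
    (hG : ContDiff ℝ 1 G) (hη : ContDiff ℝ 1 η) (hc : HasCompactSupport η)
    (hR : ∀ i, Continuous (R i))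
    (h : ∀ ζ : Euc n → ℝ, ContDiff ℝ 1 ζ → HasCompactSupport ζ →
      ∑ i, ∫ x, pd i ζ x * (wt W x * pd i G x - R i x) = 0) :
    ∑ i, ∫ x, wt W x * η x ^ 2 * pd i G x ^ 2 ≤
      2 * ∑ i, ∫ x, (5 * (wt W x * pd i η x ^ 2 * G x ^ 2)
        + 2 * (η x ^ 2 * R i x ^ 2 / wt W x)) := by
  have cW := (contDiff_wt hW).continuous
  have cG : ∀ i, Continuous (pd i G) := fun i => (hG.pd (m := 0) (by norm_num) i).continuous
  have cη : ∀ i, Continuous (pd i η) := fun i => (hη.pd (m := 0) (by norm_num) i).continuous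
  have hη2 : ContDiff ℝ 1 fun x => η x ^ 2 := hη.pow 2
  have hη2c : HasCompactSupport fun x => η x ^ 2 := by
    simp only [sq]
    exact hc.mul_left
  have key := h (fun x => η x ^ 2 * G x) (hη2.mul hG) hη2c.mul_right
  have e : ∀ i x, pd i (fun x => η x ^ 2 * G x) x
      = 2 * η x * pd i η x * G x + η x ^ 2 * pd i G x := by
    intro i x
    have dη := hη.differentiable (by norm_num) x
    rw [pd_mul (hη2.differentiable (by norm_num) x) (hG.differentiable (by norm_num) x)]
    simp only [sq]
    rw [pd_mul dη dη]
    ring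
  simp only [e] at key
  have i1 : ∀ i, Integrable fun x => wt W x * η x ^ 2 * pd i G x ^ 2 := fun i =>
    ((cW.mul (hη2.continuous)).mul ((cG i).pow 2)).integrable_of_hasCompactSupport
      (hη2c.mul_left.mul_right)
  have i2 : ∀ i, Integrable fun x => 5 * (wt W x * pd i η x ^ 2 * G x ^ 2)
        + 2 * (η x ^ 2 * R i x ^ 2 / wt W x) := fun i => by
    refine Integrable.add (Integrable.const_mul ?_ _) (Integrable.const_mul ?_ _)
    · refine ((cW.mul ((cη i).pow 2)).mul (hG.continuous.pow 2)).integrable_of_hasCompactSupport ?_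
      simp only [sq]
      exact ((hc.pd i).mul_left).mul_left.mul_right
    · refine ((hη2.continuous.mul ((hR i).pow 2)).div cW
        fun x => (wt_pos W x).ne').integrable_of_hasCompactSupport ?_
      simp only [div_eq_mul_inv]
      exact hη2c.mul_right.mul_right
  have i3 : ∀ i, Integrable fun x => (2 * η x * pd i η x * G x + η x ^ 2 * pd i G x) *
      (wt W x * pd i G x - R i x) := fun i => by
    have c1 := hη.continuous
    have c2 := hG.continuous
    have c3 := cG i
    have c4 := cη i
    have c5 := hR i
    refine Continuous.integrable_of_hasCompactSupport (by fun_prop) (HasCompactSupport.mul_right ?_)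
    refine HasCompactSupport.add ?_ hη2c.mul_right
    exact ((hc.mul_left).mul_right).mul_right
  rw [Finset.mul_sum]
  have : ∀ i, ∫ x, wt W x * η x ^ 2 * pd i G x ^ 2 ≤
      2 * (∫ x, (5 * (wt W x * pd i η x ^ 2 * G x ^ 2)
        + 2 * (η x ^ 2 * R i x ^ 2 / wt W x))) +
      2 * ∫ x, (2 * η x * pd i η x * G x + η x ^ 2 * pd i G x) *
      (wt W x * pd i G x - R i x) := by
    intro i
    rw [← integral_const_mul, ← integral_const_mul,
      ← integral_add (by exact (i2 i).const_mul 2) (by exact (i3 i).const_mul 2)]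
    refine integral_mono (i1 i) (((i2 i).const_mul 2).add ((i3 i).const_mul 2)) fun x => ?_
    simp only
    have hw := wt_pos W x
    set s := Real.sqrt (wt W x)
    have hs : s ^ 2 = wt W x := Real.sq_sqrt hw.le
    have hs0 : 0 < s := Real.sqrt_pos.2 hw
    rw [← hs]
    have e1 : η x ^ 2 * R i x ^ 2 / s ^ 2 = (η x * R i x / s) ^ 2 := by
      field_simp
    have e2 : R i x * η x = s * (η x * R i x / s) := by field_simp
    rw [e1]
    set C := η x * R i x / s
    have e3 : (2 * η x * pd i η x * G x + η x ^ 2 * pd i G x) * (s ^ 2 * pd i G x - R i x)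
      = (s * η x * pd i G x) ^ 2 - (s * η x * pd i G x) * C
        + 2 * (s * η x * pd i G x) * (s * G x * pd i η x) - 2 * (s * G x * pd i η x) * C := by
      linear_combination (-2 * pd i η x * G x - η x * pd i G x) * e2
    rw [e3]
    set A := s * η x * pd i G x
    set B := s * G x * pd i η x
    have e4 : s ^ 2 * η x ^ 2 * pd i G x ^ 2 = A ^ 2 := by ring
    have e5 : s ^ 2 * pd i η x ^ 2 * G x ^ 2 = B ^ 2 := by ring
    rw [e4, e5]
    nlinarith [sq_nonneg (A - 2 * C + 4 * B), sq_nonneg (A-4*B), sq_nonneg (A - 2 * C), sq_nonneg (B - C)]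
  refine (Finset.sum_le_sum fun i _ => this i).trans_eq ?_
  rw [Finset.sum_add_distrib, ← Finset.mul_sum (f := fun i => ∫ x, (2 * η x * pd i η x * G x
    + η x ^ 2 * pd i G x) * (wt W x * pd i G x - R i x)), key]
  ring

end Density

section Liouville

variable {n : ℕ}

lemma pd_comp_const_sub {f : Euc n → ℝ} (hf : Differentiable ℝ f) (y x : Euc n) (i : Fin n) :
    pd i (fun z => f (y - z)) x = - pd i f (y - x) := by
  have hd : HasFDerivAt (fun x : Euc n => y - x) (-ContinuousLinearMap.id ℝ (Euc n)) x :=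
    (hasFDerivAt_id x).const_sub y
  have := ((hf (y - x)).hasFDerivAt.comp x hd).fderiv
  simp only [Function.comp_def] at this
  rw [pd, this]
  simp [pd]

/-- Mollifying a weak solution of the adjoint equation gives a divergence-free field. -/
lemma divergence_mollify_eq_zero {W m ρ : Euc n → ℝ} (hW : ContDiff ℝ 1 W)
    (hm : LocallyIntegrable m)
    (h : ∀ u : Euc n → ℝ, ContDiff ℝ (⊤ : ℕ∞) u → HasCompactSupport u →
      ∫ x, m x * gen W u x = 0)
    (hρ : ContDiff ℝ (⊤ : ℕ∞) ρ) (hc : HasCompactSupport ρ) (y : Euc n) :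
    ∑ i, pd i (fun z => pd i (mollify ρ m) z + mollify ρ (fun x => m x * pd i W x) z) y = 0 := by
  have cW : ∀ i, Continuous (pd i W) := fun i => (hW.pd (m := 0) (by norm_num) i).continuous
  have hρi : ∀ i, ContDiff ℝ (⊤ : ℕ∞) (pd i ρ) := fun i => hρ.pd (by simp) i
  have hρii : ∀ i, ContDiff ℝ (⊤ : ℕ∞) (pd i (pd i ρ)) := fun i => (hρi i).pd (by simp) i
  have hle : (1 : WithTop ℕ∞) ≤ (⊤ : ℕ∞) := by exact_mod_cast le_top
  have hmW : ∀ i, LocallyIntegrable fun x => m x * pd i W x := fun i => hm.mul_continuous (cW i)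
  have key := h (fun x => ρ (y - x)) (hρ.comp (contDiff_const.sub contDiff_id))
    (hc.comp_homeomorph (Homeomorph.subLeft y))
  have e1 : ∀ i, pd i (fun x => ρ (y - x)) = fun x => - pd i ρ (y - x) := fun i =>
    funext fun x => pd_comp_const_sub (hρ.differentiable (by norm_num)) y x i
  have e2 : ∀ i x, pd i (fun x => - pd i ρ (y - x)) x = pd i (pd i ρ) (y - x) := by
    intro i x
    have : pd i (fun x => - pd i ρ (y - x)) x = - pd i (fun x => pd i ρ (y - x)) x := by
      simp [pd]
    rw [this, pd_comp_const_sub ((hρi i).differentiable (by norm_num)), neg_neg]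
  have e3 : ∀ x, m x * gen W (fun x => ρ (y - x)) x
      = ∑ i, (pd i (pd i ρ) (y - x) * m x + pd i ρ (y - x) * (m x * pd i W x)) := by
    intro x
    rw [gen, Finset.mul_sum]
    refine Finset.sum_congr rfl fun i _ => ?_
    rw [e1, e2]
    ring
  simp only [e3] at key
  have i1 := fun i => integrable_mollify_integrand (hρii i).continuous ((hc.pd i).pd i) hm y
  have i2 := fun i => integrable_mollify_integrand (hρi i).continuous (hc.pd i) (hmW i) y
  rw [integral_finsetSum _ (fun i _ => by exact (i1 i).add (i2 i))] at key
  rw [← key]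
  refine Finset.sum_congr rfl fun i _ => ?_
  rw [integral_add (i1 i) (i2 i)]
  have c1 := contDiff_mollify hρ hc hm
  have c2 := contDiff_mollify hρ hc (hmW i)
  have c3 : ContDiff ℝ (⊤ : ℕ∞) (pd i (mollify ρ m)) := c1.pd (by simp) i
  rw [pd_add (c3.differentiable (by norm_num) y) (c2.differentiable (by norm_num) y),
    pd_mollify (hρ.of_le hle) hc hm, pd_mollify ((hρi i).of_le hle) (hc.pd i) hm,
    pd_mollify (hρ.of_le hle) hc (hmW i)]
  rfl

/-- The weak form of the equation satisfied by the mollified density quotient. -/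
lemma sum_integral_pd_mul_flux_eq_zero {W m ρ : Euc n → ℝ} (hW : ContDiff ℝ 2 W)
    (hm : LocallyIntegrable m)
    (h : ∀ u : Euc n → ℝ, ContDiff ℝ (⊤ : ℕ∞) u → HasCompactSupport u →
      ∫ x, m x * gen W u x = 0)
    (hρ : ContDiff ℝ (⊤ : ℕ∞) ρ) (hc : HasCompactSupport ρ) {ζ : Euc n → ℝ}
    (hζ : ContDiff ℝ 1 ζ) (hζc : HasCompactSupport ζ) :
    ∑ i, ∫ x, pd i ζ x * (wt W x * pd i (fun z => Real.exp (W z) * mollify ρ m z) x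
      - (pd i W x * mollify ρ m x - mollify ρ (fun z => m z * pd i W z) x)) = 0 := by
  have cW : ∀ i, Continuous (pd i W) := fun i => (hW.pd (m := 1) (by norm_num) i).continuous
  have hmW : ∀ i, LocallyIntegrable fun x => m x * pd i W x := fun i => hm.mul_continuous (cW i)
  have c1 : ContDiff ℝ 2 (mollify ρ m) := contDiff_infty.1 (contDiff_mollify hρ hc hm) 2
  have c2 : ∀ i, ContDiff ℝ 1 (mollify ρ fun x => m x * pd i W x) := fun i =>
    (contDiff_mollify hρ hc (hmW i)).of_le (by exact_mod_cast le_top)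
  have e : ∀ i x, wt W x * pd i (fun z => Real.exp (W z) * mollify ρ m z) x
      - (pd i W x * mollify ρ m x - mollify ρ (fun z => m z * pd i W z) x)
      = pd i (mollify ρ m) x + mollify ρ (fun z => m z * pd i W z) x := by
    intro i x
    have hd := hW.differentiable (by norm_num) x
    rw [pd_mul hd.exp (c1.differentiable (by norm_num) x)]
    have : pd i (fun z => Real.exp (W z)) x = Real.exp (W x) * pd i W x := by
      rw [pd, (hd.hasFDerivAt.exp).fderiv]
      simp [pd]
    rw [this]
    have h1 : wt W x * Real.exp (W x) = 1 := by
      rw [wt, ← Real.exp_add, neg_add_cancel, Real.exp_zero]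
    linear_combination (pd i W x * mollify ρ m x + pd i (mollify ρ m) x) * h1
  simp only [e]
  have c3 : ∀ i, ContDiff ℝ 1 fun x =>
      pd i (mollify ρ m) x + mollify ρ (fun z => m z * pd i W z) x := fun i =>
    (c1.pd (by norm_num) i).add (c2 i)
  have e2 : ∀ i, ∫ x, pd i ζ x * (pd i (mollify ρ m) x + mollify ρ (fun z => m z * pd i W z) x)
      = - ∫ x, pd i (fun x => pd i (mollify ρ m) x + mollify ρ (fun z => m z * pd i W z) x) x
        * ζ x := by
    intro i
    rw [← integral_mul_pd (c3 i) hζ hζc i]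
    exact integral_congr_ae (Filter.Eventually.of_forall fun x => mul_comm _ _)
  rw [Finset.sum_congr rfl fun i _ => e2 i, Finset.sum_neg_distrib, ← integral_finsetSum]
  · simp only [← Finset.sum_mul,
      divergence_mollify_eq_zero (hW.of_le (by norm_num)) hm h hρ hc, zero_mul, integral_zero,
      neg_zero]
  · intro i _
    exact (((c3 i).pd (m := 0) (by norm_num) i).continuous.mul
      hζ.continuous).integrable_of_hasCompactSupport hζc.mul_left

lemma mollify_sub {ρ f g : Euc n → ℝ} (hρ : Continuous ρ) (hc : HasCompactSupport ρ)
    (hf : LocallyIntegrable f) (hg : LocallyIntegrable g) (y : Euc n) :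
    mollify ρ (fun x => f x - g x) y = mollify ρ f y - mollify ρ g y := by
  unfold mollify
  rw [← integral_sub (integrable_mollify_integrand hρ hc hf y)
    (integrable_mollify_integrand hρ hc hg y)]
  simp only [mul_sub]

/-- Local comparison of the mollified quantities with the mollification of `|k|`. -/
lemma exists_mollify_bounds {W k : Euc n → ℝ} (hW : ContDiff ℝ 1 W) (hk : LocallyIntegrable k)
    {R δ : ℝ} (hδ : 0 < δ) :
    ∃ ε₀ > 0, ∀ ρ ε, IsMollifier ρ ε → ε < ε₀ → ∀ y : Euc n, ‖y‖ ≤ R →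
      |mollify ρ (fun x => k x * Real.exp (-W x / 2)) y| ≤
        2 * Real.exp (-W y / 2) * mollify ρ (fun x => |k x|) y ∧
      ∀ i, |pd i W y * mollify ρ (fun x => k x * Real.exp (-W x / 2)) y
          - mollify ρ (fun x => k x * Real.exp (-W x / 2) * pd i W x) y| ≤
        2 * δ * Real.exp (-W y / 2) * mollify ρ (fun x => |k x|) y := by
  have cW : ∀ i, Continuous (pd i W) := fun i => (hW.pd (m := 0) (by norm_num) i).continuous
  set B : Set (Euc n) := Metric.closedBall 0 (R + 1)
  have hB : IsCompact B := isCompact_closedBall 0 (R + 1)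
  have uW := hB.uniformContinuousOn_of_continuous hW.continuous.continuousOn
  have uWi := fun i => hB.uniformContinuousOn_of_continuous (cW i).continuousOn
  obtain ⟨ε₁, h1, hu1⟩ := Metric.uniformContinuousOn_iff.1 uW 1 one_pos
  have h2 : ∀ i, ∃ ε > 0, ∀ a ∈ B, ∀ b ∈ B, dist a b < ε → dist (pd i W a) (pd i W b) < δ :=
    fun i => Metric.uniformContinuousOn_iff.1 (uWi i) δ hδ
  choose ε₂ h2 hu2 using h2
  have hm : LocallyIntegrable fun x => k x * Real.exp (-W x / 2) := hk.mul_continuous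
    (by have := hW.continuous; fun_prop)
  have hka : LocallyIntegrable fun x => |k x| :=
    hk.mono hk.aestronglyMeasurable.norm (Filter.Eventually.of_forall fun x => by simp)
  obtain ⟨ε₃, h3, hu3⟩ : ∃ ε > 0, ∀ i, ε ≤ ε₂ i := by
    have hne : (insert 1 (Finset.univ.image ε₂)).Nonempty := ⟨1, by simp⟩
    refine ⟨(insert 1 (Finset.univ.image ε₂)).min' hne, ?_, fun i => Finset.min'_le _ _ (by simp)⟩
    rw [gt_iff_lt, Finset.lt_min'_iff]
    intro y hy
    simp only [Finset.mem_insert, Finset.mem_image, Finset.mem_univ, true_and] at hy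
    rcases hy with rfl | ⟨i, rfl⟩
    · norm_num
    · exact h2 i
  refine ⟨min 1 (min ε₁ ε₃), by positivity, fun ρ ε hρ hε y hy => ?_⟩
  have hy1 : y ∈ B := by
    rw [mem_closedBall_zero_iff]
    linarith
  have hx1 : ∀ x, ‖y - x‖ < ε → x ∈ B := by
    intro x hx
    rw [mem_closedBall_zero_iff]
    have : ‖x‖ ≤ ‖y‖ + ‖y - x‖ := by
      have := norm_sub_le y (y - x)
      simpa using this
    have := min_le_left 1 (min ε₁ ε₃)
    linarith
  have hexp : ∀ x, ‖y - x‖ < ε → Real.exp (-W x / 2) ≤ 2 * Real.exp (-W y / 2) := by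
    intro x hx
    have := hu1 y hy1 x (hx1 x hx) (by
      rw [dist_eq_norm]
      exact hx.trans (hε.trans_le ((min_le_right _ _).trans (min_le_left _ _))))
    rw [Real.dist_eq] at this
    have h5 := (abs_lt.1 this).2
    have h6 : Real.exp (-W x / 2) ≤ Real.exp (1 / 2 + -W y / 2) := by
      apply Real.exp_le_exp.2
      linarith
    rw [Real.exp_add] at h6
    have h7 : Real.exp (1 / 2) ≤ 2 := by
      have h8 : Real.exp (1 / 2) ^ 2 = Real.exp 1 := by
        rw [← Real.exp_nat_mul]
        norm_num
      have := Real.exp_one_lt_d9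
      nlinarith [Real.exp_pos (1 / 2)]
    exact h6.trans (mul_le_mul_of_nonneg_right h7 (Real.exp_pos _).le)
  have hb : ∀ x, ‖y - x‖ < ε →
      |k x * Real.exp (-W x / 2)| ≤ 2 * Real.exp (-W y / 2) * |k x| := by
    intro x hx
    rw [abs_mul, abs_of_pos (Real.exp_pos _), mul_comm]
    exact mul_le_mul_of_nonneg_right (hexp x hx) (abs_nonneg _)
  refine ⟨abs_mollify_le hρ hka hb, fun i => ?_⟩
  have e1 : pd i W y * mollify ρ (fun x => k x * Real.exp (-W x / 2)) y
      - mollify ρ (fun x => k x * Real.exp (-W x / 2) * pd i W x) y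
      = mollify ρ (fun x => pd i W y * (k x * Real.exp (-W x / 2))
        - k x * Real.exp (-W x / 2) * pd i W x) y := by
    rw [mollify_sub hρ.smooth.continuous hρ.compact _ (hm.mul_continuous (cW i))]
    · congr 1
      simp only [mollify]
      rw [← integral_const_mul]
      exact integral_congr_ae (Filter.Eventually.of_forall fun x => by ring)
    · exact hm.continuous_mul continuous_const
  rw [e1]
  refine abs_mollify_le hρ hka fun x hx => ?_
  have h4 : |pd i W y - pd i W x| ≤ δ := by
    have := hu2 i y hy1 x (hx1 x hx) (by
      rw [dist_eq_norm]
      exact hx.trans (hε.trans_le (((min_le_right _ _).trans (min_le_right _ _)).trans (hu3 i))))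
    rw [Real.dist_eq] at this
    exact this.le
  have e2 : pd i W y * (k x * Real.exp (-W x / 2)) - k x * Real.exp (-W x / 2) * pd i W x
      = (k x * Real.exp (-W x / 2)) * (pd i W y - pd i W x) := by ring
  rw [e2, abs_mul]
  calc _ ≤ 2 * Real.exp (-W y / 2) * |k x| * δ := mul_le_mul (hb x hx) h4 (abs_nonneg _)
          (by positivity)
    _ = _ := by ring

end Liouville

section Liouville

variable {n : ℕ}

lemma exists_energy_bound {W k : Euc n → ℝ} (hW : ContDiff ℝ 2 W) (hk : MemLp k 2 volume)
    (h : ∀ u : Euc n → ℝ, ContDiff ℝ (⊤ : ℕ∞) u → HasCompactSupport u →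
      ∫ x, k x * Real.exp (-W x / 2) * gen W u x = 0) :
    ∃ C : ℝ, 0 ≤ C ∧ ∀ R : ℝ, 0 < R → ∃ η : Euc n → ℝ, Continuous η ∧ HasCompactSupport η ∧
      (∀ x, ‖x‖ ≤ R → η x = 1) ∧ ∃ ε₀ > 0, ∀ ρ ε, IsMollifier ρ ε → ε < ε₀ →
      ∑ i, ∫ x, wt W x * η x ^ 2 * pd i (fun z => Real.exp (W z) *
        mollify ρ (fun x => k x * Real.exp (-W x / 2)) z) x ^ 2 ≤ C / R ^ 2 := by
  have hW1 : ContDiff ℝ 1 W := hW.of_le (by norm_num)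
  have hkl : LocallyIntegrable k := hk.locallyIntegrable (by norm_num)
  have hk2 : Integrable fun x => k x ^ 2 := hk.integrable_sq
  have hka : LocallyIntegrable fun x => |k x| :=
    hkl.mono hkl.aestronglyMeasurable.norm (Filter.Eventually.of_forall fun x => by simp)
  have hm : LocallyIntegrable fun x => k x * Real.exp (-W x / 2) := hkl.mul_continuous
    (by have := hW.continuous; fun_prop)
  have cW : ∀ i, Continuous (pd i W) := fun i => (hW1.pd (m := 0) (by norm_num) i).continuous
  obtain ⟨Cb, hCb, hcut⟩ := exists_cutoff n
  set I := ∫ x, k x ^ 2 with hI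
  have hI0 : 0 ≤ I := integral_nonneg fun x => sq_nonneg _
  refine ⟨2 * (n * ((20 * Cb ^ 2 + 8) * I)), by positivity, fun R hR => ?_⟩
  obtain ⟨η, hη, hηc, hη0, hη1, hηR, hη2R, hηd⟩ := hcut R hR
  have hη' : ContDiff ℝ 1 η := hη.of_le (by exact_mod_cast le_top)
  obtain ⟨ε₀, hε₀, hb⟩ := exists_mollify_bounds hW1 hkl (R := 2 * R) (δ := 1 / R) (by positivity)
  refine ⟨η, hη.continuous, hηc, hηR, ε₀, hε₀, fun ρ ε hρ hε => ?_⟩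
  set M := mollify ρ (fun x => k x * Real.exp (-W x / 2)) with hM
  have hMc : ContDiff ℝ 2 M := contDiff_infty.1 (contDiff_mollify hρ.smooth hρ.compact hm) 2
  have hGc : ContDiff ℝ 1 fun z => Real.exp (W z) * M z :=
    (hW1.exp).mul (hMc.of_le (by norm_num))
  have hNc : ∀ i, Continuous
      (mollify ρ fun x => k x * Real.exp (-W x / 2) * pd i W x) := fun i =>
    (contDiff_mollify hρ.smooth hρ.compact (hm.mul_continuous (cW i))).continuous
  have hen := energy_estimate hW1 hGc hη' hηc
    (R := fun i x => pd i W x * M x - mollify ρ (fun x => k x * Real.exp (-W x / 2) * pd i W x) x)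
    (fun i => ((cW i).mul hMc.continuous).sub (hNc i))
    (fun ζ hζ hζc => sum_integral_pd_mul_flux_eq_zero hW hm h hρ.smooth hρ.compact hζ hζc)
  refine hen.trans ?_
  have hQi : Integrable (mollify ρ fun x => k x ^ 2) := integrable_mollify hρ hk2
  have hbd : ∀ i, ∫ x, (5 * (wt W x * pd i η x ^ 2 * (Real.exp (W x) * M x) ^ 2)
        + 2 * (η x ^ 2 * (pd i W x * M x
          - mollify ρ (fun x => k x * Real.exp (-W x / 2) * pd i W x) x) ^ 2 / wt W x))
      ≤ (20 * Cb ^ 2 + 8) / R ^ 2 * I := by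
    intro i
    rw [hI, ← integral_mollify hρ hk2, ← integral_const_mul]
    refine integral_mono_of_nonneg (Filter.Eventually.of_forall fun x => ?_) (hQi.const_mul _)
      (Filter.Eventually.of_forall fun x => ?_)
    · have := wt_pos W x
      simp only [Pi.zero_apply]
      positivity
    simp only
    have hQ0 : 0 ≤ mollify ρ (fun x => k x ^ 2) x :=
      integral_nonneg fun z => mul_nonneg (hρ.nonneg _) (sq_nonneg _)
    rcases le_or_gt ‖x‖ (2 * R) with hx | hx
    · obtain ⟨b1, b2⟩ := hb ρ ε hρ hε x hx
      specialize b2 i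
      have hq := mollify_sq_le hρ hka (by simpa only [sq_abs] using hk2.locallyIntegrable) x
      simp only [sq_abs] at hq
      set q := mollify ρ (fun x => |k x|) x with hqdef
      have hq0 : 0 ≤ q := integral_nonneg fun z => mul_nonneg (hρ.nonneg _) (abs_nonneg _)
      rw [← hM] at b1 b2
      set N := pd i W x * M x - mollify ρ (fun x => k x * Real.exp (-W x / 2) * pd i W x) x
      have hE : Real.exp (-W x / 2) ^ 2 = wt W x := by
        rw [← Real.exp_nat_mul, wt]
        congr 1
        push_cast
        ring
      have hw := wt_pos W x
      have hWW : Real.exp (W x) * wt W x = 1 := by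
        rw [wt, ← Real.exp_add, add_neg_cancel, Real.exp_zero]
      have s1 : M x ^ 2 ≤ 4 * wt W x * q ^ 2 := by
        have := pow_le_pow_left₀ (abs_nonneg _) b1 2
        rw [sq_abs, mul_pow, mul_pow, hE] at this
        linarith
      have s2 : N ^ 2 ≤ 4 / R ^ 2 * wt W x * q ^ 2 := by
        have := pow_le_pow_left₀ (abs_nonneg _) b2 2
        rw [sq_abs, mul_pow, mul_pow, hE] at this
        refine this.trans_eq ?_
        ring
      have s3 : pd i η x ^ 2 ≤ Cb ^ 2 / R ^ 2 := by
        have := pow_le_pow_left₀ (abs_nonneg _) (hηd i x) 2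
        rwa [sq_abs, div_pow] at this
      have t1 : wt W x * pd i η x ^ 2 * (Real.exp (W x) * M x) ^ 2
          ≤ Cb ^ 2 / R ^ 2 * (4 * q ^ 2) := by
        have e1 : wt W x * pd i η x ^ 2 * (Real.exp (W x) * M x) ^ 2
            = pd i η x ^ 2 * (Real.exp (W x) * M x ^ 2) := by
          linear_combination (pd i η x ^ 2 * Real.exp (W x) * M x ^ 2) * hWW
        rw [e1]
        refine mul_le_mul s3 ?_ (by positivity) (by positivity)
        calc Real.exp (W x) * M x ^ 2 ≤ Real.exp (W x) * (4 * wt W x * q ^ 2) :=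
              mul_le_mul_of_nonneg_left s1 (Real.exp_pos _).le
          _ = 4 * q ^ 2 := by linear_combination 4 * q ^ 2 * hWW
      have t2 : η x ^ 2 * N ^ 2 / wt W x ≤ 4 / R ^ 2 * q ^ 2 := by
        rw [div_le_iff₀ hw]
        have : η x ^ 2 ≤ 1 := pow_le_one₀ (hη0 x) (hη1 x)
        nlinarith [mul_le_mul_of_nonneg_right this (sq_nonneg N)]
      have hQQ : (20 * Cb ^ 2 + 8) / R ^ 2 * q ^ 2
          ≤ (20 * Cb ^ 2 + 8) / R ^ 2 * mollify ρ (fun x => k x ^ 2) x :=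
        mul_le_mul_of_nonneg_left hq (by positivity)
      refine le_trans ?_ hQQ
      have e2 : (20 * Cb ^ 2 + 8) / R ^ 2 * q ^ 2
          = 5 * (Cb ^ 2 / R ^ 2 * (4 * q ^ 2)) + 2 * (4 / R ^ 2 * q ^ 2) := by ring
      rw [e2]
      linarith
    · have hnot : x ∉ tsupport η := by
        intro hx'
        have : tsupport η ⊆ Metric.closedBall 0 (2 * R) := by
          refine closure_minimal (fun z hz => ?_) Metric.isClosed_closedBall
          rw [mem_closedBall_zero_iff]
          by_contra hlt
          exact hz (hη2R z (by linarith [not_le.1 hlt]))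
        have := this hx'
        rw [mem_closedBall_zero_iff] at this
        linarith
      rw [pd_eq_zero_of_notMem_tsupport hnot, hη2R x hx.le]
      simp only [ne_eq, OfNat.ofNat_ne_zero, not_false_eq_true, zero_pow, mul_zero, zero_mul,
        zero_div, add_zero]
      positivity
  calc _ ≤ 2 * ∑ i : Fin n, (20 * Cb ^ 2 + 8) / R ^ 2 * I :=
        mul_le_mul_of_nonneg_left (Finset.sum_le_sum fun i _ => hbd i) (by norm_num)
    _ = _ := by
        rw [Finset.sum_const, Finset.card_univ, Fintype.card_fin, nsmul_eq_mul]
        ring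

/-- An `L²` function orthogonal to the (weighted) range of the generator on test functions is a
multiple of the square root of the density. -/
theorem ae_eq_const_mul_of_orthogonal_gen {W k : Euc n → ℝ} (hW : ContDiff ℝ 2 W)
    (hk : MemLp k 2 volume)
    (h : ∀ u : Euc n → ℝ, ContDiff ℝ (⊤ : ℕ∞) u → HasCompactSupport u →
      ∫ x, k x * Real.exp (-W x / 2) * gen W u x = 0) :
    ∃ c : ℝ, k =ᵐ[volume] fun x => c * Real.exp (-W x / 2) := by
  have cW := hW.continuous
  have hkl : LocallyIntegrable k := hk.locallyIntegrable (by norm_num)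
  have hm : LocallyIntegrable fun x => k x * Real.exp (-W x / 2) := hkl.mul_continuous
    (by fun_prop)
  have hf : LocallyIntegrable fun x => k x * Real.exp (W x / 2) := hkl.mul_continuous
    (by fun_prop)
  obtain ⟨C, hC, hen⟩ := exists_energy_bound hW hk h
  suffices hc : ∀ θ : Euc n → ℝ, ContDiff ℝ (⊤ : ℕ∞) θ → HasCompactSupport θ → ∀ i,
      ∫ x, k x * Real.exp (W x / 2) * pd i θ x = 0 by
    obtain ⟨c, hc⟩ := ae_eq_const_of_weak_gradient_eq_zero hf hc
    refine ⟨c, ?_⟩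
    filter_upwards [hc] with x hx
    rw [← hx, mul_assoc, ← Real.exp_add]
    ring_nf
    simp
  intro θ hθ hθc i
  have hθ1 : ContDiff ℝ 1 θ := hθ.of_le (by exact_mod_cast le_top)
  have cθ : Continuous (pd i θ) := (hθ1.pd (m := 0) (by norm_num) i).continuous
  set κ : Euc n → ℝ := fun x => Real.exp (W x) * pd i θ x with hκ
  have hκc : Continuous κ := by fun_prop
  have hκs : HasCompactSupport κ := (hθc.pd i).mul_left
  have e1 : ∀ x, k x * Real.exp (W x / 2) * pd i θ x = k x * Real.exp (-W x / 2) * κ x := by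
    intro x
    have : Real.exp (W x / 2) = Real.exp (-W x / 2) * Real.exp (W x) := by
      rw [← Real.exp_add]
      congr 1
      ring
    rw [this, hκ]
    ring
  simp only [e1]
  set S := ∫ x, Real.exp (W x) * θ x ^ 2 with hS
  have hS0 : 0 ≤ S := integral_nonneg fun x => by positivity
  obtain ⟨R₀, hR₀⟩ : ∃ R₀ : ℝ, ∀ x ∈ tsupport θ, ‖x‖ ≤ R₀ :=
    hθc.isCompact.isBounded.exists_norm_le
  rw [← abs_nonpos_iff]
  refine le_of_forall_pos_le_add fun δ hδ => ?_
  set R := max (max R₀ 1) ((C + S) / δ) with hR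
  have hR1 : 1 ≤ R := (le_max_right _ _).trans (le_max_left _ _)
  have hRC : C + S ≤ δ * R := by
    have := le_max_right (max R₀ 1) ((C + S) / δ)
    rw [div_le_iff₀ hδ] at this
    rw [mul_comm]
    exact this
  obtain ⟨η, hη, hηc, hηR, ε₁, hε₁, hen⟩ := hen R (by linarith)
  obtain ⟨ε₂, hε₂, happ⟩ := abs_integral_mollify_mul_sub_le hm hκc hκs (half_pos hδ)
  have hε : min ε₁ ε₂ / 2 < min ε₁ ε₂ := half_lt_self (by positivity)
  obtain ⟨ρ, hρ⟩ := exists_isMollifier (n := n) (min ε₁ ε₂ / 2) (by positivity)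
  have h1 := hen ρ _ hρ (hε.trans_le (min_le_left _ _))
  have h2 := happ ρ _ hρ (hε.trans_le (min_le_right _ _))
  set M := mollify ρ (fun x => k x * Real.exp (-W x / 2)) with hM
  have hMc : ContDiff ℝ 2 M := contDiff_infty.1 (contDiff_mollify hρ.smooth hρ.compact hm) 2
  set G : Euc n → ℝ := fun z => Real.exp (W z) * M z with hG
  have hGc : ContDiff ℝ 1 G := ((hW.of_le (by norm_num)).exp).mul (hMc.of_le (by norm_num))
  have cG : ∀ j, Continuous (pd j G) := fun j => (hGc.pd (m := 0) (by norm_num) j).continuous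
  have e2 : ∀ y, M y * κ y = G y * pd i θ y := by
    intro y
    simp only [hκ, hG]
    ring
  have h3 : |∫ y, M y * κ y| ≤ δ / 2 := by
    simp only [e2]
    rw [integral_mul_pd hGc hθ1 hθc i, abs_neg, ← Real.norm_eq_abs]
    have i1 : Integrable fun x => wt W x * η x ^ 2 * pd i G x ^ 2 := by
      have cw : Continuous (wt W) := (contDiff_wt hW).continuous
      have := cG i
      refine Continuous.integrable_of_hasCompactSupport (by fun_prop) ?_
      simp only [sq (η _)]
      exact (hηc.mul_left.mul_left).mul_right
    have i2 : Integrable fun x => Real.exp (W x) * θ x ^ 2 := by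
      have := hθ.continuous
      refine Continuous.integrable_of_hasCompactSupport (by fun_prop) ?_
      simp only [sq]
      exact hθc.mul_left.mul_left
    have hpt : ∀ x, ‖pd i G x * θ x‖ ≤
        R / 2 * (wt W x * η x ^ 2 * pd i G x ^ 2) + 1 / (2 * R) * (Real.exp (W x) * θ x ^ 2) := by
      intro x
      have hw := wt_pos W x
      have hRp : 0 < R := by linarith
      by_cases hx : x ∈ tsupport θ
      · rw [hηR x ((hR₀ x hx).trans ((le_max_left _ _).trans (le_max_left _ _)))]
        have hE : Real.exp (W x) = (wt W x)⁻¹ := by rw [wt, Real.exp_neg, inv_inv]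
        rw [hE, Real.norm_eq_abs, abs_le]
        set s := wt W x
        have a1 := sq_nonneg (R * s * pd i G x - θ x)
        have a2 := sq_nonneg (R * s * pd i G x + θ x)
        have e3 : R / 2 * (s * 1 ^ 2 * pd i G x ^ 2) + 1 / (2 * R) * (s⁻¹ * θ x ^ 2)
            = ((R * s * pd i G x) ^ 2 + θ x ^ 2) / (2 * R * s) := by
          field_simp
        rw [e3]
        constructor
        · rw [neg_le, ← sub_nonneg]
          have : ((R * s * pd i G x) ^ 2 + θ x ^ 2) / (2 * R * s) - -(pd i G x * θ x)
            = (R * s * pd i G x + θ x) ^ 2 / (2 * R * s) := by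
            field_simp
            ring
          rw [this]
          positivity
        · rw [← sub_nonneg]
          have : ((R * s * pd i G x) ^ 2 + θ x ^ 2) / (2 * R * s) - (pd i G x * θ x)
            = (R * s * pd i G x - θ x) ^ 2 / (2 * R * s) := by
            field_simp
            ring
          rw [this]
          positivity
      · rw [image_eq_zero_of_notMem_tsupport hx]
        simp only [mul_zero, norm_zero]
        positivity
    refine (norm_integral_le_of_norm_le ((i1.const_mul (R / 2)).add (i2.const_mul (1 / (2 * R))))
      (Filter.Eventually.of_forall hpt)).trans ?_
    have hsplit : ∫ x, (R / 2 * (wt W x * η x ^ 2 * pd i G x ^ 2)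
        + 1 / (2 * R) * (Real.exp (W x) * θ x ^ 2))
        = R / 2 * (∫ x, wt W x * η x ^ 2 * pd i G x ^ 2) + 1 / (2 * R) * S := by
      rw [hS, ← integral_const_mul, ← integral_const_mul]
      exact integral_add (i1.const_mul (R / 2)) (i2.const_mul (1 / (2 * R)))
    refine hsplit.trans_le ?_
    have h4 : ∫ x, wt W x * η x ^ 2 * pd i G x ^ 2 ≤ C / R ^ 2 := by
      refine le_trans ?_ h1
      exact Finset.single_le_sum (f := fun j => ∫ x, wt W x * η x ^ 2 * pd j G x ^ 2)
        (fun j _ => integral_nonneg fun x => by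
          have := wt_pos W x
          simp only [Pi.zero_apply]
          positivity) (Finset.mem_univ i)
    have hRp : 0 < R := by linarith
    calc _ ≤ R / 2 * (C / R ^ 2) + 1 / (2 * R) * S := by gcongr
      _ = (C + S) / (2 * R) := by
        field_simp
      _ ≤ δ / 2 := by
        rw [div_le_div_iff₀ (by positivity) (by norm_num)]
        nlinarith
  have := abs_sub_abs_le_abs_sub (∫ y, k y * Real.exp (-W y / 2) * κ y) (∫ y, M y * κ y)
  rw [abs_sub_comm] at this
  linarith

end Liouville

section Approximation

variable {n : ℕ}

lemma exp_neg_half_sq (W : Euc n → ℝ) (x : Euc n) : Real.exp (-W x / 2) ^ 2 = wt W x := by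
  rw [← Real.exp_nat_mul, wt]
  congr 1
  push_cast
  ring

lemma memLp_two_of_continuous {f : Euc n → ℝ} (hf : Continuous f)
    (hi : Integrable fun x => f x ^ 2) : MemLp f 2 volume :=
  (memLp_two_iff_integrable_sq hf.aestronglyMeasurable).2 hi

/-- The range of the generator on test functions is dense among mean-zero functions. -/
lemma exists_gen_approx {W φ : Euc n → ℝ} (hW : ContDiff ℝ 2 W) (hφ : Continuous φ)
    (hφi : Integrable fun x => φ x ^ 2 * wt W x) (h0 : ∫ x, φ x * wt W x = 0)
    {ε : ℝ} (hε : 0 < ε) :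
    ∃ u : Euc n → ℝ, ContDiff ℝ (⊤ : ℕ∞) u ∧ HasCompactSupport u ∧
      ∫ x, (φ x - gen W u x) ^ 2 * wt W x ≤ ε := by
  have cW := hW.continuous
  have cs : Continuous fun x => Real.exp (-W x / 2) := by fun_prop
  have cgen : ∀ u : Euc n → ℝ, ContDiff ℝ (⊤ : ℕ∞) u → Continuous (gen W u) := fun u hu =>
    continuous_gen (hW.of_le (by norm_num)) (contDiff_infty.1 hu 2)
  have hgen : ∀ u : Euc n → ℝ, ContDiff ℝ (⊤ : ℕ∞) u → HasCompactSupport u →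
      MemLp (fun x => Real.exp (-W x / 2) * gen W u x) 2 volume := fun u hu hc =>
    (cs.mul (cgen u hu)).memLp_of_hasCompactSupport ((hasCompactSupport_gen hc).mul_left)
  have hF : MemLp (fun x => φ x * Real.exp (-W x / 2)) 2 volume := by
    refine memLp_two_of_continuous (hφ.mul cs) ?_
    simpa only [mul_pow, exp_neg_half_sq] using hφi
  let T : Set (Lp ℝ 2 (volume : Measure (Euc n))) :=
    {f | ∃ u : Euc n → ℝ, ContDiff ℝ (⊤ : ℕ∞) u ∧ HasCompactSupport u ∧
      f =ᵐ[volume] fun x => Real.exp (-W x / 2) * gen W u x}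
  let S := Submodule.span ℝ T
  have hmem : hF.toLp _ ∈ S.topologicalClosure := by
    rw [← Submodule.orthogonal_orthogonal_eq_closure, Submodule.mem_orthogonal]
    intro k hk
    rw [Submodule.mem_orthogonal] at hk
    obtain ⟨c, hc⟩ := ae_eq_const_mul_of_orthogonal_gen hW (Lp.memLp k) (fun u hu hc => by
      have := hk ((hgen u hu hc).toLp _) (Submodule.subset_span ⟨u, hu, hc, MemLp.coeFn_toLp _⟩)
      rw [L2.inner_def] at this
      rw [← this]
      refine integral_congr_ae ?_
      filter_upwards [MemLp.coeFn_toLp (hgen u hu hc)] with x hx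
      rw [hx]
      simp
      ring)
    rw [L2.inner_def]
    have : ∫ x, c * (φ x * wt W x) = 0 := by rw [integral_const_mul, h0, mul_zero]
    rw [← this]
    refine integral_congr_ae ?_
    filter_upwards [MemLp.coeFn_toLp hF, hc] with x hx hx2
    rw [hx, hx2, ← exp_neg_half_sq]
    simp
    ring
  have hspan : ∀ f ∈ S, f ∈ T := by
    intro f hf
    refine Submodule.span_induction (p := fun f _ => f ∈ T) (fun f hf => hf) ?_ ?_ ?_ hf
    · refine ⟨fun _ => 0, contDiff_const, HasCompactSupport.zero, ?_⟩
      filter_upwards [Lp.coeFn_zero ℝ 2 (volume : Measure (Euc n))] with x hx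
      have e : ∀ i, pd i (fun _ : Euc n => (0 : ℝ)) = fun _ => 0 := fun i =>
        funext fun x => by simp [pd]
      rw [hx]
      simp [gen, e]
    · rintro f g - - ⟨u, hu, hc, hf⟩ ⟨v, hv, hd, hg⟩
      refine ⟨fun x => u x + v x, hu.add hv, hc.add hd, ?_⟩
      filter_upwards [Lp.coeFn_add f g, hf, hg] with x hx hx1 hx2
      have du := hu.differentiable (by norm_num)
      have dv := hv.differentiable (by norm_num)
      have e1 : ∀ i, pd i (fun x => u x + v x) = fun x => pd i u x + pd i v x := fun i =>
        funext fun x => pd_add (du x) (dv x) i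
      have e2 : ∀ i, pd i (fun x => pd i u x + pd i v x) x = pd i (pd i u) x + pd i (pd i v) x :=
        fun i => pd_add ((hu.pd (m := (⊤ : ℕ∞)) (by simp) i).differentiable (by norm_num) x)
          ((hv.pd (m := (⊤ : ℕ∞)) (by simp) i).differentiable (by norm_num) x) i
      rw [hx, Pi.add_apply, hx1, hx2, ← mul_add]
      simp only [gen, e1, e2]
      rw [← Finset.sum_add_distrib]
      congr 1
      exact Finset.sum_congr rfl fun i _ => by ring
    · rintro a f - ⟨u, hu, hc, hf⟩
      refine ⟨fun x => a * u x, contDiff_const.mul hu, hc.mul_left, ?_⟩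
      filter_upwards [Lp.coeFn_smul a f, hf] with x hx hx1
      have e1 : ∀ (i : Fin n) (v : Euc n → ℝ), ContDiff ℝ (⊤ : ℕ∞) v →
          pd i (fun x => a * v x) = fun x => a * pd i v x := fun i v hv =>
        funext fun x => by
          rw [pd_mul (differentiableAt_const a) (hv.differentiable (by norm_num) x)]
          simp [pd]
      have e2 : ∀ i, pd i (pd i fun x => a * u x) = fun x => a * pd i (pd i u) x := fun i => by
        rw [e1 i u hu, e1 i _ (hu.pd (m := (⊤ : ℕ∞)) (by simp) i)]
      rw [hx, Pi.smul_apply, hx1, smul_eq_mul]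
      simp only [gen, e2]
      simp only [e1 _ u hu]
      rw [mul_left_comm, Finset.mul_sum]
      congr 1
      exact Finset.sum_congr rfl fun i _ => by ring
  obtain ⟨f, hf, hfε⟩ := Metric.mem_closure_iff.1 hmem (Real.sqrt ε) (Real.sqrt_pos.2 hε)
  obtain ⟨u, hu, hc, hfu⟩ := hspan f hf
  refine ⟨u, hu, hc, ?_⟩
  have h1 : ‖hF.toLp _ - f‖ ^ 2 ≤ ε := by
    rw [← Real.sq_sqrt hε.le]
    rw [dist_eq_norm] at hfε
    exact pow_le_pow_left₀ (norm_nonneg _) hfε.le 2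
  refine le_trans (le_of_eq ?_) h1
  rw [← real_inner_self_eq_norm_sq, L2.inner_def]
  refine integral_congr_ae ?_
  filter_upwards [MemLp.coeFn_toLp hF, hfu, Lp.coeFn_sub (hF.toLp _) f] with x hx hx1 hx2
  rw [hx2, Pi.sub_apply, hx, hx1, ← exp_neg_half_sq]
  simp
  ring

lemma pd_comp_neg {f : Euc n → ℝ} (hf : Differentiable ℝ f) (x : Euc n) (i : Fin n) :
    pd i (fun z => f (-z)) x = - pd i f (-x) := by
  simpa using pd_comp_const_sub hf 0 x i

lemma pd_neg_of_even {f : Euc n → ℝ} (hf : Differentiable ℝ f) (he : ∀ x, f (-x) = f x)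
    (x : Euc n) (i : Fin n) : pd i f (-x) = - pd i f x := by
  have := pd_comp_neg hf x i
  simp only [he] at this
  linarith

lemma gen_comp_neg {W u : Euc n → ℝ} (hW : Differentiable ℝ W) (hWe : ∀ x, W (-x) = W x)
    (hu : ContDiff ℝ 2 u) (x : Euc n) : gen W (fun z => u (-z)) x = gen W u (-x) := by
  have hd := hu.differentiable (by norm_num)
  have hd1 : ∀ i, Differentiable ℝ (pd i u) := fun i =>
    (hu.pd (m := 1) (by norm_num) i).differentiable (by norm_num)
  have e1 : ∀ i, pd i (fun z => u (-z)) = fun z => - pd i u (-z) := fun i =>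
    funext fun z => pd_comp_neg hd z i
  refine Finset.sum_congr rfl fun i _ => ?_
  have e2 : pd i (fun z => - pd i u (-z)) x = pd i (pd i u) (-x) := by
    have : pd i (fun z => - pd i u (-z)) x = - pd i (fun z => pd i u (-z)) x := by simp [pd]
    rw [this, pd_comp_neg (hd1 i), neg_neg]
  rw [e1, e2, pd_neg_of_even hW hWe]
  ring

lemma integrable_sub_gen_sq {W φ u : Euc n → ℝ} (hW : ContDiff ℝ 2 W) (hφ : Continuous φ)
    (hφi : Integrable fun x => φ x ^ 2 * wt W x) (hu : ContDiff ℝ 2 u)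
    (hc : HasCompactSupport u) :
    Integrable fun x => (φ x - gen W u x) ^ 2 * wt W x := by
  have cg := continuous_gen (hW.of_le (by norm_num)) hu
  have cw := (contDiff_wt hW).continuous
  have hg : HasCompactSupport (gen W u) := hasCompactSupport_gen hc
  have i1 : Integrable fun x => gen W u x * ((gen W u x - 2 * φ x) * wt W x) :=
    (by fun_prop : Continuous _).integrable_of_hasCompactSupport hg.mul_right
  refine (hφi.add i1).congr (Filter.Eventually.of_forall fun x => ?_)
  simp only [Pi.add_apply]
  ring

/-- Even version of the density of the range of the generator. -/
lemma exists_even_gen_approx {W φ : Euc n → ℝ} (hW : ContDiff ℝ 2 W) (hφ : Continuous φ)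
    (hWe : ∀ x, W (-x) = W x) (hφe : ∀ x, φ (-x) = φ x)
    (hφi : Integrable fun x => φ x ^ 2 * wt W x) (h0 : ∫ x, φ x * wt W x = 0)
    {ε : ℝ} (hε : 0 < ε) :
    ∃ u : Euc n → ℝ, ContDiff ℝ (⊤ : ℕ∞) u ∧ HasCompactSupport u ∧ (∀ x, u (-x) = u x) ∧
      ∫ x, (φ x - gen W u x) ^ 2 * wt W x ≤ ε := by
  obtain ⟨u, hu, hc, hle⟩ := exists_gen_approx hW hφ hφi h0 hε
  have hun : ContDiff ℝ (⊤ : ℕ∞) fun x => u (-x) := hu.comp contDiff_neg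
  have hcn : HasCompactSupport fun x => u (-x) := hc.comp_homeomorph (Homeomorph.neg _)
  have hu2 : ContDiff ℝ 2 u := contDiff_infty.1 hu 2
  have hun2 : ContDiff ℝ 2 fun x => u (-x) := contDiff_infty.1 hun 2
  refine ⟨fun x => 1 / 2 * (u x + u (-x)), contDiff_const.mul (hu.add hun),
    (hc.add hcn).mul_left, fun x => by simp [add_comm], ?_⟩
  have eg : ∀ x, gen W (fun x => 1 / 2 * (u x + u (-x))) x
      = 1 / 2 * (gen W u x + gen W u (-x)) := by
    intro x
    rw [← gen_comp_neg (hW.differentiable (by norm_num)) hWe hu2]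
    have e1 : ∀ i, pd i (fun x => 1 / 2 * (u x + u (-x)))
        = fun x => 1 / 2 * (pd i u x + pd i (fun z => u (-z)) x) := fun i => funext fun x => by
      rw [pd_mul (differentiableAt_const _) ((hu2.add hun2).differentiable (by norm_num) x),
        pd_add (hu2.differentiable (by norm_num) x) (hun2.differentiable (by norm_num) x)]
      simp [pd]
    have c1 : ∀ i, ContDiff ℝ 1 (pd i u) := fun i => hu2.pd (by norm_num) i
    have c2 : ∀ i, ContDiff ℝ 1 (pd i fun z => u (-z)) := fun i => hun2.pd (by norm_num) i
    have e2 : ∀ i, pd i (fun x => 1 / 2 * (pd i u x + pd i (fun z => u (-z)) x)) x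
        = 1 / 2 * (pd i (pd i u) x + pd i (pd i fun z => u (-z)) x) := fun i => by
      rw [pd_mul (differentiableAt_const _) (((c1 i).add (c2 i)).differentiable (by norm_num) x),
        pd_add ((c1 i).differentiable (by norm_num) x) ((c2 i).differentiable (by norm_num) x)]
      simp [pd]
    simp only [gen, e1, e2]
    rw [← Finset.sum_add_distrib, Finset.mul_sum]
    exact Finset.sum_congr rfl fun i _ => by ring
  have i1 := integrable_sub_gen_sq hW hφ hφi hu2 hc
  have i2 : Integrable fun x => (φ (-x) - gen W u (-x)) ^ 2 * wt W (-x) := i1.comp_neg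
  have e3 : ∫ x, (φ (-x) - gen W u (-x)) ^ 2 * wt W (-x)
      = ∫ x, (φ x - gen W u x) ^ 2 * wt W x :=
    integral_neg_eq_self (fun x => (φ x - gen W u x) ^ 2 * wt W x) volume
  calc _ ≤ ∫ x, (1 / 2 * ((φ x - gen W u x) ^ 2 * wt W x)
        + 1 / 2 * ((φ (-x) - gen W u (-x)) ^ 2 * wt W (-x))) := by
        refine integral_mono_of_nonneg (Filter.Eventually.of_forall fun x =>
          mul_nonneg (sq_nonneg _) (wt_pos W x).le) ((i1.const_mul _).add (i2.const_mul _))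
          (Filter.Eventually.of_forall fun x => ?_)
        have hw : wt W (-x) = wt W x := by simp [wt, hWe]
        simp only [eg, hw, hφe]
        nlinarith [mul_nonneg (sq_nonneg ((φ x - gen W u x) - (φ x - gen W u (-x))))
          (wt_pos W x).le]
    _ = ∫ x, (φ x - gen W u x) ^ 2 * wt W x := by
        rw [integral_add (by exact i1.const_mul _) (by exact i2.const_mul _), integral_const_mul,
          integral_const_mul, e3]
        ring
    _ ≤ ε := hle

end Approximation

/-! ### Variance inequality for strongly log-concave even densities -/

section Variance

variable {n : ℕ}

/-- The Hessian quadratic form of `f` at `x`. -/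
def hess (f : Euc n → ℝ) (x : Euc n) (w : Fin n → ℝ) : ℝ :=
  ∑ j, ∑ i, pd j (pd i f) x * w i * w j

/-- The potential `V + |x|²/2`. -/
def addGauss (V : Euc n → ℝ) (x : Euc n) : ℝ := V x + ‖x‖ ^ 2 / 2

lemma contDiff_addGauss {V : Euc n → ℝ} {k : WithTop ℕ∞} (hV : ContDiff ℝ k V) :
    ContDiff ℝ k (addGauss V) :=
  hV.add ((contDiff_norm_sq ℝ).div_const 2)

lemma pd_coord (i j : Fin n) (x : Euc n) :
    pd j (fun y : Euc n => y i) x = if i = j then 1 else 0 := by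
  have : HasFDerivAt (fun y : Euc n => y i) (EuclideanSpace.proj i : Euc n →L[ℝ] ℝ) x :=
    (EuclideanSpace.proj i : Euc n →L[ℝ] ℝ).hasFDerivAt
  rw [pd, this.fderiv]
  simp

lemma pd_addGauss {V : Euc n → ℝ} (hV : Differentiable ℝ V) (i : Fin n) :
    pd i (addGauss V) = fun x => pd i V x + x i := by
  funext x
  have h1 : HasFDerivAt (fun x : Euc n => ‖x‖ ^ 2 / 2) ((1 / 2 : ℝ) • (2 • innerSL ℝ x)) x := by
    have := ((hasStrictFDerivAt_norm_sq x).hasFDerivAt).const_smul (1 / 2 : ℝ)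
    refine this.congr_of_eventuallyEq (Filter.Eventually.of_forall fun y => ?_)
    simp
    ring
  change pd i (fun x => V x + ‖x‖ ^ 2 / 2) x = _
  rw [pd_add (hV x) h1.differentiableAt]
  congr 1
  rw [pd, h1.fderiv]
  simp [EuclideanSpace.inner_single_right]

lemma hess_addGauss {V : Euc n → ℝ} (hV : ContDiff ℝ 2 V) (x : Euc n) (w : Fin n → ℝ) :
    hess (addGauss V) x w = hess V x w + ∑ i, w i ^ 2 := by
  have e : ∀ i j, pd j (pd i (addGauss V)) x = pd j (pd i V) x + if i = j then 1 else 0 := by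
    intro i j
    rw [pd_addGauss (hV.differentiable (by norm_num)),
      pd_add (((hV.pd (m := 1) (by norm_num) i).differentiable (by norm_num)) x)
      (by fun_prop), pd_coord]
  simp only [hess, e, add_mul, Finset.sum_add_distrib]
  congr 1
  refine Finset.sum_congr rfl fun j _ => ?_
  simp [sq]

lemma continuous_hess {f : Euc n → ℝ} (hf : ContDiff ℝ 2 f) {w : Fin n → Euc n → ℝ}
    (hw : ∀ i, Continuous (w i)) : Continuous fun x => hess f x fun i => w i x := by
  have : ∀ i j, Continuous (pd j (pd i f)) := fun i j =>
    ((hf.pd (m := 1) (by norm_num) i).pd (m := 0) (by norm_num) j).continuous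
  unfold hess
  fun_prop

lemma integrable_of_zero_off_tsupport {f u : Euc n → ℝ} (hf : Continuous f)
    (hc : HasCompactSupport u) (h : ∀ x, x ∉ tsupport u → f x = 0) : Integrable f :=
  hf.integrable_of_hasCompactSupport (HasCompactSupport.intro hc h)

lemma pd_pd_eq_zero_of_notMem_tsupport {u : Euc n → ℝ} {x : Euc n} (hx : x ∉ tsupport u)
    (i j : Fin n) : pd i (pd j u) x = 0 := by
  refine pd_eq_zero_of_notMem_tsupport (fun h => hx (closure_minimal ?_ (isClosed_tsupport u) h)) i
  intro y hy
  by_contra hy'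
  exact hy (pd_eq_zero_of_notMem_tsupport hy' j)

/-- Dual bound for the second moment in terms of an approximate solution of `gen W u = φ`. -/
lemma integral_sq_le_of_gen_approx {W φ u : Euc n → ℝ} (hW : ContDiff ℝ 2 W)
    (hφ : ContDiff ℝ 1 φ) (hφi : Integrable fun x => φ x ^ 2 * wt W x) (hu : ContDiff ℝ 3 u)
    (hc : HasCompactSupport u) {ε : ℝ} (h : ∫ x, (φ x - gen W u x) ^ 2 * wt W x ≤ ε) :
    ∫ x, φ x ^ 2 * wt W x ≤ ε - ∫ x, (2 * (∑ i, pd i φ x * pd i u x)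
      + (∑ j, ∑ i, pd i (pd j u) x ^ 2) + hess W x fun i => pd i u x) * wt W x := by
  have hW1 : ContDiff ℝ 1 W := hW.of_le (by norm_num)
  have hu2 : ContDiff ℝ 2 u := hu.of_le (by norm_num)
  have cw := (contDiff_wt hW).continuous
  have cg := continuous_gen hW1 hu2
  have cφ := hφ.continuous
  have hg : HasCompactSupport (gen W u) := hasCompactSupport_gen hc
  have cu : ∀ i, Continuous (pd i u) := fun i => (hu.pd (m := 2) (by norm_num) i).continuous
  have cuu : ∀ i j, Continuous (pd i (pd j u)) := fun i j =>
    ((hu.pd (m := 2) (by norm_num) j).pd (m := 1) (by norm_num) i).continuous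
  have cφi : ∀ i, Continuous (pd i φ) := fun i => (hφ.pd (m := 0) (by norm_num) i).continuous
  have ch := continuous_hess hW cu
  have i0 := integrable_sub_gen_sq hW cφ hφi hu2 hc
  have i1 : Integrable fun x => φ x * gen W u x * wt W x :=
    (by fun_prop : Continuous _).integrable_of_hasCompactSupport hg.mul_left.mul_right
  have i2 : Integrable fun x => gen W u x ^ 2 * wt W x := by
    refine (by fun_prop : Continuous _).integrable_of_hasCompactSupport ?_
    simp only [sq]
    exact hg.mul_left.mul_right
  have e1 : ∀ x, φ x ^ 2 * wt W x = (φ x - gen W u x) ^ 2 * wt W x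
      + (2 * (φ x * gen W u x * wt W x) - gen W u x ^ 2 * wt W x) := fun x => by ring
  have j1 : Integrable fun x => (∑ i, pd i φ x * pd i u x) * wt W x := by
    refine integrable_of_zero_off_tsupport (u := u) (by fun_prop) hc fun x hx => ?_
    simp [pd_eq_zero_of_notMem_tsupport hx]
  have j2 : Integrable fun x => ((∑ j, ∑ i, pd i (pd j u) x ^ 2)
      + hess W x fun i => pd i u x) * wt W x := by
    refine integrable_of_zero_off_tsupport (u := u) (by fun_prop) hc fun x hx => ?_
    simp [pd_eq_zero_of_notMem_tsupport hx, pd_pd_eq_zero_of_notMem_tsupport hx, hess]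
  simp only [e1]
  rw [integral_add i0 (by exact (i1.const_mul 2).sub i2), integral_sub (by exact i1.const_mul 2) i2,
    integral_const_mul, integral_mul_gen hW1 hφ hu2 hc, integral_gen_sq hW hu hc]
  have e2 : ∀ x, (2 * (∑ i, pd i φ x * pd i u x)
      + (∑ j, ∑ i, pd i (pd j u) x ^ 2) + hess W x fun i => pd i u x) * wt W x
      = 2 * ((∑ i, pd i φ x * pd i u x) * wt W x) + ((∑ j, ∑ i, pd i (pd j u) x ^ 2)
      + hess W x fun i => pd i u x) * wt W x := fun x => by ring
  simp only [e2]
  rw [integral_add (by exact j1.const_mul 2) j2, integral_const_mul]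
  unfold hess
  linarith

/-- Brascamp-Lieb type Poincaré inequality with constant one for odd test functions. -/
lemma poincare_of_odd {V w : Euc n → ℝ} (hV : ContDiff ℝ 2 V) (hVe : ∀ x, V (-x) = V x)
    (hconv : ∀ x v, 0 ≤ hess V x v) (hw : ContDiff ℝ 1 w) (hwc : HasCompactSupport w)
    (hwo : ∀ x, w (-x) = - w x) :
    ∫ x, w x ^ 2 * wt (addGauss V) x ≤ ∫ x, (∑ i, pd i w x ^ 2) * wt (addGauss V) x := by
  have hW : ContDiff ℝ 2 (addGauss V) := contDiff_addGauss hV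
  set W := addGauss V with hWd
  have cw := (contDiff_wt hW).continuous
  have cww := hw.continuous
  have cwi : ∀ i, Continuous (pd i w) := fun i => (hw.pd (m := 0) (by norm_num) i).continuous
  have hWe : ∀ x, wt W (-x) = wt W x := fun x => by simp [wt, hWd, addGauss, hVe]
  have h0 : ∫ x, w x * wt W x = 0 := by
    have := integral_neg_eq_self (fun x => w x * wt W x) volume
    simp only [hwo, hWe, neg_mul, integral_neg] at this
    linarith
  have hi : Integrable fun x => w x ^ 2 * wt W x :=
    integrable_of_zero_off_tsupport (u := w) (by fun_prop) hwc fun x hx => by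
      simp [image_eq_zero_of_notMem_tsupport hx]
  refine le_of_forall_pos_le_add fun ε hε => ?_
  obtain ⟨u, hu, hc, hle⟩ := exists_gen_approx hW cww hi h0 hε
  have hu3 : ContDiff ℝ 3 u := contDiff_infty.1 hu 3
  have cu : ∀ i, Continuous (pd i u) := fun i => (hu3.pd (m := 2) (by norm_num) i).continuous
  have cuu : ∀ i j, Continuous (pd i (pd j u)) := fun i j =>
    ((hu3.pd (m := 2) (by norm_num) j).pd (m := 1) (by norm_num) i).continuous
  have ch := continuous_hess hW cu
  refine (integral_sq_le_of_gen_approx hW hw hi hu3 hc hle).trans ?_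
  have j1 : Integrable fun x => (2 * (∑ i, pd i w x * pd i u x)
      + (∑ j, ∑ i, pd i (pd j u) x ^ 2) + hess W x fun i => pd i u x) * wt W x :=
    integrable_of_zero_off_tsupport (u := u) (by fun_prop) hc fun x hx => by
      simp [pd_eq_zero_of_notMem_tsupport hx, pd_pd_eq_zero_of_notMem_tsupport hx, hess]
  have j2 : Integrable fun x => (∑ i, pd i w x ^ 2) * wt W x :=
    integrable_of_zero_off_tsupport (u := w) (by fun_prop) hwc fun x hx => by
      simp [pd_eq_zero_of_notMem_tsupport hx]
  have : 0 ≤ ∫ x, ((2 * (∑ i, pd i w x * pd i u x)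
      + (∑ j, ∑ i, pd i (pd j u) x ^ 2) + hess W x fun i => pd i u x) * wt W x
      + (∑ i, pd i w x ^ 2) * wt W x) := by
    refine integral_nonneg fun x => ?_
    simp only [Pi.zero_apply]
    rw [← add_mul, hWd, hess_addGauss hV]
    refine mul_nonneg ?_ (wt_pos _ x).le
    have h1 := hconv x fun i => pd i u x
    have h2 : 0 ≤ ∑ j, ∑ i, pd i (pd j u) x ^ 2 :=
      Finset.sum_nonneg fun j _ => Finset.sum_nonneg fun i _ => sq_nonneg _
    have h3 : 0 ≤ ∑ i, (pd i w x + pd i u x) ^ 2 := Finset.sum_nonneg fun i _ => sq_nonneg _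
    have h4 : ∑ i, (pd i w x + pd i u x) ^ 2
        = ∑ i, pd i w x ^ 2 + 2 * (∑ i, pd i w x * pd i u x) + ∑ i, pd i u x ^ 2 := by
      rw [Finset.mul_sum, ← Finset.sum_add_distrib, ← Finset.sum_add_distrib]
      exact Finset.sum_congr rfl fun i _ => by ring
    linarith
  rw [integral_add j1 j2] at this
  linarith

/-- Radial drift bound. -/
lemma integral_drift_le {V w : Euc n → ℝ} (hV : ContDiff ℝ 2 V) (hw : ContDiff ℝ 1 w)
    (hwc : HasCompactSupport w) :
    ∫ x, (∑ i, x i * pd i V x) * w x ^ 2 * wt (addGauss V) x ≤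
      n * (∫ x, w x ^ 2 * wt (addGauss V) x)
        + ∫ x, (∑ i, pd i w x ^ 2) * wt (addGauss V) x := by
  have hW : ContDiff ℝ 2 (addGauss V) := contDiff_addGauss hV
  set W := addGauss V with hWd
  have hW1 : ContDiff ℝ 1 W := hW.of_le (by norm_num)
  have cw := (contDiff_wt hW).continuous
  have cww := hw.continuous
  have cwi : ∀ i, Continuous (pd i w) := fun i => (hw.pd (m := 0) (by norm_num) i).continuous
  have cV : ∀ i, Continuous (pd i V) := fun i => (hV.pd (m := 1) (by norm_num) i).continuous
  have cW : ∀ i, Continuous (pd i W) := fun i => (hW.pd (m := 1) (by norm_num) i).continuous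
  have hx : ∀ i, ContDiff ℝ 1 fun x : Euc n => x i := fun i => by fun_prop
  have hw2 : ContDiff ℝ 1 fun x => w x ^ 2 := hw.pow 2
  have hw2c : HasCompactSupport fun x => w x ^ 2 := by
    simp only [sq]
    exact hwc.mul_left
  have hibp : ∀ i, ∫ x, (pd i (fun x => x i * w x ^ 2) x - pd i W x * (x i * w x ^ 2)) * wt W x
      = 0 := by
    intro i
    have := integral_mul_pd_wt hW1 (contDiff_const (c := (1 : ℝ))) ((hx i).mul hw2)
      hw2c.mul_left i
    simpa [pd] using this
  have e1 : ∀ i x, pd i (fun x => x i * w x ^ 2) x = w x ^ 2 + 2 * (x i * (w x * pd i w x)) := by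
    intro i x
    have dw := hw.differentiable (by norm_num) x
    rw [pd_mul ((hx i).differentiable (by norm_num) x) (hw2.differentiable (by norm_num) x),
      pd_coord]
    simp only [sq]
    rw [pd_mul dw dw]
    simp
    ring
  have e2 : ∀ i x, pd i W x = pd i V x + x i := fun i x => by
    rw [hWd, pd_addGauss (hV.differentiable (by norm_num))]
  simp only [e1, e2] at hibp
  have hsum : ∫ x, ∑ i, (w x ^ 2 + 2 * (x i * (w x * pd i w x))
      - (pd i V x + x i) * (x i * w x ^ 2)) * wt W x = 0 := by
    rw [integral_finsetSum]
    · exact Finset.sum_eq_zero fun i _ => hibp i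
    · intro i _
      refine integrable_of_zero_off_tsupport (u := w) (by fun_prop) hwc fun x hx => ?_
      simp [image_eq_zero_of_notMem_tsupport hx]
  have j0 : Integrable fun x => ∑ i, (w x ^ 2 + 2 * (x i * (w x * pd i w x))
      - (pd i V x + x i) * (x i * w x ^ 2)) * wt W x :=
    integrable_of_zero_off_tsupport (u := w) (by fun_prop) hwc fun x hx => by
      simp [image_eq_zero_of_notMem_tsupport hx]
  have j1 : Integrable fun x => w x ^ 2 * wt W x :=
    integrable_of_zero_off_tsupport (u := w) (by fun_prop) hwc fun x hx => by
      simp [image_eq_zero_of_notMem_tsupport hx]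
  have j2 : Integrable fun x => (∑ i, pd i w x ^ 2) * wt W x :=
    integrable_of_zero_off_tsupport (u := w) (by fun_prop) hwc fun x hx => by
      simp [pd_eq_zero_of_notMem_tsupport hx]
  have j3 : Integrable fun x => (∑ i, x i * pd i V x) * w x ^ 2 * wt W x :=
    integrable_of_zero_off_tsupport (u := w) (by fun_prop) hwc fun x hx => by
      simp [image_eq_zero_of_notMem_tsupport hx]
  rw [← integral_const_mul, ← integral_add (by exact j1.const_mul _) j2]
  have := integral_mono (j3.add j0) ((j1.const_mul (n : ℝ)).add j2) fun x => by
    simp only [Pi.add_apply]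
    rw [← Finset.sum_mul, ← add_mul, ← mul_assoc, ← add_mul]
    refine mul_le_mul_of_nonneg_right ?_ (wt_pos _ x).le
    have h1 : 0 ≤ ∑ i, (x i * w x - pd i w x) ^ 2 := Finset.sum_nonneg fun i _ => sq_nonneg _
    have h2 : (∑ i, x i * pd i V x) * w x ^ 2 + ∑ i, (w x ^ 2 + 2 * (x i * (w x * pd i w x))
        - (pd i V x + x i) * (x i * w x ^ 2))
        = n * w x ^ 2 + ∑ i, pd i w x ^ 2 - ∑ i, (x i * w x - pd i w x) ^ 2 := by
      have : (n : ℝ) * w x ^ 2 = ∑ i : Fin n, w x ^ 2 := by simp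
      rw [this, Finset.sum_mul, ← Finset.sum_add_distrib, ← Finset.sum_add_distrib,
        ← Finset.sum_sub_distrib]
      exact Finset.sum_congr rfl fun i _ => by ring
    linarith
  have e3 := integral_add j3 j0
  simp only [Pi.add_apply] at this
  rw [hsum, add_zero] at e3
  exact e3.symm.trans_le this

end Variance

section Core

variable {n : ℕ}

/-- A variance bound for even functions under a pointwise quadratic-form condition which uses the
radial drift in addition to the Hessian. -/
theorem variance_le_of_quadratic {V φ χ : Euc n → ℝ} (hn : 1 ≤ n) (hV : ContDiff ℝ 2 V)
    (hVe : ∀ x, V (-x) = V x) (hconv : ∀ x w, 0 ≤ hess V x w) (hφ : ContDiff ℝ 1 φ)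
    (hφe : ∀ x, φ (-x) = φ x) (hω : Integrable (wt (addGauss V)))
    (hφ1 : Integrable fun x => φ x * wt (addGauss V) x)
    (hφ2 : Integrable fun x => φ x ^ 2 * wt (addGauss V) x)
    (hχ : Integrable fun x => χ x * wt (addGauss V) x)
    (hQ : ∀ (x : Euc n) (w : Fin n → ℝ), 0 ≤ χ x - 2 * (∑ i, pd i φ x * w i) + hess V x w
      + 2 / ((n : ℝ) + 1) * (∑ i, x i * pd i V x) * ∑ i, w i ^ 2) :
    (∫ x, wt (addGauss V) x) * (∫ x, φ x ^ 2 * wt (addGauss V) x)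
      - (∫ x, φ x * wt (addGauss V) x) ^ 2
      ≤ (∫ x, wt (addGauss V) x) * ∫ x, χ x * wt (addGauss V) x := by
  have hW : ContDiff ℝ 2 (addGauss V) := contDiff_addGauss hV
  have hWe : ∀ x, addGauss V (-x) = addGauss V x := fun x => by simp [addGauss, hVe]
  set ω := wt (addGauss V) with hωd
  have cw : Continuous ω := (contDiff_wt hW).continuous
  set Z := ∫ x, ω x with hZ
  have hZ0 : 0 < Z := by
    refine (integral_pos_iff_support_of_nonneg (fun x => (wt_pos _ x).le) hω).2 ?_
    have : Function.support ω = Set.univ :=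
      Set.eq_univ_of_forall fun x => (wt_pos _ x).ne'
    rw [this]
    exact Measure.measure_univ_pos.2 (NeZero.ne _)
  set a := (∫ x, φ x * ω x) / Z with ha
  have haZ : ∫ x, φ x * ω x = a * Z := by
    rw [ha]
    field_simp
  set ψ : Euc n → ℝ := fun x => φ x - a with hψ
  have hψc : ContDiff ℝ 1 ψ := hφ.sub contDiff_const
  have e1 : ∀ x, ψ x ^ 2 * ω x = φ x ^ 2 * ω x + (a ^ 2 * ω x - 2 * a * (φ x * ω x)) := fun x => by
    simp only [hψ]
    ring
  have hψ2 : Integrable fun x => ψ x ^ 2 * ω x := by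
    simp only [e1]
    exact hφ2.add ((hω.const_mul _).sub (hφ1.const_mul _))
  have hψint : ∫ x, ψ x ^ 2 * ω x = (∫ x, φ x ^ 2 * ω x) - a ^ 2 * Z := by
    simp only [e1]
    rw [integral_add hφ2 (by exact (hω.const_mul _).sub (hφ1.const_mul _)),
      integral_sub (by exact hω.const_mul _) (by exact hφ1.const_mul _), integral_const_mul,
      integral_const_mul, haZ]
    ring
  have hψ0 : ∫ x, ψ x * ω x = 0 := by
    simp only [hψ, sub_mul]
    rw [integral_sub hφ1 (hω.const_mul a), integral_const_mul, haZ]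
    ring
  have hpdψ : ∀ i x, pd i ψ x = pd i φ x := fun i x => by
    rw [hψ, pd_sub (hφ.differentiable (by norm_num) x) (differentiableAt_const a)]
    simp [pd]
  suffices hmain : ∫ x, ψ x ^ 2 * ω x ≤ ∫ x, χ x * ω x by
    rw [hψint] at hmain
    rw [haZ]
    nlinarith [mul_le_mul_of_nonneg_left hmain hZ0.le]
  refine le_of_forall_pos_le_add fun ε hε => ?_
  obtain ⟨u, hu, hc, hue, hle⟩ := exists_even_gen_approx hW hψc.continuous hWe
    (fun x => by simp [hψ, hφe]) hψ2 hψ0 hε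
  have hu3 : ContDiff ℝ 3 u := contDiff_infty.1 hu 3
  have cu : ∀ i, Continuous (pd i u) := fun i => (hu3.pd (m := 2) (by norm_num) i).continuous
  have cuu : ∀ i j, Continuous (pd i (pd j u)) := fun i j =>
    ((hu3.pd (m := 2) (by norm_num) j).pd (m := 1) (by norm_num) i).continuous
  have cφ : ∀ i, Continuous (pd i φ) := fun i => (hφ.pd (m := 0) (by norm_num) i).continuous
  have cV : ∀ i, Continuous (pd i V) := fun i => (hV.pd (m := 1) (by norm_num) i).continuous
  have ch := continuous_hess hV cu
  have hdual := integral_sq_le_of_gen_approx hW hψc hψ2 hu3 hc hle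
  have hui : ∀ i, ContDiff ℝ 1 (pd i u) := fun i => hu3.pd (by norm_num) i
  have huo : ∀ i x, pd i u (-x) = - pd i u x := fun i x =>
    pd_neg_of_even (hu3.differentiable (by norm_num)) hue x i
  have hpoin := fun i => poincare_of_odd hV hVe hconv (hui i) (hc.pd i) (huo i)
  have hdrift := fun i => integral_drift_le hV (hui i) (hc.pd i)
  have j1 : Integrable fun x => (2 * (∑ i, pd i φ x * pd i u x)
      + hess V x fun i => pd i u x) * ω x :=
    integrable_of_zero_off_tsupport (u := u) (by fun_prop) hc fun x hx => by
      simp [pd_eq_zero_of_notMem_tsupport hx, hess]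
  have j2 : ∀ j, Integrable fun x => (∑ i, pd i (pd j u) x ^ 2) * ω x := fun j =>
    integrable_of_zero_off_tsupport (u := u) (by fun_prop) hc fun x hx => by
      simp [pd_pd_eq_zero_of_notMem_tsupport hx]
  have j3 : ∀ j, Integrable fun x => pd j u x ^ 2 * ω x := fun j =>
    integrable_of_zero_off_tsupport (u := u) (by fun_prop) hc fun x hx => by
      simp [pd_eq_zero_of_notMem_tsupport hx]
  have j4 : ∀ j, Integrable fun x => (∑ i, x i * pd i V x) * pd j u x ^ 2 * ω x := fun j =>
    integrable_of_zero_off_tsupport (u := u) (by fun_prop) hc fun x hx => by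
      simp [pd_eq_zero_of_notMem_tsupport hx]
  have j2' : Integrable fun x => ∑ j, (∑ i, pd i (pd j u) x ^ 2) * ω x :=
    integrable_finsetSum _ fun j _ => j2 j
  have j3' : Integrable fun x => ∑ j, pd j u x ^ 2 * ω x := integrable_finsetSum _ fun j _ => j3 j
  have j4' : Integrable fun x => ∑ j, (∑ i, x i * pd i V x) * pd j u x ^ 2 * ω x :=
    integrable_finsetSum _ fun j _ => j4 j
  set A := ∫ x, ∑ j, pd j u x ^ 2 * ω x with hA
  set B := ∫ x, ∑ j, (∑ i, pd i (pd j u) x ^ 2) * ω x with hB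
  set D := ∫ x, ∑ j, (∑ i, x i * pd i V x) * pd j u x ^ 2 * ω x with hD
  set E := ∫ x, (2 * (∑ i, pd i φ x * pd i u x) + hess V x fun i => pd i u x) * ω x with hE
  have hAB : A ≤ B := by
    rw [hA, hB, integral_finsetSum _ fun j _ => j3 j, integral_finsetSum _ fun j _ => j2 j]
    exact Finset.sum_le_sum fun j _ => hpoin j
  have hDAB : D ≤ n * A + B := by
    rw [hA, hB, hD, integral_finsetSum _ fun j _ => j3 j, integral_finsetSum _ fun j _ => j2 j,
      integral_finsetSum _ fun j _ => j4 j, Finset.mul_sum, ← Finset.sum_add_distrib]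
    exact Finset.sum_le_sum fun j _ => hdrift j
  have hdual' : ∫ x, ψ x ^ 2 * ω x ≤ ε - (E + B + A) := by
    refine hdual.trans_eq ?_
    congr 1
    rw [hE, hB, hA, ← integral_add j1 j2', ← integral_add (by exact j1.add j2') j3']
    refine integral_congr_ae (Filter.Eventually.of_forall fun x => ?_)
    simp only [hpdψ, hess_addGauss hV, ← Finset.sum_mul, ← add_mul]
    ring
  have hpos : 0 ≤ (∫ x, χ x * ω x) + E + 2 / ((n : ℝ) + 1) * D := by
    rw [hE, hD, ← integral_const_mul, ← integral_add hχ j1,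
      ← integral_add (by exact hχ.add j1) (by exact j4'.const_mul _)]
    refine integral_nonneg fun x => ?_
    simp only [Pi.zero_apply]
    have h1 := mul_nonneg (hQ x fun i => - pd i u x) (wt_pos (addGauss V) x).le
    refine h1.trans_eq ?_
    have h2 : hess V x (fun i => - pd i u x) = hess V x fun i => pd i u x := by
      simp [hess]
    rw [h2, ← hωd]
    simp only [mul_neg, Finset.sum_neg_distrib, neg_sq, ← Finset.sum_mul, ← Finset.mul_sum]
    ring
  have hn' : (1 : ℝ) ≤ n := by exact_mod_cast hn
  have hfin : 2 / ((n : ℝ) + 1) * D ≤ A + B := by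
    rw [div_mul_eq_mul_div, div_le_iff₀ (by positivity)]
    nlinarith [mul_nonneg (sub_nonneg.2 hn') (sub_nonneg.2 hAB)]
  linarith

end Core

/-! ### A convex profile and the quadratic inequality for one slab -/

section Profile

/-- The profile `N (y - 1)₊^(k+3)`. -/
def bump (N : ℝ) (k : ℕ) (y : ℝ) : ℝ := N * max (y - 1) 0 ^ (k + 3)

/-- The derivative of `bump`. -/
def bumpDeriv (N : ℝ) (k : ℕ) (y : ℝ) : ℝ := N * (k + 3) * max (y - 1) 0 ^ (k + 2)

/-- The second derivative of `bump`. -/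
def bumpDerivTwo (N : ℝ) (k : ℕ) (y : ℝ) : ℝ := N * (k + 3) * (k + 2) * max (y - 1) 0 ^ (k + 1)

lemma hasDerivAt_max_zero_pow (k : ℕ) (y : ℝ) :
    HasDerivAt (fun y : ℝ => max y 0 ^ (k + 2)) ((k + 2) * max y 0 ^ (k + 1)) y := by
  rcases lt_trichotomy y 0 with h | rfl | h
  · have : (fun y : ℝ => max y 0 ^ (k + 2)) =ᶠ[nhds y] fun _ => 0 := by
      filter_upwards [Iio_mem_nhds h] with z hz
      simp [max_eq_right (Set.mem_Iio.1 hz).le]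
    simpa [max_eq_right h.le] using (hasDerivAt_const y (0 : ℝ)).congr_of_eventuallyEq this
  · rw [hasDerivAt_iff_isLittleO_nhds_zero]
    simp only [zero_add, max_self, ne_eq, Nat.add_eq_zero_iff, OfNat.ofNat_ne_zero, and_false,
      not_false_eq_true, zero_pow, sub_zero, one_ne_zero, mul_zero, smul_zero]
    have h1 : (fun h : ℝ => max h 0 ^ (k + 2)) =O[nhds 0] fun h : ℝ => h ^ (k + 2) := by
      refine Asymptotics.IsBigO.of_bound 1 (Filter.Eventually.of_forall fun h => ?_)
      rw [one_mul, norm_pow, norm_pow]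
      refine pow_le_pow_left₀ (norm_nonneg _) ?_ _
      rw [Real.norm_eq_abs, Real.norm_eq_abs, abs_of_nonneg (le_max_right _ _)]
      exact max_le (le_abs_self _) (abs_nonneg _)
    refine h1.trans_isLittleO ?_
    simpa using Asymptotics.isLittleO_pow_pow (𝕜 := ℝ) (show 1 < k + 2 by omega)
  · have : (fun y : ℝ => max y 0 ^ (k + 2)) =ᶠ[nhds y] fun y => y ^ (k + 2) := by
      filter_upwards [Ioi_mem_nhds h] with z hz
      rw [max_eq_left (Set.mem_Ioi.1 hz).le]
    rw [max_eq_left h.le]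
    have h2 := (hasDerivAt_pow (k + 2) y).congr_of_eventuallyEq this
    simpa using h2

lemma hasDerivAt_bump (N : ℝ) (k : ℕ) (y : ℝ) : HasDerivAt (bump N k) (bumpDeriv N k y) y := by
  have h := ((hasDerivAt_max_zero_pow (k + 1) (y - 1)).comp y
    ((hasDerivAt_id y).sub_const 1)).const_mul N
  refine h.congr_deriv ?_
  simp only [bumpDeriv]
  push_cast
  ring

lemma hasDerivAt_bumpDeriv (N : ℝ) (k : ℕ) (y : ℝ) :
    HasDerivAt (bumpDeriv N k) (bumpDerivTwo N k y) y := by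
  have h := ((hasDerivAt_max_zero_pow k (y - 1)).comp y
    ((hasDerivAt_id y).sub_const 1)).const_mul (N * (k + 3))
  refine h.congr_deriv ?_
  simp only [bumpDerivTwo]
  ring

lemma continuous_bumpDerivTwo (N : ℝ) (k : ℕ) : Continuous (bumpDerivTwo N k) := by
  unfold bumpDerivTwo
  fun_prop

lemma contDiff_one_bumpDeriv (N : ℝ) (k : ℕ) : ContDiff ℝ 1 (bumpDeriv N k) := by
  rw [contDiff_one_iff_deriv]
  refine ⟨fun y => (hasDerivAt_bumpDeriv N k y).differentiableAt, ?_⟩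
  rw [funext fun y => (hasDerivAt_bumpDeriv N k y).deriv]
  exact continuous_bumpDerivTwo N k

lemma contDiff_two_bump (N : ℝ) (k : ℕ) : ContDiff ℝ 2 (bump N k) := by
  rw [show (2 : WithTop ℕ∞) = 1 + 1 from by norm_num, contDiff_succ_iff_deriv]
  refine ⟨fun y => (hasDerivAt_bump N k y).differentiableAt, by simp, ?_⟩
  rw [funext fun y => (hasDerivAt_bump N k y).deriv]
  exact contDiff_one_bumpDeriv N k

variable {N : ℝ} {k : ℕ} {y : ℝ}

lemma bump_nonneg (hN : 0 ≤ N) : 0 ≤ bump N k y := by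
  unfold bump
  positivity

lemma bumpDeriv_nonneg (hN : 0 ≤ N) : 0 ≤ bumpDeriv N k y := by
  unfold bumpDeriv
  positivity

lemma bumpDerivTwo_nonneg (hN : 0 ≤ N) : 0 ≤ bumpDerivTwo N k y := by
  unfold bumpDerivTwo
  positivity

lemma bump_eq_zero (hy : y ≤ 1) : bump N k y = 0 := by
  simp [bump, max_eq_right (sub_nonpos.2 hy)]

lemma bumpDeriv_eq_zero (hy : y ≤ 1) : bumpDeriv N k y = 0 := by
  simp [bumpDeriv, max_eq_right (sub_nonpos.2 hy)]

lemma bumpDeriv_le_mul (hN : 0 ≤ N) (hy : 0 ≤ y) :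
    (k + 2) * bumpDeriv N k y ≤ bumpDerivTwo N k y * y := by
  unfold bumpDeriv bumpDerivTwo
  have h : max (y - 1) 0 ≤ y := max_le (by linarith) hy
  have h0 : 0 ≤ N * (k + 3) * (k + 2) * max (y - 1) 0 ^ (k + 1) := by positivity
  calc (k + 2) * (N * (k + 3) * max (y - 1) 0 ^ (k + 2))
      = N * (k + 3) * (k + 2) * max (y - 1) 0 ^ (k + 1) * max (y - 1) 0 := by ring
    _ ≤ _ := mul_le_mul_of_nonneg_left h h0

lemma bumpDeriv_le (hN : 0 ≤ N) (hy : 0 ≤ y) : bumpDeriv N k y ≤ N * (k + 3) * y ^ (k + 2) := by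
  unfold bumpDeriv
  have h : max (y - 1) 0 ≤ y := max_le (by linarith) hy
  gcongr

lemma bumpDerivTwo_le (hN : 0 ≤ N) (hy : 0 ≤ y) :
    bumpDerivTwo N k y ≤ N * (k + 3) * (k + 2) * y ^ (k + 1) := by
  unfold bumpDerivTwo
  have h : max (y - 1) 0 ≤ y := max_le (by linarith) hy
  gcongr

/-- The quadratic form attached to the slab `s² q ≤ 1` dominates the drift it needs. -/
lemma slab_quadratic_nonneg {p δ c r q q₁ q₂ s σ : ℝ} (hN : 0 ≤ N) (hp : 0 ≤ p) (hp1 : p ≤ 1)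
    (hδ : 0 < δ) (hδp : δ ≤ 2 * c * r ^ 2 - (1 - p)) (hk : 1 ≤ 2 * δ * (k + 2))
    (hc : 0 ≤ c) (hq : 0 < q) (hqr : q * r ^ 2 ≤ 1) (hqq : (1 + p / 2) * q₁ ^ 2 ≤ q * q₂) :
    0 ≤ bumpDerivTwo N k (s ^ 2 * q) * (s ^ 2 * q₁) ^ 2 + bumpDeriv N k (s ^ 2 * q) * (s ^ 2 * q₂)
      - 2 * ((bumpDerivTwo N k (s ^ 2 * q) * (2 * s * q) * (s ^ 2 * q₁)
        + bumpDeriv N k (s ^ 2 * q) * (2 * s * q₁)) * σ)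
      + (bumpDerivTwo N k (s ^ 2 * q) * (2 * s * q) ^ 2 + bumpDeriv N k (s ^ 2 * q) * (2 * q))
        * σ ^ 2
      + 2 * c * (2 * bumpDeriv N k (s ^ 2 * q) * (s ^ 2 * q)) * σ ^ 2 := by
  have hy0 : 0 ≤ s ^ 2 * q := by positivity
  have hab := bumpDeriv_le_mul (k := k) hN hy0
  have ha := bumpDerivTwo_nonneg (N := N) (k := k) (y := s ^ 2 * q) hN
  have hb := bumpDeriv_nonneg (N := N) (k := k) (y := s ^ 2 * q) hN
  have hb1 : 0 ≤ bumpDeriv N k (s ^ 2 * q) * (s ^ 2 * q - 1) := by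
    rcases le_total (s ^ 2 * q) 1 with h | h
    · simp [bumpDeriv_eq_zero h]
    · exact mul_nonneg hb (sub_nonneg.2 h)
  generalize bumpDerivTwo N k (s ^ 2 * q) = a at *
  generalize bumpDeriv N k (s ^ 2 * q) = b at *
  refine nonneg_of_mul_nonneg_right (a := q) ?_ hq
  set Z := s * q₁ - 2 * (q * σ)
  set F := q * σ
  have e1 : 0 ≤ b * s ^ 2 * (q * q₂ - (1 + p / 2) * q₁ ^ 2) :=
    mul_nonneg (by positivity) (sub_nonneg.2 hqq)
  have e2 : 0 ≤ 4 * c * b * (s ^ 2 * q) * (q * σ ^ 2) * (1 - q * r ^ 2) :=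
    mul_nonneg (by positivity) (sub_nonneg.2 hqr)
  have e3 : 0 ≤ (a * (s ^ 2 * q) - (k + 2) * b) * Z ^ 2 :=
    mul_nonneg (sub_nonneg.2 hab) (sq_nonneg _)
  have e4 : 0 ≤ 4 * c * r ^ 2 * (b * (s ^ 2 * q - 1)) * F ^ 2 := by positivity
  have e5 : 0 ≤ 2 * b * (2 * c * r ^ 2 - (1 - p) - δ) * F ^ 2 :=
    mul_nonneg (mul_nonneg (by positivity) (by linarith)) (sq_nonneg _)
  have e6 : 0 ≤ b * ((k + 2) * Z ^ 2 + (1 + p / 2) * Z ^ 2 + 2 * p * Z * F + 2 * δ * F ^ 2) := by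
    refine mul_nonneg hb ?_
    have h1 : 0 ≤ 2 * δ * ((k + 2) * Z ^ 2 + 2 * p * Z * F + 2 * δ * F ^ 2) := by
      have : 0 ≤ (2 * δ * (k + 2) - 1) * Z ^ 2 := mul_nonneg (by linarith) (sq_nonneg _)
      have h3 : 0 ≤ (1 - p ^ 2) * Z ^ 2 := mul_nonneg (by nlinarith) (sq_nonneg _)
      nlinarith [sq_nonneg (p * Z + 2 * δ * F)]
    have h2 := nonneg_of_mul_nonneg_right h1 (by positivity)
    nlinarith [mul_nonneg hp (sq_nonneg Z), sq_nonneg Z]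
  have key : q * (a * (s ^ 2 * q₁) ^ 2 + b * (s ^ 2 * q₂)
      - 2 * ((a * (2 * s * q) * (s ^ 2 * q₁) + b * (2 * s * q₁)) * σ)
      + (a * (2 * s * q) ^ 2 + b * (2 * q)) * σ ^ 2
      + 2 * c * (2 * b * (s ^ 2 * q)) * σ ^ 2)
      = b * s ^ 2 * (q * q₂ - (1 + p / 2) * q₁ ^ 2)
        + 4 * c * b * (s ^ 2 * q) * (q * σ ^ 2) * (1 - q * r ^ 2)
        + (a * (s ^ 2 * q) - (k + 2) * b) * Z ^ 2
        + 4 * c * r ^ 2 * (b * (s ^ 2 * q - 1)) * F ^ 2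
        + 2 * b * (2 * c * r ^ 2 - (1 - p) - δ) * F ^ 2
        + b * ((k + 2) * Z ^ 2 + (1 + p / 2) * Z ^ 2 + 2 * p * Z * F + 2 * δ * F ^ 2) := by
    simp only [Z, F]
    ring
  rw [key]
  positivity

end Profile

/-! ### Potentials that penalise leaving finitely many symmetric slabs -/

section SlabPotential

variable {n : ℕ}

/-- The potential `∑ⱼ G(⟨x, uⱼ⟩² qⱼ)` with `G` the profile `bump N k`. -/
def slabPot (N : ℝ) (k : ℕ) (s : Finset ℕ) (u : ℕ → Euc n) (q : ℕ → ℝ) (x : Euc n) : ℝ :=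
  ∑ j ∈ s, bump N k (⟪x, u j⟫ ^ 2 * q j)

/-- The derivative of `slabPot` along a curve `q` with velocity `q₁`. -/
def slabPotDot (N : ℝ) (k : ℕ) (s : Finset ℕ) (u : ℕ → Euc n) (q q₁ : ℕ → ℝ) (x : Euc n) : ℝ :=
  ∑ j ∈ s, bumpDeriv N k (⟪x, u j⟫ ^ 2 * q j) * (⟪x, u j⟫ ^ 2 * q₁ j)

/-- The second derivative of `slabPot` along a curve `q` with velocity `q₁` and
acceleration `q₂`. -/
def slabPotDdot (N : ℝ) (k : ℕ) (s : Finset ℕ) (u : ℕ → Euc n) (q q₁ q₂ : ℕ → ℝ)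
    (x : Euc n) : ℝ :=
  ∑ j ∈ s, (bumpDerivTwo N k (⟪x, u j⟫ ^ 2 * q j) * (⟪x, u j⟫ ^ 2 * q₁ j) ^ 2
    + bumpDeriv N k (⟪x, u j⟫ ^ 2 * q j) * (⟪x, u j⟫ ^ 2 * q₂ j))

variable (N : ℝ) (k : ℕ) (s : Finset ℕ) (u : ℕ → Euc n) (q q₁ q₂ : ℕ → ℝ)

lemma contDiff_inner_sq_mul (v : Euc n) (c : ℝ) {m : WithTop ℕ∞} :
    ContDiff ℝ m fun x : Euc n => ⟪x, v⟫ ^ 2 * c :=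
  ((contDiff_id.inner ℝ contDiff_const).pow 2).mul contDiff_const

lemma contDiff_slabPot : ContDiff ℝ 2 (slabPot N k s u q) := by
  refine ContDiff.sum fun j _ => (contDiff_two_bump N k).comp
    (contDiff_inner_sq_mul _ _)

lemma contDiff_slabPotDot : ContDiff ℝ 1 (slabPotDot N k s u q q₁) := by
  refine ContDiff.sum fun j _ => ((contDiff_one_bumpDeriv N k).comp
    (contDiff_inner_sq_mul _ _)).mul (contDiff_inner_sq_mul _ _)

lemma continuous_slabPotDdot : Continuous (slabPotDdot N k s u q q₁ q₂) := by
  have h1 := continuous_bumpDerivTwo N k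
  have h2 := (contDiff_one_bumpDeriv N k).continuous
  unfold slabPotDdot
  fun_prop

lemma slabPot_neg (x : Euc n) : slabPot N k s u q (-x) = slabPot N k s u q x := by
  simp [slabPot]

lemma slabPotDot_neg (x : Euc n) : slabPotDot N k s u q q₁ (-x) = slabPotDot N k s u q q₁ x := by
  simp [slabPotDot]

lemma hasFDerivAt_ridge {f : ℝ → ℝ} {f' : ℝ} {v x : Euc n} (hf : HasDerivAt f f' ⟪x, v⟫) :
    HasFDerivAt (fun x : Euc n => f ⟪x, v⟫) (f' • innerSL ℝ v) x := by
  have h : HasFDerivAt (fun x : Euc n => ⟪x, v⟫) (innerSL ℝ v) x := by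
    have := (innerSL ℝ v).hasFDerivAt (x := x)
    refine this.congr_of_eventuallyEq (Filter.Eventually.of_forall fun y => ?_)
    simp [real_inner_comm]
  exact hf.comp_hasFDerivAt x h

lemma pd_sum_ridge {f : ℕ → ℝ → ℝ} {f' : ℕ → ℝ → ℝ} {v : ℕ → Euc n}
    (hf : ∀ j y, HasDerivAt (f j) (f' j y) y) (i : Fin n) :
    pd i (fun x => ∑ j ∈ s, f j ⟪x, v j⟫) = fun x => ∑ j ∈ s, f' j ⟪x, v j⟫ * v j i := by
  funext x
  have h := HasFDerivAt.fun_sum fun j (_ : j ∈ s) => hasFDerivAt_ridge (v := v j) (x := x) (hf j _)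
  rw [pd, h.fderiv]
  simp [EuclideanSpace.inner_single_right]

lemma hasDerivAt_sq_mul (c y : ℝ) : HasDerivAt (fun y : ℝ => y ^ 2 * c) (2 * y * c) y := by
  simpa using (hasDerivAt_pow 2 y).mul_const c

lemma pd_slabPot (i : Fin n) : pd i (slabPot N k s u q) = fun x =>
    ∑ j ∈ s, bumpDeriv N k (⟪x, u j⟫ ^ 2 * q j) * (2 * ⟪x, u j⟫ * q j) * u j i :=
  pd_sum_ridge s (f := fun j y => bump N k (y ^ 2 * q j))
    (f' := fun j y => bumpDeriv N k (y ^ 2 * q j) * (2 * y * q j))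
    (fun _ y => (hasDerivAt_bump N k _).comp y (hasDerivAt_sq_mul _ _)) i

lemma pd_slabPotDot (i : Fin n) : pd i (slabPotDot N k s u q q₁) = fun x =>
    ∑ j ∈ s, (bumpDerivTwo N k (⟪x, u j⟫ ^ 2 * q j) * (2 * ⟪x, u j⟫ * q j) * (⟪x, u j⟫ ^ 2 * q₁ j)
      + bumpDeriv N k (⟪x, u j⟫ ^ 2 * q j) * (2 * ⟪x, u j⟫ * q₁ j)) * u j i :=
  pd_sum_ridge s (f := fun j y => bumpDeriv N k (y ^ 2 * q j) * (y ^ 2 * q₁ j))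
    (f' := fun j y => bumpDerivTwo N k (y ^ 2 * q j) * (2 * y * q j) * (y ^ 2 * q₁ j)
      + bumpDeriv N k (y ^ 2 * q j) * (2 * y * q₁ j))
    (fun _ y => ((hasDerivAt_bumpDeriv N k _).comp y (hasDerivAt_sq_mul _ _)).mul
      (hasDerivAt_sq_mul _ _)) i

lemma pd_pd_slabPot (i l : Fin n) : pd l (pd i (slabPot N k s u q)) = fun x =>
    ∑ j ∈ s, (bumpDerivTwo N k (⟪x, u j⟫ ^ 2 * q j) * (2 * ⟪x, u j⟫ * q j) ^ 2
      + bumpDeriv N k (⟪x, u j⟫ ^ 2 * q j) * (2 * q j)) * u j i * u j l := by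
  rw [pd_slabPot]
  refine pd_sum_ridge s
    (f := fun j y => bumpDeriv N k (y ^ 2 * q j) * (2 * y * q j) * u j i)
    (f' := fun j y => (bumpDerivTwo N k (y ^ 2 * q j) * (2 * y * q j) ^ 2
      + bumpDeriv N k (y ^ 2 * q j) * (2 * q j)) * u j i)
    (fun j y => ?_) l
  have h1 := (hasDerivAt_bumpDeriv N k (y ^ 2 * q j)).comp y (hasDerivAt_sq_mul (q j) y)
  have h2 : HasDerivAt (fun y : ℝ => 2 * y * q j) (2 * q j) y := by
    simpa using ((hasDerivAt_id y).const_mul 2).mul_const (q j)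
  refine ((h1.mul h2).mul_const (u j i)).congr_deriv ?_
  simp only [Function.comp_apply]
  ring

lemma hess_slabPot (x : Euc n) (w : Fin n → ℝ) : hess (slabPot N k s u q) x w =
    ∑ j ∈ s, (bumpDerivTwo N k (⟪x, u j⟫ ^ 2 * q j) * (2 * ⟪x, u j⟫ * q j) ^ 2
      + bumpDeriv N k (⟪x, u j⟫ ^ 2 * q j) * (2 * q j)) * (∑ i, u j i * w i) ^ 2 := by
  simp only [hess, pd_pd_slabPot, Finset.sum_mul]
  simp_rw [Finset.sum_comm (s := Finset.univ) (t := s)]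
  refine Finset.sum_congr rfl fun j _ => ?_
  rw [sq (∑ i, u j i * w i), Finset.sum_mul_sum, Finset.mul_sum]
  simp_rw [Finset.mul_sum]
  rw [Finset.sum_comm]
  refine Finset.sum_congr rfl fun i _ => Finset.sum_congr rfl fun l _ => ?_
  ring

variable {N k s u q q₁ q₂}

lemma slabPot_nonneg (hN : 0 ≤ N) (x : Euc n) : 0 ≤ slabPot N k s u q x :=
  Finset.sum_nonneg fun _ _ => bump_nonneg hN

lemma hess_slabPot_nonneg (hN : 0 ≤ N) (hq : ∀ j, 0 < q j) (x : Euc n) (w : Fin n → ℝ) :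
    0 ≤ hess (slabPot N k s u q) x w := by
  rw [hess_slabPot]
  refine Finset.sum_nonneg fun j _ => mul_nonneg (add_nonneg
    (mul_nonneg (bumpDerivTwo_nonneg hN) (sq_nonneg _))
    (mul_nonneg (bumpDeriv_nonneg hN) (by linarith [hq j]))) (sq_nonneg _)

lemma slabPot_quadratic_nonneg {p δ r : ℝ} (hN : 0 ≤ N) (hp : 0 ≤ p) (hp1 : p ≤ 1)
    (hδ : 0 < δ) (hδp : δ ≤ 2 * r ^ 2 / ((n : ℝ) + 1) - (1 - p)) (hk : 1 ≤ 2 * δ * (k + 2))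
    (hu : ∀ j, ‖u j‖ = 1) (hq : ∀ j, 0 < q j) (hqr : ∀ j, q j * r ^ 2 ≤ 1)
    (hqq : ∀ j, (1 + p / 2) * q₁ j ^ 2 ≤ q j * q₂ j) (x : Euc n) (w : Fin n → ℝ) :
    0 ≤ slabPotDdot N k s u q q₁ q₂ x - 2 * (∑ i, pd i (slabPotDot N k s u q q₁) x * w i)
      + hess (slabPot N k s u q) x w
      + 2 / ((n : ℝ) + 1) * (∑ i, x i * pd i (slabPot N k s u q) x) * ∑ i, w i ^ 2 := by
  have e1 : ∑ i, pd i (slabPotDot N k s u q q₁) x * w i = ∑ j ∈ s,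
      (bumpDerivTwo N k (⟪x, u j⟫ ^ 2 * q j) * (2 * ⟪x, u j⟫ * q j) * (⟪x, u j⟫ ^ 2 * q₁ j)
      + bumpDeriv N k (⟪x, u j⟫ ^ 2 * q j) * (2 * ⟪x, u j⟫ * q₁ j)) * ∑ i, u j i * w i := by
    simp only [pd_slabPotDot, Finset.sum_mul]
    rw [Finset.sum_comm]
    refine Finset.sum_congr rfl fun j _ => ?_
    rw [Finset.mul_sum]
    refine Finset.sum_congr rfl fun i _ => ?_
    ring
  have e2 : ∑ i, x i * pd i (slabPot N k s u q) x = ∑ j ∈ s,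
      2 * bumpDeriv N k (⟪x, u j⟫ ^ 2 * q j) * (⟪x, u j⟫ ^ 2 * q j) := by
    simp only [pd_slabPot, Finset.mul_sum]
    rw [Finset.sum_comm]
    refine Finset.sum_congr rfl fun j _ => ?_
    have h : ⟪x, u j⟫ = ∑ i, x i * u j i := by
      simp [PiLp.inner_apply, mul_comm]
    calc ∑ i, x i * (bumpDeriv N k (⟪x, u j⟫ ^ 2 * q j) * (2 * ⟪x, u j⟫ * q j) * u j i)
        = bumpDeriv N k (⟪x, u j⟫ ^ 2 * q j) * (2 * ⟪x, u j⟫ * q j) * ∑ i, x i * u j i := by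
          rw [Finset.mul_sum]
          refine Finset.sum_congr rfl fun i _ => ?_
          ring
      _ = _ := by
          rw [← h]
          ring
  obtain ⟨W, hW⟩ : ∃ W, W = ∑ i, w i ^ 2 := ⟨_, rfl⟩
  rw [e1, e2, ← hW, hess_slabPot, slabPotDdot, Finset.mul_sum, Finset.mul_sum, Finset.sum_mul,
    ← Finset.sum_sub_distrib, ← Finset.sum_add_distrib, ← Finset.sum_add_distrib]
  refine Finset.sum_nonneg fun j _ => ?_
  have h := slab_quadratic_nonneg (N := N) (k := k) (p := p) (δ := δ) (c := 1 / ((n : ℝ) + 1))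
    (r := r) (q := q j) (q₁ := q₁ j) (q₂ := q₂ j) (s := ⟪x, u j⟫) (σ := ∑ i, u j i * w i)
    hN hp hp1 hδ (by convert hδp using 2; ring) hk (by positivity) (hq j) (hqr j) (hqq j)
  have hcs : (∑ i, u j i * w i) ^ 2 ≤ W := by
    have h1 := Finset.sum_mul_sq_le_sq_mul_sq Finset.univ (fun i => u j i) w
    have h2 : ∑ i, u j i ^ 2 = 1 := by
      have := EuclideanSpace.real_norm_sq_eq (u j)
      rw [hu j] at this
      simpa using this.symm
    simpa [h2, hW] using h1
  have hb := bumpDeriv_nonneg (N := N) (k := k) (y := ⟪x, u j⟫ ^ 2 * q j) hN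
  have h3 : 2 * (1 / ((n : ℝ) + 1)) * (2 * bumpDeriv N k (⟪x, u j⟫ ^ 2 * q j)
      * (⟪x, u j⟫ ^ 2 * q j)) * (∑ i, u j i * w i) ^ 2
      ≤ 2 / ((n : ℝ) + 1) * (2 * bumpDeriv N k (⟪x, u j⟫ ^ 2 * q j)
      * (⟪x, u j⟫ ^ 2 * q j)) * W := by
    rw [mul_one_div]
    have := hq j
    exact mul_le_mul_of_nonneg_left hcs (by positivity)
  linarith

end SlabPotential

/-! ### Log-concavity of the mass along a curve of slab potentials -/

section Curve

/-- A curve `q = h⁻²` on `[0, 1]` with `h ≥ r` an `L_p` mean of constants, in the weak sense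
used below: first two derivatives `q₁`, `q₂` and the inequality `q q₂ ≥ (1 + p/2) q₁²`. -/
structure IsSlabCurve (p r : ℝ) (q q₁ q₂ : ℝ → ℝ) : Prop where
  pos : ∀ t ∈ Set.Icc (0 : ℝ) 1, 0 < q t
  mul_le : ∀ t ∈ Set.Icc (0 : ℝ) 1, q t * r ^ 2 ≤ 1
  hasDerivAt : ∀ t ∈ Set.Icc (0 : ℝ) 1, HasDerivAt q (q₁ t) t
  hasDerivAt_deriv : ∀ t ∈ Set.Icc (0 : ℝ) 1, HasDerivAt q₁ (q₂ t) t
  continuousOn : ContinuousOn q₂ (Set.Icc 0 1)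
  sq_le : ∀ t ∈ Set.Icc (0 : ℝ) 1, (1 + p / 2) * q₁ t ^ 2 ≤ q t * q₂ t

lemma IsSlabCurve.exists_bound {p r : ℝ} {q q₁ q₂ : ℝ → ℝ} (h : IsSlabCurve p r q q₁ q₂) :
    ∃ B, 0 ≤ B ∧ ∀ t ∈ Set.Icc (0 : ℝ) 1, |q t| ≤ B ∧ |q₁ t| ≤ B ∧ |q₂ t| ≤ B := by
  have hc : ContinuousOn q (Set.Icc 0 1) := fun t ht =>
    (h.hasDerivAt t ht).continuousAt.continuousWithinAt
  have hc1 : ContinuousOn q₁ (Set.Icc 0 1) := fun t ht =>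
    (h.hasDerivAt_deriv t ht).continuousAt.continuousWithinAt
  obtain ⟨A, hA⟩ := isCompact_Icc.exists_bound_of_continuousOn hc
  obtain ⟨A1, hA1⟩ := isCompact_Icc.exists_bound_of_continuousOn hc1
  obtain ⟨A2, hA2⟩ := isCompact_Icc.exists_bound_of_continuousOn h.continuousOn
  refine ⟨max (max A A1) (max A2 0), le_max_of_le_right (le_max_right _ _), fun t ht => ⟨?_, ?_, ?_⟩⟩
  · exact (hA t ht).trans (le_max_of_le_left (le_max_left _ _))
  · exact (hA1 t ht).trans (le_max_of_le_left (le_max_right _ _))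
  · exact (hA2 t ht).trans (le_max_of_le_right (le_max_left _ _))

variable {n : ℕ}

lemma integrable_exp_neg_mul_norm_sq {b : ℝ} (hb : 0 < b) :
    Integrable fun x : Euc n => Real.exp (-b * ‖x‖ ^ 2) := by
  by_contra h
  have h1 := GaussianFourier.integral_rexp_neg_mul_sq_norm (V := Euc n) hb
  rw [integral_undef h] at h1
  have : 0 < (Real.pi / b) ^ (Module.finrank ℝ (Euc n) / 2 : ℝ) := by positivity
  exact this.ne h1

lemma integrable_pow_mul_exp_neg_norm_sq (j : ℕ) :
    Integrable fun x : Euc n => (‖x‖ ^ 2) ^ j * Real.exp (-(‖x‖ ^ 2 / 2)) := by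
  refine ((integrable_exp_neg_mul_norm_sq (n := n) (b := 1 / 4) (by norm_num)).const_mul
    (4 ^ j * j.factorial)).mono' (by fun_prop) (Filter.Eventually.of_forall fun x => ?_)
  rw [Real.norm_of_nonneg (by positivity)]
  have h := Real.pow_div_factorial_le_exp (‖x‖ ^ 2 / 4) (by positivity) j
  rw [div_le_iff₀ (by positivity), div_pow, div_le_iff₀ (by positivity)] at h
  have e : Real.exp (-(‖x‖ ^ 2 / 2)) * Real.exp (‖x‖ ^ 2 / 4) = Real.exp (-(1 / 4) * ‖x‖ ^ 2) := by
    rw [← Real.exp_add]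
    ring_nf
  calc (‖x‖ ^ 2) ^ j * Real.exp (-(‖x‖ ^ 2 / 2))
      ≤ Real.exp (‖x‖ ^ 2 / 4) * j.factorial * 4 ^ j * Real.exp (-(‖x‖ ^ 2 / 2)) := by gcongr
    _ = 4 ^ j * j.factorial * (Real.exp (-(‖x‖ ^ 2 / 2)) * Real.exp (‖x‖ ^ 2 / 4)) := by ring
    _ = _ := by rw [e]

variable {p r N B : ℝ} {k : ℕ} {s : Finset ℕ} {u : ℕ → Euc n}

lemma wt_addGauss_le {V : Euc n → ℝ} (hV : ∀ x, 0 ≤ V x) (x : Euc n) :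
    wt (addGauss V) x ≤ Real.exp (-(‖x‖ ^ 2 / 2)) := by
  refine Real.exp_le_exp.2 ?_
  have := hV x
  unfold addGauss
  linarith

lemma abs_slabPotDot_le {q q₁ : ℕ → ℝ} (hN : 0 ≤ N) (hu : ∀ j, ‖u j‖ = 1) (hB : 0 ≤ B)
    (h0 : ∀ j ∈ s, 0 < q j) (hq : ∀ j ∈ s, |q j| ≤ B) (hq1 : ∀ j ∈ s, |q₁ j| ≤ B) (x : Euc n) :
    |slabPotDot N k s u q q₁ x| ≤ s.card * (N * (k + 3) * B ^ (k + 3)) * (‖x‖ ^ 2) ^ (k + 3) := by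
  refine (Finset.abs_sum_le_sum_abs _ _).trans ?_
  rw [mul_assoc, ← nsmul_eq_mul]
  refine Finset.sum_le_card_nsmul _ _ _ fun j hj => ?_
  have hs : ⟪x, u j⟫ ^ 2 ≤ ‖x‖ ^ 2 := by
    have := abs_real_inner_le_norm x (u j)
    rw [hu j, mul_one] at this
    exact sq_le_sq' (by linarith [neg_abs_le ⟪x, u j⟫]) ((le_abs_self _).trans this)
  have hqB : q j ≤ B := (le_abs_self _).trans (hq j hj)
  have hy : ⟪x, u j⟫ ^ 2 * q j ≤ ‖x‖ ^ 2 * B := by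
    have := h0 j hj
    gcongr
  have hy0 : 0 ≤ ⟪x, u j⟫ ^ 2 * q j := mul_nonneg (sq_nonneg _) (h0 j hj).le
  have hb := bumpDeriv_le (k := k) hN hy0
  have hb0 := bumpDeriv_nonneg (k := k) (y := ⟪x, u j⟫ ^ 2 * q j) hN
  rw [abs_mul, abs_of_nonneg hb0, abs_mul, abs_of_nonneg (sq_nonneg _)]
  calc bumpDeriv N k (⟪x, u j⟫ ^ 2 * q j) * (⟪x, u j⟫ ^ 2 * |q₁ j|)
      ≤ (N * (k + 3) * (‖x‖ ^ 2 * B) ^ (k + 2)) * (‖x‖ ^ 2 * B) := by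
        have := hq1 j hj
        refine mul_le_mul (hb.trans ?_) ?_ (by positivity) (by positivity) <;> gcongr
    _ = _ := by ring

lemma abs_slabPotDdot_le {q q₁ q₂ : ℕ → ℝ} (hN : 0 ≤ N) (hu : ∀ j, ‖u j‖ = 1) (hB : 0 ≤ B)
    (h0 : ∀ j ∈ s, 0 < q j) (hq : ∀ j ∈ s, |q j| ≤ B) (hq1 : ∀ j ∈ s, |q₁ j| ≤ B)
    (hq2 : ∀ j ∈ s, |q₂ j| ≤ B) (x : Euc n) : |slabPotDdot N k s u q q₁ q₂ x| ≤
      s.card * (N * (k + 3) * (k + 3) * B ^ (k + 3)) * (‖x‖ ^ 2) ^ (k + 3) := by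
  refine (Finset.abs_sum_le_sum_abs _ _).trans ?_
  rw [mul_assoc, ← nsmul_eq_mul]
  refine Finset.sum_le_card_nsmul _ _ _ fun j hj => ?_
  have hs : ⟪x, u j⟫ ^ 2 ≤ ‖x‖ ^ 2 := by
    have := abs_real_inner_le_norm x (u j)
    rw [hu j, mul_one] at this
    exact sq_le_sq' (by linarith [neg_abs_le ⟪x, u j⟫]) ((le_abs_self _).trans this)
  have hqB : q j ≤ B := (le_abs_self _).trans (hq j hj)
  have hy : ⟪x, u j⟫ ^ 2 * q j ≤ ‖x‖ ^ 2 * B := by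
    have := h0 j hj
    gcongr
  have hy0 : 0 ≤ ⟪x, u j⟫ ^ 2 * q j := mul_nonneg (sq_nonneg _) (h0 j hj).le
  have hb := bumpDeriv_le (k := k) hN hy0
  have hb0 := bumpDeriv_nonneg (k := k) (y := ⟪x, u j⟫ ^ 2 * q j) hN
  have ha := bumpDerivTwo_le (k := k) hN hy0
  have ha0 := bumpDerivTwo_nonneg (k := k) (y := ⟪x, u j⟫ ^ 2 * q j) hN
  refine (abs_add_le _ _).trans ?_
  rw [abs_mul (bumpDerivTwo _ _ _), abs_mul (bumpDeriv _ _ _), abs_of_nonneg ha0,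
    abs_of_nonneg hb0, abs_mul _ (q₂ j), abs_pow, abs_mul _ (q₁ j),
    abs_of_nonneg (sq_nonneg ⟪x, u j⟫)]
  have h1 := hq1 j hj
  have h2 := hq2 j hj
  calc bumpDerivTwo N k (⟪x, u j⟫ ^ 2 * q j) * (⟪x, u j⟫ ^ 2 * |q₁ j|) ^ 2
        + bumpDeriv N k (⟪x, u j⟫ ^ 2 * q j) * (⟪x, u j⟫ ^ 2 * |q₂ j|)
      ≤ (N * (k + 3) * (k + 2) * (‖x‖ ^ 2 * B) ^ (k + 1)) * (‖x‖ ^ 2 * B) ^ 2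
        + (N * (k + 3) * (‖x‖ ^ 2 * B) ^ (k + 2)) * (‖x‖ ^ 2 * B) := by
        refine add_le_add (mul_le_mul (ha.trans ?_) ?_ (by positivity) (by positivity))
          (mul_le_mul (hb.trans ?_) ?_ (by positivity) (by positivity)) <;> gcongr
    _ = _ := by ring

lemma hasDerivAt_slabPot {q q₁ : ℝ → ℕ → ℝ} {t : ℝ}
    (h : ∀ j, HasDerivAt (fun t => q t j) (q₁ t j) t) (x : Euc n) :
    HasDerivAt (fun t => slabPot N k s u (q t) x) (slabPotDot N k s u (q t) (q₁ t) x) t :=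
  HasDerivAt.fun_sum fun j _ => (hasDerivAt_bump N k _).comp t ((h j).const_mul _)

lemma hasDerivAt_slabPotDot {q q₁ q₂ : ℝ → ℕ → ℝ} {t : ℝ}
    (h : ∀ j, HasDerivAt (fun t => q t j) (q₁ t j) t)
    (h1 : ∀ j, HasDerivAt (fun t => q₁ t j) (q₂ t j) t) (x : Euc n) :
    HasDerivAt (fun t => slabPotDot N k s u (q t) (q₁ t) x)
      (slabPotDdot N k s u (q t) (q₁ t) (q₂ t) x) t := by
  refine HasDerivAt.fun_sum fun j _ => ?_
  refine (((hasDerivAt_bumpDeriv N k _).comp t ((h j).const_mul _)).mul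
    ((h1 j).const_mul _)).congr_deriv ?_
  simp only [Function.comp_apply]
  ring

lemma hasDerivAt_wt_addGauss {V : ℝ → Euc n → ℝ} {V' t : ℝ} {x : Euc n}
    (h : HasDerivAt (fun t => V t x) V' t) :
    HasDerivAt (fun t => wt (addGauss (V t)) x) (-V' * wt (addGauss (V t)) x) t := by
  refine (((h.add_const (‖x‖ ^ 2 / 2)).neg).exp).congr_deriv ?_
  simp only [wt, addGauss, Pi.neg_apply]
  ring

/-- The mass of the slab density is log-concave along the curve. -/
theorem concaveOn_log_mass {δ : ℝ} {q q₁ q₂ : ℝ → ℕ → ℝ} (hn : 1 ≤ n) (hN : 0 ≤ N)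
    (hp : 0 ≤ p) (hp1 : p ≤ 1) (hδ : 0 < δ) (hδp : δ ≤ 2 * r ^ 2 / ((n : ℝ) + 1) - (1 - p))
    (hk : 1 ≤ 2 * δ * (k + 2)) (hu : ∀ j, ‖u j‖ = 1)
    (hq : ∀ j, IsSlabCurve p r (fun t => q t j) (fun t => q₁ t j) (fun t => q₂ t j)) :
    ConcaveOn ℝ (Set.Icc 0 1)
      fun t => Real.log (∫ x, wt (addGauss (slabPot N k s u (q t))) x) := by
  choose b hb0 hb using fun j => (hq j).exists_bound
  set B := ∑ j ∈ s, b j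
  have hB : 0 ≤ B := Finset.sum_nonneg fun j _ => hb0 j
  have hle : ∀ j ∈ s, b j ≤ B := fun j hj =>
    Finset.single_le_sum (f := b) (fun i _ => hb0 i) hj
  set V : ℝ → Euc n → ℝ := fun t => slabPot N k s u (q t)
  set φ : ℝ → Euc n → ℝ := fun t => slabPotDot N k s u (q t) (q₁ t)
  set χ : ℝ → Euc n → ℝ := fun t => slabPotDdot N k s u (q t) (q₁ t) (q₂ t)
  set D := (s.card : ℝ) * (N * (k + 3) * (k + 3) * B ^ (k + 3))
  have hV0 : ∀ t x, 0 ≤ V t x := fun t x => slabPot_nonneg hN x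
  have hφb : ∀ t ∈ Set.Icc (0 : ℝ) 1, ∀ x, |φ t x| ≤
      s.card * (N * (k + 3) * B ^ (k + 3)) * (‖x‖ ^ 2) ^ (k + 3) := fun t ht x =>
    abs_slabPotDot_le hN hu hB (fun j _ => (hq j).pos t ht)
      (fun j hj => (hb j t ht).1.trans (hle j hj)) (fun j hj => (hb j t ht).2.1.trans (hle j hj)) x
  have hχb : ∀ t ∈ Set.Icc (0 : ℝ) 1, ∀ x, |χ t x| ≤ D * (‖x‖ ^ 2) ^ (k + 3) := fun t ht x =>
    abs_slabPotDdot_le hN hu hB (fun j _ => (hq j).pos t ht)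
      (fun j hj => (hb j t ht).1.trans (hle j hj)) (fun j hj => (hb j t ht).2.1.trans (hle j hj))
      (fun j hj => (hb j t ht).2.2.trans (hle j hj)) x
  generalize (s.card : ℝ) * (N * (k + 3) * B ^ (k + 3)) = C at hφb
  have hwle : ∀ t x, wt (addGauss (V t)) x ≤ Real.exp (-(‖x‖ ^ 2 / 2)) := fun t x =>
    wt_addGauss_le (hV0 t) x
  have hVc : ∀ t, ContDiff ℝ 2 (V t) := fun t => contDiff_slabPot _ _ _ _ _
  have hwc : ∀ t, Continuous (wt (addGauss (V t))) := fun t =>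
    (contDiff_wt (contDiff_addGauss (hVc t))).continuous
  have hφc : ∀ t, ContDiff ℝ 1 (φ t) := fun t => contDiff_slabPotDot _ _ _ _ _ _
  have hχc : ∀ t, Continuous (χ t) := fun t => continuous_slabPotDdot _ _ _ _ _ _ _
  have hφc' : ∀ t, Continuous (φ t) := fun t => (hφc t).continuous
  have hint0 : Integrable fun x : Euc n => Real.exp (-(‖x‖ ^ 2 / 2)) := by
    simpa using integrable_pow_mul_exp_neg_norm_sq (n := n) 0
  have hint1 := integrable_pow_mul_exp_neg_norm_sq (n := n) (k + 3)
  have hint2 := integrable_pow_mul_exp_neg_norm_sq (n := n) (2 * (k + 3))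
  have hω : ∀ t, Integrable (wt (addGauss (V t))) := fun t =>
    hint0.mono' (hwc t).aestronglyMeasurable (Filter.Eventually.of_forall fun x => by
      rw [Real.norm_of_nonneg (wt_pos _ _).le]
      exact hwle t x)
  have hb1 : ∀ t ∈ Set.Icc (0 : ℝ) 1, ∀ x, ‖φ t x * wt (addGauss (V t)) x‖ ≤
      C * ((‖x‖ ^ 2) ^ (k + 3) * Real.exp (-(‖x‖ ^ 2 / 2))) := fun t ht x => by
    rw [norm_mul, Real.norm_of_nonneg (wt_pos _ _).le, Real.norm_eq_abs, ← mul_assoc]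
    exact mul_le_mul (hφb t ht x) (hwle t x) (wt_pos _ _).le ((abs_nonneg _).trans (hφb t ht x))
  have hb2 : ∀ t ∈ Set.Icc (0 : ℝ) 1, ∀ x, ‖φ t x ^ 2 * wt (addGauss (V t)) x‖ ≤
      C ^ 2 * ((‖x‖ ^ 2) ^ (2 * (k + 3)) * Real.exp (-(‖x‖ ^ 2 / 2))) := fun t ht x => by
    rw [norm_mul, Real.norm_of_nonneg (wt_pos _ _).le, Real.norm_eq_abs, ← mul_assoc, abs_pow]
    have h2 : |φ t x| ^ 2 ≤ C ^ 2 * (‖x‖ ^ 2) ^ (2 * (k + 3)) :=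
      (pow_le_pow_left₀ (abs_nonneg _) (hφb t ht x) 2).trans_eq (by ring)
    exact mul_le_mul h2 (hwle t x) (wt_pos _ _).le ((by positivity : (0:ℝ) ≤ |φ t x| ^ 2).trans h2)
  have hb3 : ∀ t ∈ Set.Icc (0 : ℝ) 1, ∀ x, ‖χ t x * wt (addGauss (V t)) x‖ ≤
      D * ((‖x‖ ^ 2) ^ (k + 3) * Real.exp (-(‖x‖ ^ 2 / 2))) := fun t ht x => by
    rw [norm_mul, Real.norm_of_nonneg (wt_pos _ _).le, Real.norm_eq_abs, ← mul_assoc]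
    exact mul_le_mul (hχb t ht x) (hwle t x) (wt_pos _ _).le ((abs_nonneg _).trans (hχb t ht x))
  have hφ1 : ∀ t ∈ Set.Icc (0 : ℝ) 1, Integrable fun x => φ t x * wt (addGauss (V t)) x :=
    fun t ht => (hint1.const_mul C).mono' ((hφc' t).mul (hwc t)).aestronglyMeasurable
      (Filter.Eventually.of_forall (hb1 t ht))
  have hφ2 : ∀ t ∈ Set.Icc (0 : ℝ) 1, Integrable fun x => φ t x ^ 2 * wt (addGauss (V t)) x :=
    fun t ht => (hint2.const_mul (C ^ 2)).mono'
      (((hφc' t).pow 2).mul (hwc t)).aestronglyMeasurable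
      (Filter.Eventually.of_forall (hb2 t ht))
  have hχ : ∀ t ∈ Set.Icc (0 : ℝ) 1, Integrable fun x => χ t x * wt (addGauss (V t)) x :=
    fun t ht => (hint1.const_mul D).mono' ((hχc t).mul (hwc t)).aestronglyMeasurable
      (Filter.Eventually.of_forall (hb3 t ht))
  have hdV : ∀ t ∈ Set.Icc (0 : ℝ) 1, ∀ x, HasDerivAt (fun t => wt (addGauss (V t)) x)
      (-(φ t x * wt (addGauss (V t)) x)) t := fun t ht x => by
    rw [← neg_mul]
    exact hasDerivAt_wt_addGauss (hasDerivAt_slabPot (fun j => (hq j).hasDerivAt t ht) x)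
  have hdφ : ∀ t ∈ Set.Icc (0 : ℝ) 1, ∀ x,
      HasDerivAt (fun t => -(φ t x * wt (addGauss (V t)) x))
        (φ t x ^ 2 * wt (addGauss (V t)) x - χ t x * wt (addGauss (V t)) x) t := fun t ht x => by
    have h1 : HasDerivAt (fun t => φ t x) (χ t x) t :=
      hasDerivAt_slabPotDot (fun j => (hq j).hasDerivAt t ht)
        (fun j => (hq j).hasDerivAt_deriv t ht) x
    refine (h1.mul (hdV t ht x)).neg.congr_deriv ?_
    ring
  have hpos : ∀ t, 0 < ∫ x, wt (addGauss (V t)) x := fun t => by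
    rw [integral_pos_iff_support_of_nonneg (fun x => (wt_pos _ x).le) (hω t)]
    have : Function.support (wt (addGauss (V t))) = Set.univ :=
      Set.eq_univ_of_forall fun x => (wt_pos _ x).ne'
    rw [this]
    exact Measure.measure_univ_pos.2 (NeZero.ne _)
  have hIoo : ∀ t ∈ Set.Ioo (0 : ℝ) 1, Set.Ioo (0 : ℝ) 1 ∈ nhds t := fun t ht =>
    Ioo_mem_nhds ht.1 ht.2
  have hZ1 : ∀ t ∈ Set.Ioo (0 : ℝ) 1, HasDerivAt (fun t => ∫ x, wt (addGauss (V t)) x)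
      (∫ x, -(φ t x * wt (addGauss (V t)) x)) t := fun t ht =>
    (hasDerivAt_integral_of_dominated_loc_of_deriv_le (hIoo t ht)
      (Filter.Eventually.of_forall fun t => (hwc t).aestronglyMeasurable) (hω t)
      ((hφc' t).mul (hwc t)).neg.aestronglyMeasurable
      (Filter.Eventually.of_forall fun x t ht => by
        rw [norm_neg]
        exact hb1 t (Set.Ioo_subset_Icc_self ht) x) (hint1.const_mul C)
      (Filter.Eventually.of_forall fun x t ht => hdV t (Set.Ioo_subset_Icc_self ht) x)).2
  have hZ2 : ∀ t ∈ Set.Ioo (0 : ℝ) 1,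
      HasDerivAt (fun t => ∫ x, -(φ t x * wt (addGauss (V t)) x))
      (∫ x, (φ t x ^ 2 * wt (addGauss (V t)) x - χ t x * wt (addGauss (V t)) x)) t := fun t ht =>
    (hasDerivAt_integral_of_dominated_loc_of_deriv_le (hIoo t ht)
      (Filter.Eventually.of_forall fun t => ((hφc' t).mul (hwc t)).neg.aestronglyMeasurable)
      (hφ1 t (Set.Ioo_subset_Icc_self ht)).neg
      ((((hφc' t).pow 2).mul (hwc t)).sub ((hχc t).mul (hwc t))).aestronglyMeasurable
      (Filter.Eventually.of_forall fun x t ht =>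
        (norm_sub_le _ _).trans (add_le_add (hb2 t (Set.Ioo_subset_Icc_self ht) x)
          (hb3 t (Set.Ioo_subset_Icc_self ht) x)))
      ((hint2.const_mul (C ^ 2)).add (hint1.const_mul D))
      (Filter.Eventually.of_forall fun x t ht => hdφ t (Set.Ioo_subset_Icc_self ht) x)).2
  have hcont : ContinuousOn (fun t => ∫ x, wt (addGauss (V t)) x) (Set.Icc 0 1) :=
    continuousOn_of_dominated (fun t _ => (hwc t).aestronglyMeasurable)
      (fun t _ => Filter.Eventually.of_forall fun x => by
        rw [Real.norm_of_nonneg (wt_pos _ _).le]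
        exact hwle t x) hint0
      (Filter.Eventually.of_forall fun x t ht => (hdV t ht x).continuousAt.continuousWithinAt)
  refine concaveOn_of_hasDerivWithinAt2_nonpos (convex_Icc 0 1)
    (f' := fun t => (∫ x, -(φ t x * wt (addGauss (V t)) x)) / ∫ x, wt (addGauss (V t)) x)
    (f'' := fun t => ((∫ x, (φ t x ^ 2 * wt (addGauss (V t)) x - χ t x * wt (addGauss (V t)) x))
      * (∫ x, wt (addGauss (V t)) x) - (∫ x, -(φ t x * wt (addGauss (V t)) x))
      * ∫ x, -(φ t x * wt (addGauss (V t)) x)) / (∫ x, wt (addGauss (V t)) x) ^ 2)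
    (hcont.log fun t _ => (hpos t).ne') (fun t ht => ?_) (fun t ht => ?_) (fun t ht => ?_)
  · rw [interior_Icc] at ht
    exact ((hZ1 t ht).log (hpos t).ne').hasDerivWithinAt
  · rw [interior_Icc] at ht
    exact ((hZ2 t ht).div (hZ1 t ht) (hpos t).ne').hasDerivWithinAt
  · rw [interior_Icc] at ht
    have ht' := Set.Ioo_subset_Icc_self ht
    have key := variance_le_of_quadratic hn (hVc t) (slabPot_neg _ _ _ _ _)
      (hess_slabPot_nonneg hN fun j => (hq j).pos t ht') (hφc t) (slabPotDot_neg _ _ _ _ _ _)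
      (hω t) (hφ1 t ht') (hφ2 t ht') (hχ t ht')
      (slabPot_quadratic_nonneg hN hp hp1 hδ hδp hk hu (fun j => (hq j).pos t ht')
        (fun j => (hq j).mul_le t ht') fun j => (hq j).sq_le t ht')
    refine div_nonpos_of_nonpos_of_nonneg ?_ (sq_nonneg _)
    rw [integral_neg, integral_sub (hφ2 t ht') (hχ t ht')]
    nlinarith

end Curve

/-! ### `L_p` means of two positive numbers -/

section Mean

/-- The weighted `L_p` mean of two positive numbers (geometric for `p = 0`). -/
def lpMean (p t a b : ℝ) : ℝ :=
  if p = 0 then a ^ t * b ^ (1 - t) else (t * a ^ p + (1 - t) * b ^ p) ^ (1 / p)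

lemma lpComb_eq {n : ℕ} (p lam : ℝ) (K L : Set (Euc n)) :
    lpComb p lam K L =
      {x | ∀ u : Euc n, ‖u‖ = 1 → ⟪x, u⟫ ≤ lpMean p lam (suppFn K u) (suppFn L u)} := by
  unfold lpComb lpMean
  split_ifs <;> rfl

variable {p r a b : ℝ}

lemma lpMean_one (hp : 0 ≤ p) (ha : 0 < a) : lpMean p 1 a b = a := by
  unfold lpMean
  split_ifs with h
  · simp
  · have : 0 < p := lt_of_le_of_ne hp (Ne.symm h)
    simp [← Real.rpow_mul ha.le, h]

lemma lpMean_zero (hp : 0 ≤ p) (hb : 0 < b) : lpMean p 0 a b = b := by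
  unfold lpMean
  split_ifs with h
  · simp
  · have : 0 < p := lt_of_le_of_ne hp (Ne.symm h)
    simp [← Real.rpow_mul hb.le, h]

lemma le_sum_rpow {t : ℝ} (hp : 0 ≤ p) (hr : 0 < r) (ha : r ≤ a) (hb : r ≤ b)
    (ht : t ∈ Set.Icc (0 : ℝ) 1) : r ^ p ≤ t * a ^ p + (1 - t) * b ^ p := by
  have h1 := Real.rpow_le_rpow hr.le ha hp
  have h2 := Real.rpow_le_rpow hr.le hb hp
  nlinarith [mul_le_mul_of_nonneg_left h1 ht.1,
    mul_le_mul_of_nonneg_left h2 (sub_nonneg.2 ht.2)]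

lemma le_lpMean {t : ℝ} (hp : 0 ≤ p) (hr : 0 < r) (ha : r ≤ a) (hb : r ≤ b)
    (ht : t ∈ Set.Icc (0 : ℝ) 1) : r ≤ lpMean p t a b := by
  unfold lpMean
  split_ifs with h
  · calc r = r ^ t * r ^ (1 - t) := by rw [← Real.rpow_add hr]; simp
      _ ≤ _ := mul_le_mul (Real.rpow_le_rpow hr.le ha ht.1)
        (Real.rpow_le_rpow hr.le hb (sub_nonneg.2 ht.2)) (by positivity)
        (Real.rpow_nonneg (hr.le.trans ha) _)
  · calc r = (r ^ p) ^ (1 / p) := by simp [← Real.rpow_mul hr.le, h]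
      _ ≤ _ := Real.rpow_le_rpow (by positivity) (le_sum_rpow hp hr ha hb ht) (by positivity)

lemma lpMean_mul {t c : ℝ} (hc : 0 < c) (ha : 0 < a) (hb : 0 < b)
    (ht : t ∈ Set.Icc (0 : ℝ) 1) : lpMean p t (c * a) (c * b) = c * lpMean p t a b := by
  unfold lpMean
  split_ifs with h
  · rw [Real.mul_rpow hc.le ha.le, Real.mul_rpow hc.le hb.le, mul_mul_mul_comm,
      ← Real.rpow_add hc]
    simp
  · have h1 : 0 ≤ 1 - t := sub_nonneg.2 ht.2
    have h0 := ht.1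
    rw [Real.mul_rpow hc.le ha.le, Real.mul_rpow hc.le hb.le,
      show t * (c ^ p * a ^ p) + (1 - t) * (c ^ p * b ^ p)
        = c ^ p * (t * a ^ p + (1 - t) * b ^ p) from by ring,
      Real.mul_rpow (by positivity) (by positivity), ← Real.rpow_mul hc.le]
    simp [h]

lemma exists_isSlabCurve (hp : 0 ≤ p) (hr : 0 < r) (ha : r ≤ a) (hb : r ≤ b) :
    ∃ q q₁ q₂ : ℝ → ℝ, IsSlabCurve p r q q₁ q₂ ∧
      ∀ t ∈ Set.Icc (0 : ℝ) 1, q t = (lpMean p t a b ^ 2)⁻¹ := by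
  have ha0 := hr.trans_le ha
  have hb0 := hr.trans_le hb
  have main : ∀ q q₁ q₂ : ℝ → ℝ, (∀ t ∈ Set.Icc (0 : ℝ) 1, q t = (lpMean p t a b ^ 2)⁻¹) →
      (∀ t ∈ Set.Icc (0 : ℝ) 1, HasDerivAt q (q₁ t) t) →
      (∀ t ∈ Set.Icc (0 : ℝ) 1, HasDerivAt q₁ (q₂ t) t) → ContinuousOn q₂ (Set.Icc 0 1) →
      (∀ t ∈ Set.Icc (0 : ℝ) 1, (1 + p / 2) * q₁ t ^ 2 ≤ q t * q₂ t) →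
      ∃ q q₁ q₂ : ℝ → ℝ, IsSlabCurve p r q q₁ q₂ ∧
      ∀ t ∈ Set.Icc (0 : ℝ) 1, q t = (lpMean p t a b ^ 2)⁻¹ := by
    intro q q₁ q₂ h0 h1 h2 h3 h4
    refine ⟨q, q₁, q₂, ⟨fun t ht => ?_, fun t ht => ?_, h1, h2, h3, h4⟩, h0⟩
    · have := hr.trans_le (le_lpMean hp hr ha hb ht)
      rw [h0 t ht]
      positivity
    · have h := le_lpMean hp hr ha hb ht
      have := hr.trans_le h
      rw [h0 t ht, inv_mul_le_iff₀ (by positivity), mul_one]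
      gcongr
  by_cases h : p = 0
  · subst h
    set c := -2 * (Real.log a - Real.log b)
    set d := -2 * Real.log b
    have hd : ∀ t, HasDerivAt (fun t => Real.exp (t * c + d)) (c * Real.exp (t * c + d)) t := by
      intro t
      refine ((((hasDerivAt_id t).mul_const c).add_const d).exp).congr_deriv ?_
      simp only [id]
      ring
    refine main (fun t => Real.exp (t * c + d)) (fun t => c * Real.exp (t * c + d))
      (fun t => c * (c * Real.exp (t * c + d))) (fun t _ => ?_) (fun t _ => hd t)
      (fun t _ => (hd t).const_mul c) (by fun_prop) (fun t _ => le_of_eq (by ring))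
    rw [lpMean, if_pos rfl, Real.rpow_def_of_pos ha0, Real.rpow_def_of_pos hb0, ← Real.exp_add,
      ← Real.exp_nat_mul, ← Real.exp_neg]
    congr 1
    simp only [c, d]
    push_cast
    ring
  · have hp0 : 0 < p := lt_of_le_of_ne hp (Ne.symm h)
    set g : ℝ → ℝ := fun t => t * a ^ p + (1 - t) * b ^ p
    set d := a ^ p - b ^ p
    have hg : ∀ t ∈ Set.Icc (0 : ℝ) 1, 0 < g t := fun t ht =>
      (by positivity : 0 < r ^ p).trans_le (le_sum_rpow hp hr ha hb ht)
    have hgd : ∀ t, HasDerivAt g d t := fun t => by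
      refine (((hasDerivAt_id t).mul_const (a ^ p)).add
        (((hasDerivAt_id t).const_sub 1).mul_const (b ^ p))).congr_deriv ?_
      simp only [d]
      ring
    have hpow : ∀ e : ℝ, ∀ t ∈ Set.Icc (0 : ℝ) 1,
        HasDerivAt (fun t => g t ^ e) (d * e * g t ^ (e - 1)) t := fun e t ht =>
      (hgd t).rpow_const (Or.inl (hg t ht).ne')
    refine main (fun t => g t ^ (-(2 / p))) (fun t => d * (-(2 / p)) * g t ^ (-(2 / p) - 1))
      (fun t => d * (-(2 / p)) * (d * (-(2 / p) - 1) * g t ^ (-(2 / p) - 1 - 1)))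
      (fun t ht => ?_) (hpow _) (fun t ht => (hpow _ t ht).const_mul _) ?_ (fun t ht => ?_)
    · rw [lpMean, if_neg h, Real.rpow_neg (hg t ht).le]
      congr 1
      change g t ^ (2 / p) = (g t ^ (1 / p)) ^ 2
      rw [← Real.rpow_natCast, ← Real.rpow_mul (hg t ht).le]
      congr 1
      push_cast
      ring
    · exact fun t ht => ((((hpow _ t ht).const_mul _).const_mul _).continuousAt).continuousWithinAt
    · have e1 : g t ^ (-(2 / p)) * g t ^ (-(2 / p) - 1 - 1) = (g t ^ (-(2 / p) - 1)) ^ 2 := by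
        rw [sq, ← Real.rpow_add (hg t ht), ← Real.rpow_add (hg t ht)]
        congr 1
        ring
      refine le_of_eq ?_
      calc (1 + p / 2) * (d * (-(2 / p)) * g t ^ (-(2 / p) - 1)) ^ 2
          = (1 + p / 2) * (d * (2 / p)) ^ 2 * (g t ^ (-(2 / p) - 1)) ^ 2 := by ring
        _ = (1 + p / 2) * (d * (2 / p)) ^ 2
            * (g t ^ (-(2 / p)) * g t ^ (-(2 / p) - 1 - 1)) := by rw [e1]
        _ = (d * (2 / p) * (d * (2 / p + 1)))
            * (g t ^ (-(2 / p)) * g t ^ (-(2 / p) - 1 - 1)) := by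
            congr 1
            field_simp
        _ = _ := by ring

end Mean

/-! ### Passage to countable intersections of slabs -/

section Slabs

variable {n : ℕ}

/-- The intersection of the symmetric slabs `|⟨x, uⱼ⟩| ≤ aⱼ`. -/
def slabs (u : ℕ → Euc n) (a : ℕ → ℝ) : Set (Euc n) := {x | ∀ j, |⟪x, u j⟫| ≤ a j}

lemma isClosed_slabs (u : ℕ → Euc n) (a : ℕ → ℝ) : IsClosed (slabs u a) := by
  rw [show slabs u a = ⋂ j, {x | |⟪x, u j⟫| ≤ a j} from Set.ofPred_forall _]
  exact isClosed_iInter fun j => isClosed_le (by fun_prop) continuous_const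

lemma inner_sq_mul_le_one_iff {x v : Euc n} {c : ℝ} (hc : 0 < c) :
    ⟪x, v⟫ ^ 2 * (c ^ 2)⁻¹ ≤ 1 ↔ |⟪x, v⟫| ≤ c := by
  rw [mul_inv_le_iff₀ (by positivity), one_mul, sq_le_sq, abs_of_pos hc]

variable {p r lam N : ℝ} {k : ℕ} {u : ℕ → Euc n} {a b : ℕ → ℝ} {A B : Set (Euc n)}

lemma integrable_exp_neg_norm_sq_div_two :
    Integrable fun x : Euc n => Real.exp (-‖x‖ ^ 2 / 2) := by
  refine (integrable_exp_neg_mul_norm_sq (b := 1 / 2) (by norm_num)).congr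
    (Filter.Eventually.of_forall fun x => ?_)
  simp only
  congr 1
  ring

lemma integrable_wt_slabPot (hN : 0 ≤ N) (s : Finset ℕ) (q : ℕ → ℝ) :
    Integrable (wt (addGauss (slabPot N k s u q))) := by
  refine integrable_exp_neg_norm_sq_div_two.mono'
    (contDiff_wt (contDiff_addGauss (contDiff_slabPot N k s u q))).continuous.aestronglyMeasurable
    (Filter.Eventually.of_forall fun x => ?_)
  rw [Real.norm_of_nonneg (wt_pos _ _).le, neg_div]
  exact wt_addGauss_le (fun x => slabPot_nonneg hN x) x

lemma integral_slabs_le_mass (hN : 0 ≤ N) (s : Finset ℕ) (ha : ∀ j, 0 < a j)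
    (hA : MeasurableSet A) (hAs : A ⊆ slabs u a) {q : ℕ → ℝ} (hq : ∀ j, q j = (a j ^ 2)⁻¹) :
    ∫ x in A, Real.exp (-‖x‖ ^ 2 / 2) ≤ ∫ x, wt (addGauss (slabPot N k s u q)) x := by
  rw [← integral_indicator hA]
  refine integral_mono (integrable_exp_neg_norm_sq_div_two.indicator hA)
    (integrable_wt_slabPot hN s q) fun x => ?_
  by_cases hx : x ∈ A
  · rw [Set.indicator_of_mem hx]
    have h0 : slabPot N k s u q x = 0 := Finset.sum_eq_zero fun j _ => by
      rw [hq j]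
      exact bump_eq_zero ((inner_sq_mul_le_one_iff (ha j)).2 (hAs hx j))
    simp only [wt, addGauss, h0, zero_add]
    rw [neg_div]
  · rw [Set.indicator_of_notMem hx]
    exact (wt_pos _ _).le

lemma tendsto_wt_slabPot (ha : ∀ j, 0 < a j) {q : ℕ → ℝ} (hq : ∀ j, q j = (a j ^ 2)⁻¹)
    (x : Euc n) : Filter.Tendsto (fun m : ℕ => wt (addGauss (slabPot m k (Finset.range m) u q)) x)
      Filter.atTop (nhds ((slabs u a).indicator (fun x => Real.exp (-‖x‖ ^ 2 / 2)) x)) := by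
  by_cases hx : x ∈ slabs u a
  · rw [Set.indicator_of_mem hx]
    refine tendsto_const_nhds.congr fun m => ?_
    have h0 : slabPot m k (Finset.range m) u q x = 0 := Finset.sum_eq_zero fun j _ => by
      rw [hq j]
      exact bump_eq_zero ((inner_sq_mul_le_one_iff (ha j)).2 (hx j))
    simp only [wt, addGauss, h0, zero_add]
    rw [neg_div]
  · rw [Set.indicator_of_notMem hx]
    obtain ⟨j, hj⟩ : ∃ j, ¬ |⟪x, u j⟫| ≤ a j := by
      by_contra! h
      exact hx h
    rw [← inner_sq_mul_le_one_iff (ha j), ← hq j, not_le] at hj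
    set c := max (⟪x, u j⟫ ^ 2 * q j - 1) 0 ^ (k + 3) with hc
    have hc0 : 0 < c := pow_pos (lt_max_of_lt_left (sub_pos.2 hj)) _
    refine Real.tendsto_exp_neg_atTop_nhds_zero.comp
      (Filter.tendsto_atTop_mono' _ ?_ (tendsto_natCast_atTop_atTop.atTop_mul_const hc0))
    filter_upwards [Filter.eventually_gt_atTop j] with m hm
    have h1 : bump m k (⟪x, u j⟫ ^ 2 * q j) ≤ slabPot m k (Finset.range m) u q x :=
      Finset.single_le_sum (f := fun j => bump m k (⟪x, u j⟫ ^ 2 * q j))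
        (fun i _ => bump_nonneg (Nat.cast_nonneg m)) (Finset.mem_range.2 hm)
    have h2 : bump m k (⟪x, u j⟫ ^ 2 * q j) = m * c := rfl
    have h3 : 0 ≤ ‖x‖ ^ 2 / 2 := by positivity
    simp only [addGauss]
    linarith

theorem integral_slabs_lpMean (hn : 1 ≤ n) (hr : 0 < r) (hp : p ∈ Set.Icc (0 : ℝ) 1)
    (hpr : 0 < 2 * r ^ 2 / ((n : ℝ) + 1) - (1 - p)) (hu : ∀ j, ‖u j‖ = 1)
    (ha : ∀ j, r ≤ a j) (hb : ∀ j, r ≤ b j) (hA : MeasurableSet A) (hB : MeasurableSet B)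
    (hAs : A ⊆ slabs u a) (hBs : B ⊆ slabs u b) (hl : lam ∈ Set.Icc (0 : ℝ) 1) :
    (∫ x in A, Real.exp (-‖x‖ ^ 2 / 2)) ^ lam * (∫ x in B, Real.exp (-‖x‖ ^ 2 / 2)) ^ (1 - lam)
      ≤ ∫ x in slabs u fun j => lpMean p lam (a j) (b j), Real.exp (-‖x‖ ^ 2 / 2) := by
  set δ := 2 * r ^ 2 / ((n : ℝ) + 1) - (1 - p)
  obtain ⟨k, hk⟩ := exists_nat_ge (1 / (2 * δ))
  have hk' : 1 ≤ 2 * δ * (k + 2) := by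
    rw [div_le_iff₀ (by positivity)] at hk
    nlinarith
  choose q q₁ q₂ hq hqe using fun j => exists_isSlabCurve hp.1 hr (ha j) (hb j)
  set I : ℝ → ℕ → ℝ := fun t m =>
    ∫ x, wt (addGauss (slabPot m k (Finset.range m) u fun j => q j t)) x
  have hM : ∀ j, 0 < lpMean p lam (a j) (b j) := fun j =>
    hr.trans_le (le_lpMean hp.1 hr (ha j) (hb j) hl)
  have hlim : Filter.Tendsto (I lam) Filter.atTop
      (nhds (∫ x in slabs u fun j => lpMean p lam (a j) (b j), Real.exp (-‖x‖ ^ 2 / 2))) := by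
    rw [← integral_indicator (isClosed_slabs _ _).measurableSet]
    refine tendsto_integral_of_dominated_convergence (fun x => Real.exp (-‖x‖ ^ 2 / 2))
      (fun m => (integrable_wt_slabPot m.cast_nonneg _ _).aestronglyMeasurable)
      integrable_exp_neg_norm_sq_div_two
      (fun m => Filter.Eventually.of_forall fun x => ?_)
      (Filter.Eventually.of_forall fun x => tendsto_wt_slabPot hM (fun j => hqe j lam hl) x)
    rw [Real.norm_of_nonneg (wt_pos _ _).le, neg_div]
    exact wt_addGauss_le (fun x => slabPot_nonneg m.cast_nonneg x) x
  refine ge_of_tendsto' hlim fun m => ?_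
  have hI : ∀ t, 0 < I t m := fun t => by
    rw [show I t m = _ from rfl, integral_pos_iff_support_of_nonneg (fun x => (wt_pos _ x).le)
      (integrable_wt_slabPot m.cast_nonneg _ _)]
    rw [Set.eq_univ_of_forall (s := Function.support _) fun x => (wt_pos _ x).ne']
    exact Measure.measure_univ_pos.2 (NeZero.ne _)
  have h1 : ∫ x in A, Real.exp (-‖x‖ ^ 2 / 2) ≤ I 1 m :=
    integral_slabs_le_mass m.cast_nonneg _ (fun j => hr.trans_le (ha j)) hA hAs fun j => by
      rw [hqe j 1 (by simp), lpMean_one hp.1 (hr.trans_le (ha j))]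
  have h0 : ∫ x in B, Real.exp (-‖x‖ ^ 2 / 2) ≤ I 0 m :=
    integral_slabs_le_mass m.cast_nonneg _ (fun j => hr.trans_le (hb j)) hB hBs fun j => by
      rw [hqe j 0 (by simp), lpMean_zero hp.1 (hr.trans_le (hb j))]
  have hconc := (concaveOn_log_mass (N := m) (k := k) (s := Finset.range m) (u := u)
    (q := fun t j => q j t) (q₁ := fun t j => q₁ j t) (q₂ := fun t j => q₂ j t)
    hn m.cast_nonneg hp.1 hp.2 hpr le_rfl hk' hu hq).2
    (x := 1) (y := 0) (by simp) (by simp) hl.1 (sub_nonneg.2 hl.2) (by ring)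
  simp only [smul_eq_mul, mul_one, mul_zero, add_zero] at hconc
  calc _ ≤ I 1 m ^ lam * I 0 m ^ (1 - lam) := by
        refine mul_le_mul (Real.rpow_le_rpow ?_ h1 hl.1)
          (Real.rpow_le_rpow ?_ h0 (sub_nonneg.2 hl.2)) ?_ (Real.rpow_nonneg (hI 1).le _)
        · exact integral_nonneg fun x => (Real.exp_pos _).le
        · exact integral_nonneg fun x => (Real.exp_pos _).le
        · exact Real.rpow_nonneg (integral_nonneg fun x => (Real.exp_pos _).le) _
    _ = Real.exp (lam * Real.log (I 1 m) + (1 - lam) * Real.log (I 0 m)) := by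
        rw [Real.rpow_def_of_pos (hI 1), Real.rpow_def_of_pos (hI 0), ← Real.exp_add]
        ring_nf
    _ ≤ Real.exp (Real.log (I lam m)) := Real.exp_le_exp.2 hconc
    _ = I lam m := Real.exp_log (hI lam)

lemma gaussianMeasure_apply (hA : MeasurableSet A) : gaussianMeasure n A =
    ENNReal.ofReal ((2 * Real.pi) ^ (-(n : ℝ) / 2) * ∫ x in A, Real.exp (-‖x‖ ^ 2 / 2)) := by
  rw [gaussianMeasure, withDensity_apply _ hA, ← integral_const_mul,
    ofReal_integral_eq_lintegral_ofReal]
  · exact (integrable_exp_neg_norm_sq_div_two.const_mul _).integrableOn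
  · exact Filter.Eventually.of_forall fun x => by positivity

theorem gaussianMeasure_slabs_lpMean (hn : 1 ≤ n) (hr : 0 < r) (hp : p ∈ Set.Icc (0 : ℝ) 1)
    (hpr : 0 < 2 * r ^ 2 / ((n : ℝ) + 1) - (1 - p)) (hu : ∀ j, ‖u j‖ = 1)
    (ha : ∀ j, r ≤ a j) (hb : ∀ j, r ≤ b j) (hA : MeasurableSet A) (hB : MeasurableSet B)
    (hAs : A ⊆ slabs u a) (hBs : B ⊆ slabs u b) (hl : lam ∈ Set.Icc (0 : ℝ) 1) :
    gaussianMeasure n A ^ lam * gaussianMeasure n B ^ (1 - lam)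
      ≤ gaussianMeasure n (slabs u fun j => lpMean p lam (a j) (b j)) := by
  have h := integral_slabs_lpMean hn hr hp hpr hu ha hb hA hB hAs hBs hl
  have hl1 : 0 ≤ 1 - lam := sub_nonneg.2 hl.2
  rw [gaussianMeasure_apply hA, gaussianMeasure_apply hB,
    gaussianMeasure_apply (isClosed_slabs _ _).measurableSet]
  set c : ℝ := (2 * Real.pi) ^ (-(n : ℝ) / 2)
  have hc : 0 < c := by positivity
  have hIA : 0 ≤ ∫ x in A, Real.exp (-‖x‖ ^ 2 / 2) := integral_nonneg fun x => (Real.exp_pos _).le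
  have hIB : 0 ≤ ∫ x in B, Real.exp (-‖x‖ ^ 2 / 2) := integral_nonneg fun x => (Real.exp_pos _).le
  rw [ENNReal.ofReal_rpow_of_nonneg (by positivity) hl.1,
    ENNReal.ofReal_rpow_of_nonneg (by positivity) hl1, ← ENNReal.ofReal_mul (by positivity),
    Real.mul_rpow hc.le hIA, Real.mul_rpow hc.le hIB, mul_mul_mul_comm, ← Real.rpow_add hc]
  refine ENNReal.ofReal_le_ofReal ?_
  rw [add_sub_cancel, Real.rpow_one]
  gcongr

end Slabs

/-! ### Support functions and the conclusion -/

section Conclusion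

variable {n : ℕ} {K : Set (Euc n)}

lemma continuous_suppFn (hK : IsCompact K) : Continuous (suppFn K) :=
  hK.continuous_sSup (f := fun u y => ⟪u, y⟫) (by fun_prop)

lemma inner_le_suppFn (hK : IsCompact K) {x : Euc n} (hx : x ∈ K) (u : Euc n) :
    ⟪u, x⟫ ≤ suppFn K u :=
  le_csSup (hK.image (f := fun y => ⟪u, y⟫) (by fun_prop)).bddAbove ⟨x, hx, rfl⟩

lemma abs_inner_le_suppFn (hK : IsCompact K) (hs : K = -K) {x : Euc n} (hx : x ∈ K)
    (u : Euc n) : |⟪x, u⟫| ≤ suppFn K u := by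
  rw [real_inner_comm, abs_le']
  refine ⟨inner_le_suppFn hK hx u, ?_⟩
  rw [hs] at hx
  simpa using inner_le_suppFn hK (Set.mem_neg.1 hx) u

lemma le_suppFn {r : ℝ} (hK : IsCompact K) (hr : 0 ≤ r)
    (hKr : Metric.closedBall (0 : Euc n) r ⊆ K) {u : Euc n} (hu : ‖u‖ = 1) : r ≤ suppFn K u := by
  have h := inner_le_suppFn hK (hKr (a := r • u) (by simp [norm_smul, hu, abs_of_nonneg hr])) u
  rwa [real_inner_smul_right, real_inner_self_eq_norm_sq, hu, one_pow, mul_one] at h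

lemma continuous_lpMean {X : Type*} [TopologicalSpace X] {p t r : ℝ} {f g : X → ℝ}
    (hp : 0 ≤ p) (hr : 0 < r) (hf : Continuous f) (hg : Continuous g) (hfr : ∀ x, r ≤ f x)
    (hgr : ∀ x, r ≤ g x) (ht : t ∈ Set.Icc (0 : ℝ) 1) :
    Continuous fun x => lpMean p t (f x) (g x) := by
  have hf0 : ∀ x, f x ≠ 0 := fun x => (hr.trans_le (hfr x)).ne'
  have hg0 : ∀ x, g x ≠ 0 := fun x => (hr.trans_le (hgr x)).ne'
  unfold lpMean
  split_ifs with h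
  · exact (hf.rpow_const fun x => Or.inl (hf0 x)).mul (hg.rpow_const fun x => Or.inl (hg0 x))
  · refine Continuous.rpow_const ?_ fun x => Or.inl ?_
    · exact ((hf.rpow_const fun x => Or.inl (hf0 x)).const_mul _).add
        ((hg.rpow_const fun x => Or.inl (hg0 x)).const_mul _)
    · exact ((by positivity : 0 < r ^ p).trans_le (le_sum_rpow hp hr (hfr x) (hgr x) ht)).ne'

end Conclusion

/-- Corollary 1.7(1): for the Gaussian measure and origin-symmetric convex bodies
`K, L ⊇ rB₂ⁿ`, if `p ∈ [0,1]` and `p ≥ 1 - 2r²/(n+1)`, then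
`γ(λK +_p (1-λ)L) ≥ γ(K)^λ γ(L)^{1-λ}`. -/
theorem gaussian_lp_BM (n : ℕ) (hn : 1 ≤ n) (r : ℝ) (hr : 0 < r)
    (K L : Set (Euc n)) (hK : IsConvexBody K) (hL : IsConvexBody L)
    (hKsym : K = -K) (hLsym : L = -L)
    (hKr : Metric.closedBall (0 : Euc n) r ⊆ K)
    (hLr : Metric.closedBall (0 : Euc n) r ⊆ L)
    (p : ℝ) (hp : p ∈ Set.Icc (0:ℝ) 1)
    (hpr : 1 - 2 * r ^ 2 / ((n : ℝ) + 1) ≤ p) :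
    ∀ lam ∈ Set.Icc (0:ℝ) 1,
      gaussianMeasure n K ^ lam * gaussianMeasure n L ^ (1 - lam)
        ≤ gaussianMeasure n (lpComb p lam K L) := by
  intro lam hl
  have : Nonempty (Fin n) := ⟨⟨0, hn⟩⟩
  have : Nonempty (Metric.sphere (0 : Euc n) 1) :=
    (NormedSpace.sphere_nonempty.2 zero_le_one).to_subtype
  set e := TopologicalSpace.denseSeq (Metric.sphere (0 : Euc n) 1)
  set u : ℕ → Euc n := fun j => e j
  have hsph : ∀ v : Metric.sphere (0 : Euc n) 1, ‖(v : Euc n)‖ = 1 := fun v => by simp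
  have hu : ∀ j, ‖u j‖ = 1 := fun j => hsph (e j)
  set M : Euc n → ℝ := fun v => lpMean p lam (suppFn K v) (suppFn L v)
  have hKle : ∀ v : Metric.sphere (0 : Euc n) 1, r ≤ suppFn K v := fun v =>
    le_suppFn hK.1 hr.le hKr (hsph v)
  have hLle : ∀ v : Metric.sphere (0 : Euc n) 1, r ≤ suppFn L v := fun v =>
    le_suppFn hL.1 hr.le hLr (hsph v)
  have hM0 : ∀ j, 0 < M (u j) := fun j => hr.trans_le (le_lpMean hp.1 hr (hKle _) (hLle _) hl)
  set c : ℕ → ℝ := fun i => 1 + 1 / ((i : ℝ) + 1)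
  have hc : ∀ i, 1 < c i := fun i => lt_add_of_pos_right _ (by positivity)
  have hc0 : ∀ i, 0 < c i := fun i => one_pos.trans (hc i)
  set T : ℕ → Set (Euc n) := fun i => slabs u fun j => c i * M (u j)
  have hT : ∀ i, gaussianMeasure n K ^ lam * gaussianMeasure n L ^ (1 - lam)
      ≤ gaussianMeasure n (T i) := fun i => by
    have hsub : ∀ {A : Set (Euc n)}, IsCompact A → A = -A →
        A ⊆ slabs u fun j => c i * suppFn A (u j) := fun hA hAs x hx j => by
      have h := abs_inner_le_suppFn hA hAs hx (u j)
      exact h.trans (le_mul_of_one_le_left ((abs_nonneg _).trans h) (hc i).le)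
    have h := gaussianMeasure_slabs_lpMean (r := c i * r) (lam := lam) (p := p) hn
      (mul_pos (hc0 i) hr) hp ?_ hu (fun j => mul_le_mul_of_nonneg_left (hKle (e j)) (hc0 i).le)
      (fun j => mul_le_mul_of_nonneg_left (hLle (e j)) (hc0 i).le) hK.1.measurableSet
      hL.1.measurableSet (hsub hK.1 hKsym) (hsub hL.1 hLsym) hl
    · refine h.trans_eq ?_
      congr 2
      funext j
      exact lpMean_mul (hc0 i) (hr.trans_le (hKle (e j))) (hr.trans_le (hLle (e j))) hl
    · have h1 : 2 * r ^ 2 / ((n : ℝ) + 1) < 2 * (c i * r) ^ 2 / ((n : ℝ) + 1) := by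
        have : r < c i * r := lt_mul_of_one_lt_left hr (hc i)
        gcongr
      linarith
  have hanti : Antitone T := fun i i' hii x hx j => by
    refine (hx j).trans (mul_le_mul_of_nonneg_right ?_ (hM0 j).le)
    simp only [c]
    gcongr
  have hfin : gaussianMeasure n (T 0) ≠ ⊤ := by
    rw [gaussianMeasure_apply (isClosed_slabs _ _).measurableSet]
    exact ENNReal.ofReal_ne_top
  have hinter : ⋂ i, T i ⊆ lpComb p lam K L := by
    intro x hx
    rw [lpComb_eq]
    have hxj : ∀ j, ⟪x, u j⟫ ≤ M (u j) := fun j => by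
      have hlim : Filter.Tendsto (fun i => c i * M (u j)) Filter.atTop (nhds (M (u j))) := by
        have := ((tendsto_one_div_add_atTop_nhds_zero_nat (𝕜 := ℝ)).const_add 1).mul_const (M (u j))
        simpa [c] using this
      exact ge_of_tendsto' hlim fun i => (le_abs_self _).trans (Set.mem_iInter.1 hx i j)
    have hcl : IsClosed {v : Metric.sphere (0 : Euc n) 1 | ⟪x, (v : Euc n)⟫ ≤ M v} :=
      isClosed_le (by fun_prop) (continuous_lpMean hp.1 hr
        ((continuous_suppFn hK.1).comp continuous_subtype_val)
        ((continuous_suppFn hL.1).comp continuous_subtype_val) hKle hLle hl)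
    intro v hv
    exact isClosed_property (TopologicalSpace.denseRange_denseSeq _) hcl hxj ⟨v, by simpa using hv⟩
  refine le_trans ?_ (measure_mono hinter)
  rw [hanti.measure_iInter (fun i => (isClosed_slabs _ _).measurableSet.nullMeasurableSet)
    ⟨0, hfin⟩]
  exact le_iInf hT

end
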